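/- Every module-algebra structure of U_q(sl(3)) on the quantum 3-space A_q(3) is isomorphic to one of the following nine kinds, where (i,j) = (1,2) or (2,1), and no two structures of different kinds are isomorphic (values of e's and f's on generators not listed are zero): (1) k_i(x_s) = ε_sx_s, k_j(x_s) = δ_sx_s with ε_s, δ_s ∈ {1,−1}, all e's and f's zero on generators; (2) k_i = (q⁻², q⁻¹, q⁻¹) and k_j = (q, q, q²) on (x_1,x_2,x_3), e_i(x_1) = 1, e_j(x_1) = −qx_1x_3, e_j(x_2) = −qx_2x_3, e_j(x_3) = −qx_3², f_i(x_1) = −qx_1², f_i(x_2) = −qx_1x_2, f_i(x_3) = −qx_1x_3, f_j(x_3) = 1; (3) k_i = (q⁻², q⁻¹, q⁻¹), k_j = (q, q⁻¹, 1), e_i(x_1) = 1, e_j(x_2) = x_1, f_i(x_1) = −qx_1², f_i(x_2) = −qx_1x_2, f_i(x_3) = −qx_1x_3, f_j(x_1) = x_2; (4) k_i = (q, q, q²), k_j = (1, q, q⁻¹), e_i(x_1) = −qx_1x_3, e_i(x_2) = −qx_2x_3, e_i(x_3) = −qx_3², e_j(x_3) = x_2, f_i(x_3) = 1, f_j(x_2)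 = x_3; (5) k_i = (q, q⁻¹, 1), k_j = (1, q, q⁻¹), e_i(x_2) = x_1, e_j(x_3) = x_2, f_i(x_1) = x_2, f_j(x_2) = x_3; (6) k_i = (q, q⁻¹, 1), k_j = (q, q², q⁻¹), e_i(x_2) = x_1, e_j(x_1) = −qx_1x_2, e_j(x_2) = −qx_2², e_j(x_3) = x_2x_3, f_i(x_1) = x_2, f_j(x_2) = 1; (7) k_i = (1, q, q⁻¹), k_j = (q, q⁻², q⁻¹), e_i(x_3) = x_2, e_j(x_2) = 1, f_i(x_2) = x_3, f_j(x_1) = x_1x_2, f_j(x_2) = −qx_2², f_j(x_3) = −qx_2x_3; (8) k_i = (q⁻², q⁻¹, q⁻¹), k_j = (q, q², q⁻¹), e_i(x_1) = 1, e_j(x_1) = −qx_1x_2, e_j(x_2) = −qx_2², e_j(x_3) = x_1 + x_2x_3, f_i(x_1) = −qx_1², f_i(x_2) = −qx_1x_2, f_i(x_3) = −qx_1x_3 − qx_2x_3², f_j(x_2) = 1; (9) k_i = (q, q, q²), k_j = (q, q⁻², q⁻¹), e_i(x_1) = −qx_1x_3 − qx_1²x_2, e_i(x_2) = −qx_2x_3,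 e_i(x_3) = −qx_3², e_j(x_2) = 1, f_i(x_3) = 1, f_j(x_1) = x_3 + x_1x_2, f_j(x_2) = −qx_2², f_j(x_3) = −qx_2x_3. -/

import Mathlib

noncomputable section

open scoped BigOperators

/-- The defining relations of the quantum `n`-space `A_q(n)`:
`x_i x_j = q • (x_j x_i)` for `i > j`. -/
inductive QRel (q : ℂ) (n : ℕ) : FreeAlgebra ℂ (Fin n) → FreeAlgebra ℂ (Fin n) → Prop
  | rel (i j : Fin n) (h : j < i) :
      QRel q n (FreeAlgebra.ι ℂ i * FreeAlgebra.ι ℂ j)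
        (q • (FreeAlgebra.ι ℂ j * FreeAlgebra.ι ℂ i))

/-- The quantum `n`-space `A_q(n)`. -/
abbrev QSpace (q : ℂ) (n : ℕ) : Type := RingQuot (QRel q n)

/-- The generator `x_i` of the quantum `n`-space. -/
def Xg (q : ℂ) (n : ℕ) (i : Fin n) : QSpace q n :=
  RingQuot.mkAlgHom ℂ (QRel q n) (FreeAlgebra.ι ℂ i)

/-- The Cartan matrix of `sl(m+1)`: `a_{ii} = 2`, `a_{ij} = -1` if `|i-j| = 1`,
`a_{ij} = 0` if `|i-j| > 1`. -/
def cartan (m : ℕ) (i j : Fin m) : ℤ :=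
  if i = j then 2 else if ((i : ℤ) - (j : ℤ)).natAbs = 1 then -1 else 0

/-- A module-algebra structure of `U_q(sl(m+1))` on a unital `ℂ`-algebra `A`:
`ℂ`-linear maps `k_i` (unital algebra automorphisms with two-sided inverses `(k i).symm`),
`e_i`, `f_i` for `1 ≤ i ≤ m`, satisfying the twisted Leibniz rules and the defining
operator relations of `U_q(sl(m+1))`. -/
structure UqslMA (q : ℂ) (m : ℕ) (A : Type) [Ring A] [Algebra ℂ A] where
  k : Fin m → (A ≃ₐ[ℂ] A)
  e : Fin m → (A →ₗ[ℂ] A)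
  f : Fin m → (A →ₗ[ℂ] A)
  e_mul : ∀ (i : Fin m) (a b : A), e i (a * b) = a * e i b + e i a * k i b
  f_mul : ∀ (i : Fin m) (a b : A), f i (a * b) = (k i).symm a * f i b + f i a * b
  e_one : ∀ i : Fin m, e i 1 = 0
  f_one : ∀ i : Fin m, f i 1 = 0
  k_comm : ∀ (i j : Fin m) (a : A), k i (k j a) = k j (k i a)
  ke : ∀ (i j : Fin m) (a : A), k i (e j ((k i).symm a)) = q ^ cartan m i j • e j a
  kf : ∀ (i j : Fin m) (a : A), k i (f j ((k i).symm a)) = q ^ (-cartan m i j) • f j a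
  ef : ∀ (i j : Fin m) (a : A),
      e i (f j a) - f j (e i a) =
        if i = j then (q - q⁻¹)⁻¹ • (k i a - (k i).symm a) else 0
  ee_comm : ∀ i j : Fin m, cartan m i j = 0 → ∀ a : A, e i (e j a) = e j (e i a)
  ff_comm : ∀ i j : Fin m, cartan m i j = 0 → ∀ a : A, f i (f j a) = f j (f i a)
  serre_e : ∀ i j : Fin m, cartan m i j = -1 → ∀ a : A,
      e i (e i (e j a)) - (q + q⁻¹) • e i (e j (e i a)) + e j (e i (e i a)) = 0
  serre_f : ∀ i j : Fin m, cartan m i j = -1 → ∀ a : A,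
      f i (f i (f j a)) - (q + q⁻¹) • f i (f j (f i a)) + f j (f i (f i a)) = 0

/-- Isomorphism of module-algebra structures: an algebra automorphism `ψ` of `A` with
`ψ ∘ π₁(h) ∘ ψ⁻¹ = π₂(h)` for every generator `h ∈ {k_i^{±1}, e_i, f_i}`. -/
def UqslMA.Iso {q : ℂ} {m : ℕ} {A : Type} [Ring A] [Algebra ℂ A]
    (π₁ π₂ : UqslMA q m A) : Prop :=
  ∃ ψ : A ≃ₐ[ℂ] A,
    (∀ (i : Fin m) (a : A), ψ (π₁.k i (ψ.symm a)) = π₂.k i a) ∧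
    (∀ (i : Fin m) (a : A), ψ ((π₁.k i).symm (ψ.symm a)) = (π₂.k i).symm a) ∧
    (∀ (i : Fin m) (a : A), ψ (π₁.e i (ψ.symm a)) = π₂.e i a) ∧
    (∀ (i : Fin m) (a : A), ψ (π₁.f i (ψ.symm a)) = π₂.f i a)

/-- The generator `x_1` of the quantum 3-space. -/
def Z1 (q : ℂ) : QSpace q 3 := Xg q 3 0
/-- The generator `x_2` of the quantum 3-space. -/
def Z2 (q : ℂ) : QSpace q 3 := Xg q 3 1
/-- The generator `x_3` of the quantum 3-space. -/
def Z3 (q : ℂ) : QSpace q 3 := Xg q 3 2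

/-- Kind (1): both `k`'s act by signs, all `e`'s and `f`'s vanish on generators. -/
def T1 (q : ℂ) (π : UqslMA q 2 (QSpace q 3)) : Prop :=
  ∃ i j : Fin 2, i ≠ j ∧ ∃ ε δ : Fin 3 → ℂ,
    (∀ s, ε s = 1 ∨ ε s = -1) ∧ (∀ s, δ s = 1 ∨ δ s = -1) ∧
    (∀ s, π.k i (Xg q 3 s) = ε s • Xg q 3 s) ∧
    (∀ s, π.k j (Xg q 3 s) = δ s • Xg q 3 s) ∧
    (∀ (t : Fin 2) (s : Fin 3), π.e t (Xg q 3 s) = 0) ∧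
    (∀ (t : Fin 2) (s : Fin 3), π.f t (Xg q 3 s) = 0)

/-- Kind (2). -/
def T2 (q : ℂ) (π : UqslMA q 2 (QSpace q 3)) : Prop :=
  ∃ i j : Fin 2, i ≠ j ∧
    π.k i (Z1 q) = (q ^ (-2 : ℤ)) • Z1 q ∧ π.k i (Z2 q) = q⁻¹ • Z2 q ∧
    π.k i (Z3 q) = q⁻¹ • Z3 q ∧
    π.k j (Z1 q) = q • Z1 q ∧ π.k j (Z2 q) = q • Z2 q ∧
    π.k j (Z3 q) = (q ^ (2 : ℕ)) • Z3 q ∧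
    π.e i (Z1 q) = 1 ∧ π.e i (Z2 q) = 0 ∧ π.e i (Z3 q) = 0 ∧
    π.e j (Z1 q) = (-q) • (Z1 q * Z3 q) ∧ π.e j (Z2 q) = (-q) • (Z2 q * Z3 q) ∧
    π.e j (Z3 q) = (-q) • (Z3 q ^ 2) ∧
    π.f i (Z1 q) = (-q) • (Z1 q ^ 2) ∧ π.f i (Z2 q) = (-q) • (Z1 q * Z2 q) ∧
    π.f i (Z3 q) = (-q) • (Z1 q * Z3 q) ∧
    π.f j (Z1 q) = 0 ∧ π.f j (Z2 q) = 0 ∧ π.f j (Z3 q) = 1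

/-- Kind (3). -/
def T3 (q : ℂ) (π : UqslMA q 2 (QSpace q 3)) : Prop :=
  ∃ i j : Fin 2, i ≠ j ∧
    π.k i (Z1 q) = (q ^ (-2 : ℤ)) • Z1 q ∧ π.k i (Z2 q) = q⁻¹ • Z2 q ∧
    π.k i (Z3 q) = q⁻¹ • Z3 q ∧
    π.k j (Z1 q) = q • Z1 q ∧ π.k j (Z2 q) = q⁻¹ • Z2 q ∧ π.k j (Z3 q) = Z3 q ∧
    π.e i (Z1 q) = 1 ∧ π.e i (Z2 q) = 0 ∧ π.e i (Z3 q) = 0 ∧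
    π.e j (Z1 q) = 0 ∧ π.e j (Z2 q) = Z1 q ∧ π.e j (Z3 q) = 0 ∧
    π.f i (Z1 q) = (-q) • (Z1 q ^ 2) ∧ π.f i (Z2 q) = (-q) • (Z1 q * Z2 q) ∧
    π.f i (Z3 q) = (-q) • (Z1 q * Z3 q) ∧
    π.f j (Z1 q) = Z2 q ∧ π.f j (Z2 q) = 0 ∧ π.f j (Z3 q) = 0

/-- Kind (4). -/
def T4 (q : ℂ) (π : UqslMA q 2 (QSpace q 3)) : Prop :=
  ∃ i j : Fin 2, i ≠ j ∧
    π.k i (Z1 q) = q • Z1 q ∧ π.k i (Z2 q) = q • Z2 q ∧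
    π.k i (Z3 q) = (q ^ (2 : ℕ)) • Z3 q ∧
    π.k j (Z1 q) = Z1 q ∧ π.k j (Z2 q) = q • Z2 q ∧ π.k j (Z3 q) = q⁻¹ • Z3 q ∧
    π.e i (Z1 q) = (-q) • (Z1 q * Z3 q) ∧ π.e i (Z2 q) = (-q) • (Z2 q * Z3 q) ∧
    π.e i (Z3 q) = (-q) • (Z3 q ^ 2) ∧
    π.e j (Z1 q) = 0 ∧ π.e j (Z2 q) = 0 ∧ π.e j (Z3 q) = Z2 q ∧
    π.f i (Z1 q) = 0 ∧ π.f i (Z2 q) = 0 ∧ π.f i (Z3 q) = 1 ∧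
    π.f j (Z1 q) = 0 ∧ π.f j (Z2 q) = Z3 q ∧ π.f j (Z3 q) = 0

/-- Kind (5). -/
def T5 (q : ℂ) (π : UqslMA q 2 (QSpace q 3)) : Prop :=
  ∃ i j : Fin 2, i ≠ j ∧
    π.k i (Z1 q) = q • Z1 q ∧ π.k i (Z2 q) = q⁻¹ • Z2 q ∧ π.k i (Z3 q) = Z3 q ∧
    π.k j (Z1 q) = Z1 q ∧ π.k j (Z2 q) = q • Z2 q ∧ π.k j (Z3 q) = q⁻¹ • Z3 q ∧
    π.e i (Z1 q) = 0 ∧ π.e i (Z2 q) = Z1 q ∧ π.e i (Z3 q) = 0 ∧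
    π.e j (Z1 q) = 0 ∧ π.e j (Z2 q) = 0 ∧ π.e j (Z3 q) = Z2 q ∧
    π.f i (Z1 q) = Z2 q ∧ π.f i (Z2 q) = 0 ∧ π.f i (Z3 q) = 0 ∧
    π.f j (Z1 q) = 0 ∧ π.f j (Z2 q) = Z3 q ∧ π.f j (Z3 q) = 0

/-- Kind (6). -/
def T6 (q : ℂ) (π : UqslMA q 2 (QSpace q 3)) : Prop :=
  ∃ i j : Fin 2, i ≠ j ∧
    π.k i (Z1 q) = q • Z1 q ∧ π.k i (Z2 q) = q⁻¹ • Z2 q ∧ π.k i (Z3 q) = Z3 q ∧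
    π.k j (Z1 q) = q • Z1 q ∧ π.k j (Z2 q) = (q ^ (2 : ℕ)) • Z2 q ∧
    π.k j (Z3 q) = q⁻¹ • Z3 q ∧
    π.e i (Z1 q) = 0 ∧ π.e i (Z2 q) = Z1 q ∧ π.e i (Z3 q) = 0 ∧
    π.e j (Z1 q) = (-q) • (Z1 q * Z2 q) ∧ π.e j (Z2 q) = (-q) • (Z2 q ^ 2) ∧
    π.e j (Z3 q) = Z2 q * Z3 q ∧
    π.f i (Z1 q) = Z2 q ∧ π.f i (Z2 q) = 0 ∧ π.f i (Z3 q) = 0 ∧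
    π.f j (Z1 q) = 0 ∧ π.f j (Z2 q) = 1 ∧ π.f j (Z3 q) = 0

/-- Kind (7). -/
def T7 (q : ℂ) (π : UqslMA q 2 (QSpace q 3)) : Prop :=
  ∃ i j : Fin 2, i ≠ j ∧
    π.k i (Z1 q) = Z1 q ∧ π.k i (Z2 q) = q • Z2 q ∧ π.k i (Z3 q) = q⁻¹ • Z3 q ∧
    π.k j (Z1 q) = q • Z1 q ∧ π.k j (Z2 q) = (q ^ (-2 : ℤ)) • Z2 q ∧
    π.k j (Z3 q) = q⁻¹ • Z3 q ∧
    π.e i (Z1 q) = 0 ∧ π.e i (Z2 q) = 0 ∧ π.e i (Z3 q) = Z2 q ∧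
    π.e j (Z1 q) = 0 ∧ π.e j (Z2 q) = 1 ∧ π.e j (Z3 q) = 0 ∧
    π.f i (Z1 q) = 0 ∧ π.f i (Z2 q) = Z3 q ∧ π.f i (Z3 q) = 0 ∧
    π.f j (Z1 q) = Z1 q * Z2 q ∧ π.f j (Z2 q) = (-q) • (Z2 q ^ 2) ∧
    π.f j (Z3 q) = (-q) • (Z2 q * Z3 q)

/-- Kind (8). -/
def T8 (q : ℂ) (π : UqslMA q 2 (QSpace q 3)) : Prop :=
  ∃ i j : Fin 2, i ≠ j ∧
    π.k i (Z1 q) = (q ^ (-2 : ℤ)) • Z1 q ∧ π.k i (Z2 q) = q⁻¹ • Z2 q ∧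
    π.k i (Z3 q) = q⁻¹ • Z3 q ∧
    π.k j (Z1 q) = q • Z1 q ∧ π.k j (Z2 q) = (q ^ (2 : ℕ)) • Z2 q ∧
    π.k j (Z3 q) = q⁻¹ • Z3 q ∧
    π.e i (Z1 q) = 1 ∧ π.e i (Z2 q) = 0 ∧ π.e i (Z3 q) = 0 ∧
    π.e j (Z1 q) = (-q) • (Z1 q * Z2 q) ∧ π.e j (Z2 q) = (-q) • (Z2 q ^ 2) ∧
    π.e j (Z3 q) = Z1 q + Z2 q * Z3 q ∧
    π.f i (Z1 q) = (-q) • (Z1 q ^ 2) ∧ π.f i (Z2 q) = (-q) • (Z1 q * Z2 q) ∧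
    π.f i (Z3 q) = (-q) • (Z1 q * Z3 q) - q • (Z2 q * Z3 q ^ 2) ∧
    π.f j (Z1 q) = 0 ∧ π.f j (Z2 q) = 1 ∧ π.f j (Z3 q) = 0

/-- Kind (9). -/
def T9 (q : ℂ) (π : UqslMA q 2 (QSpace q 3)) : Prop :=
  ∃ i j : Fin 2, i ≠ j ∧
    π.k i (Z1 q) = q • Z1 q ∧ π.k i (Z2 q) = q • Z2 q ∧
    π.k i (Z3 q) = (q ^ (2 : ℕ)) • Z3 q ∧
    π.k j (Z1 q) = q • Z1 q ∧ π.k j (Z2 q) = (q ^ (-2 : ℤ)) • Z2 q ∧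
    π.k j (Z3 q) = q⁻¹ • Z3 q ∧
    π.e i (Z1 q) = (-q) • (Z1 q * Z3 q) - q • (Z1 q ^ 2 * Z2 q) ∧
    π.e i (Z2 q) = (-q) • (Z2 q * Z3 q) ∧ π.e i (Z3 q) = (-q) • (Z3 q ^ 2) ∧
    π.e j (Z1 q) = 0 ∧ π.e j (Z2 q) = 1 ∧ π.e j (Z3 q) = 0 ∧
    π.f i (Z1 q) = 0 ∧ π.f i (Z2 q) = 0 ∧ π.f i (Z3 q) = 1 ∧
    π.f j (Z1 q) = Z3 q + Z1 q * Z2 q ∧ π.f j (Z2 q) = (-q) • (Z2 q ^ 2) ∧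
    π.f j (Z3 q) = (-q) • (Z2 q * Z3 q)

/-- The nine kinds of `U_q(sl(3))`-module-algebra structures on `A_q(3)`. -/
def TKind (q : ℂ) : Fin 9 → UqslMA q 2 (QSpace q 3) → Prop
  | 0 => T1 q
  | 1 => T2 q
  | 2 => T3 q
  | 3 => T4 q
  | 4 => T5 q
  | 5 => T6 q
  | 6 => T7 q
  | 7 => T8 q
  | 8 => T9 q

/-- The exponent of `q` produced by normal ordering `x^a * x^b`. -/
def ordExp (a b : Fin 3 → ℤ) : ℤ := a 1 * b 0 + a 2 * b 0 + a 2 * b 1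

theorem ordExp_add_left (a b c : Fin 3 → ℤ) :
    ordExp (a + b) c = ordExp a c + ordExp b c := by
  simp only [ordExp, Pi.add_apply]; ring

theorem ordExp_add_right (a b c : Fin 3 → ℤ) :
    ordExp a (b + c) = ordExp a b + ordExp a c := by
  simp only [ordExp, Pi.add_apply]; ring

/-- The quantum 3-torus: Laurent polynomials in `q`-commuting variables, as a twisted group
algebra of `ℤ³`. -/
def QTorus (_q : ℂ) : Type := (Fin 3 → ℤ) →₀ ℂ

namespace QTorus

variable {q : ℂ}

instance : AddCommGroup (QTorus q) := inferInstanceAs (AddCommGroup ((Fin 3 → ℤ) →₀ ℂ))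
instance : Module ℂ (QTorus q) := inferInstanceAs (Module ℂ ((Fin 3 → ℤ) →₀ ℂ))
instance : FunLike (QTorus q) (Fin 3 → ℤ) ℂ :=
  inferInstanceAs (FunLike ((Fin 3 → ℤ) →₀ ℂ) (Fin 3 → ℤ) ℂ)

/-- The scalar multiple `c x^d` of a Laurent monomial. -/
def mono (d : Fin 3 → ℤ) (c : ℂ) : QTorus q := Finsupp.single d c

/-- The finite set of exponents of an element. -/
def supp (f : QTorus q) : Finset (Fin 3 → ℤ) := Finsupp.support f

theorem mem_supp {f : QTorus q} {d : Fin 3 → ℤ} : d ∈ f.supp ↔ f d ≠ 0 :=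
  Finsupp.mem_support_iff

@[ext] theorem ext {f g : QTorus q} (h : ∀ d, f d = g d) : f = g := Finsupp.ext h

@[simp] theorem add_apply (f g : QTorus q) (d) : (f + g) d = f d + g d := rfl
@[simp] theorem sub_apply (f g : QTorus q) (d) : (f - g) d = f d - g d := rfl
@[simp] theorem neg_apply (f : QTorus q) (d) : (-f) d = -f d := rfl
@[simp] theorem zero_apply (d) : (0 : QTorus q) d = 0 := rfl
@[simp] theorem smul_apply (c : ℂ) (f : QTorus q) (d) : (c • f) d = c * f d := rfl
theorem mono_apply (a d : Fin 3 → ℤ) (c : ℂ) : (mono a c : QTorus q) d = if a = d then c else 0 :=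
  Finsupp.single_apply
@[simp] theorem mono_zero (a : Fin 3 → ℤ) : (mono a 0 : QTorus q) = 0 := Finsupp.single_zero a
theorem mono_add (a : Fin 3 → ℤ) (c c' : ℂ) : (mono a (c + c') : QTorus q) = mono a c + mono a c' :=
  Finsupp.single_add a c c'
theorem smul_mono (a : Fin 3 → ℤ) (c c' : ℂ) : c • (mono a c' : QTorus q) = mono a (c * c') :=
  Finsupp.smul_single c a c'

theorem induction {P : QTorus q → Prop} (f : QTorus q) (h0 : P 0)
    (hadd : ∀ f g, P f → P g → P (f + g)) (hm : ∀ d c, P (mono d c)) : P f :=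
  Finsupp.induction_linear f h0 hadd hm

theorem supp_nonempty {f : QTorus q} (h : f ≠ 0) : f.supp.Nonempty :=
  Finsupp.support_nonempty_iff.2 h

theorem eq_mono_of_supp {f : QTorus q} {d : Fin 3 → ℤ} (h : ∀ a, f a ≠ 0 → a = d) :
    f = mono d (f d) := by
  ext a
  rw [mono_apply]
  split_ifs with hd
  · rw [hd]
  · by_contra hne
    exact hd (h a hne).symm

instance : Mul (QTorus q) :=
  ⟨fun f g => Finsupp.sum f fun a s => Finsupp.sum g fun b t =>
    mono (a + b) (q ^ ordExp a b * (s * t))⟩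

theorem mul_def (f g : QTorus q) : f * g = Finsupp.sum f fun a s => Finsupp.sum g fun b t =>
    (mono (a + b) (q ^ ordExp a b * (s * t)) : QTorus q) := rfl

theorem mono_mul_mono (a b : Fin 3 → ℤ) (s t : ℂ) :
    (mono a s * mono b t : QTorus q) = mono (a + b) (q ^ ordExp a b * (s * t)) := by
  refine (Finsupp.sum_single_index ?_).trans (Finsupp.sum_single_index ?_)
  · simp only [zero_mul, mul_zero, mono_zero]; exact Finsupp.sum_fun_zero ..
  · simp only [mul_zero, mono_zero]

protected theorem zero_mul' (f : QTorus q) : 0 * f = 0 := Finsupp.sum_zero_index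

protected theorem mul_zero' (f : QTorus q) : f * 0 = 0 := by
  rw [mul_def]; exact Finsupp.sum_fun_zero ..

protected theorem add_mul' (f g h : QTorus q) : (f + g) * h = f * h + g * h := by
  rw [mul_def, mul_def, mul_def]
  refine Finsupp.sum_add_index' (fun a => ?_) fun a s t => ?_
  · simp only [zero_mul, mul_zero, mono_zero]; exact Finsupp.sum_fun_zero ..
  · simp only [add_mul, mul_add, mono_add]; exact Finsupp.sum_add

protected theorem mul_add' (f g h : QTorus q) : f * (g + h) = f * g + f * h := by
  rw [mul_def, mul_def, mul_def]
  refine Eq.trans (Finsupp.sum_congr fun a _ => ?_) Finsupp.sum_add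
  refine Finsupp.sum_add_index' (fun b => ?_) fun b s t => ?_
  · simp
  · simp only [mul_add, mono_add]

protected theorem one_mul' (f : QTorus q) : mono 0 1 * f = f := by
  induction f using QTorus.induction with
  | h0 => exact QTorus.mul_zero' _
  | hadd f g hf hg => rw [QTorus.mul_add', hf, hg]
  | hm d c => rw [mono_mul_mono]; simp [ordExp]

protected theorem mul_one' (f : QTorus q) : f * mono 0 1 = f := by
  induction f using QTorus.induction with
  | h0 => exact QTorus.zero_mul' _
  | hadd f g hf hg => rw [QTorus.add_mul', hf, hg]
  | hm d c => rw [mono_mul_mono]; simp [ordExp]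

protected theorem mul_assoc' [NeZero q] (f g h : QTorus q) : f * g * h = f * (g * h) := by
  induction f using QTorus.induction with
  | h0 => simp only [QTorus.zero_mul']
  | hadd f f' hf hf' => simp only [QTorus.add_mul', hf, hf']
  | hm a r =>
    induction g using QTorus.induction with
    | h0 => simp only [QTorus.zero_mul', QTorus.mul_zero']
    | hadd f f' hf hf' => simp only [QTorus.add_mul', QTorus.mul_add', hf, hf']
    | hm b s =>
      induction h using QTorus.induction with
      | h0 => simp only [QTorus.mul_zero']
      | hadd f f' hf hf' => simp only [QTorus.mul_add', hf, hf']
      | hm c t =>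
        simp only [mono_mul_mono, ordExp_add_left, ordExp_add_right, add_assoc,
          zpow_add₀ (NeZero.ne q)]
        congr 1; ring

protected theorem smul_mul' (r : ℂ) (f g : QTorus q) : r • f * g = r • (f * g) := by
  induction f using QTorus.induction with
  | h0 => rw [smul_zero, QTorus.zero_mul', smul_zero]
  | hadd f f' hf hf' => rw [smul_add, QTorus.add_mul', QTorus.add_mul', hf, hf', smul_add]
  | hm a s =>
    induction g using QTorus.induction with
    | h0 => rw [QTorus.mul_zero', QTorus.mul_zero', smul_zero]
    | hadd f f' hf hf' => rw [QTorus.mul_add', QTorus.mul_add', hf, hf', smul_add]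
    | hm b t => simp only [smul_mono, mono_mul_mono]; congr 1; ring

protected theorem mul_smul' (r : ℂ) (f g : QTorus q) : f * r • g = r • (f * g) := by
  induction f using QTorus.induction with
  | h0 => rw [QTorus.zero_mul', QTorus.zero_mul', smul_zero]
  | hadd f f' hf hf' => rw [QTorus.add_mul', QTorus.add_mul', hf, hf', smul_add]
  | hm a s =>
    induction g using QTorus.induction with
    | h0 => rw [smul_zero, QTorus.mul_zero', smul_zero]
    | hadd f f' hf hf' => rw [smul_add, QTorus.mul_add', QTorus.mul_add', hf, hf', smul_add]
    | hm b t => simp only [smul_mono, mono_mul_mono]; congr 1; ring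

instance [NeZero q] : Ring (QTorus q) :=
  { (inferInstance : AddCommGroup (QTorus q)) with
    mul := (· * ·)
    one := mono 0 1
    zero_mul := QTorus.zero_mul'
    mul_zero := QTorus.mul_zero'
    left_distrib := QTorus.mul_add'
    right_distrib := QTorus.add_mul'
    one_mul := QTorus.one_mul'
    mul_one := QTorus.mul_one'
    mul_assoc := QTorus.mul_assoc' }

theorem eq_sum (f : QTorus q) : f = ∑ a ∈ f.supp, mono a (f a) :=
  (Finsupp.sum_single f).symm

theorem sum_apply {ι : Type*} (s : Finset ι) (F : ι → QTorus q) (d : Fin 3 → ℤ) :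
    (∑ i ∈ s, F i) d = ∑ i ∈ s, F i d :=
  Finsupp.finsetSum_apply s F d

/-- The largest exponents (for the lexicographic order) of two elements: their sum is reached by a
unique pair of exponents. -/
theorem exists_top (f g : QTorus q) (hf : f ≠ 0) (hg : g ≠ 0) :
    ∃ a b, f a ≠ 0 ∧ g b ≠ 0 ∧ (∀ d, f d ≠ 0 → toLex d ≤ toLex a) ∧
      (∀ d, g d ≠ 0 → toLex d ≤ toLex b) ∧
      (∀ a' b', f a' ≠ 0 → g b' ≠ 0 → a' + b' = a + b → a' = a ∧ b' = b) := by
  obtain ⟨a, ha, hamax⟩ := f.supp.exists_max_image toLex (supp_nonempty hf)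
  obtain ⟨b, hb, hbmax⟩ := g.supp.exists_max_image toLex (supp_nonempty hg)
  simp only [mem_supp] at ha hb hamax hbmax
  refine ⟨a, b, ha, hb, hamax, hbmax, fun a' b' ha' hb' h => ?_⟩
  have h1 := hamax a' ha'
  have h2 := hbmax b' hb'
  have h3 : toLex a' + toLex b' = toLex a + toLex b := h
  constructor
  · refine toLex.injective (le_antisymm h1 ?_)
    by_contra hlt
    exact absurd h3 (add_lt_add_of_lt_of_le (not_le.1 hlt) h2).ne
  · refine toLex.injective (le_antisymm h2 ?_)
    by_contra hlt
    exact absurd h3 (add_lt_add_of_le_of_lt h1 (not_le.1 hlt)).ne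

/-- The smallest exponents (for the lexicographic order) of two elements. -/
theorem exists_bot (f g : QTorus q) (hf : f ≠ 0) (hg : g ≠ 0) :
    ∃ a b, f a ≠ 0 ∧ g b ≠ 0 ∧ (∀ d, f d ≠ 0 → toLex a ≤ toLex d) ∧
      (∀ d, g d ≠ 0 → toLex b ≤ toLex d) ∧
      (∀ a' b', f a' ≠ 0 → g b' ≠ 0 → a' + b' = a + b → a' = a ∧ b' = b) := by
  obtain ⟨a, ha, hamax⟩ := f.supp.exists_min_image toLex (supp_nonempty hf)
  obtain ⟨b, hb, hbmax⟩ := g.supp.exists_min_image toLex (supp_nonempty hg)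
  simp only [mem_supp] at ha hb hamax hbmax
  refine ⟨a, b, ha, hb, hamax, hbmax, fun a' b' ha' hb' h => ?_⟩
  have h1 := hamax a' ha'
  have h2 := hbmax b' hb'
  have h3 : toLex a + toLex b = toLex a' + toLex b' := h.symm
  constructor
  · refine toLex.injective (le_antisymm ?_ h1)
    by_contra hlt
    exact absurd h3 (add_lt_add_of_lt_of_le (not_le.1 hlt) h2).ne
  · refine toLex.injective (le_antisymm ?_ h2)
    by_contra hlt
    exact absurd h3 (add_lt_add_of_le_of_lt h1 (not_le.1 hlt)).ne

variable [NeZero q]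

theorem one_def : (1 : QTorus q) = mono 0 1 := rfl

instance : Algebra ℂ (QTorus q) := Algebra.ofModule QTorus.smul_mul' QTorus.mul_smul'

theorem mono_mul_apply (a : Fin 3 → ℤ) (s : ℂ) (f : QTorus q) (d : Fin 3 → ℤ) :
    (mono a s * f : QTorus q) d = q ^ ordExp a (d - a) * (s * f (d - a)) := by
  induction f using QTorus.induction with
  | h0 => simp
  | hadd f g hf hg => simp only [mul_add, add_apply, hf, hg]
  | hm b t =>
    rw [mono_mul_mono, mono_apply, mono_apply]
    by_cases h : a + b = d
    · subst h; simp
    · rw [if_neg h, if_neg (fun h' => h (by rw [h']; abel))]; simp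

theorem mul_mono_apply (a : Fin 3 → ℤ) (s : ℂ) (f : QTorus q) (d : Fin 3 → ℤ) :
    (f * mono a s : QTorus q) d = q ^ ordExp (d - a) a * (f (d - a) * s) := by
  induction f using QTorus.induction with
  | h0 => simp
  | hadd f g hf hg => simp only [add_mul, mul_add, add_apply, hf, hg]
  | hm b t =>
    rw [mono_mul_mono, mono_apply, mono_apply]
    by_cases h : b + a = d
    · subst h; simp
    · rw [if_neg h, if_neg (fun h' => h (by rw [h']; abel))]; simp

theorem mul_apply (f g : QTorus q) (d : Fin 3 → ℤ) :
    (f * g) d = ∑ a ∈ f.supp, q ^ ordExp a (d - a) * (f a * g (d - a)) := by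
  conv_lhs => rw [eq_sum f, Finset.sum_mul, sum_apply]
  exact Finset.sum_congr rfl fun a _ => mono_mul_apply ..

/-- If only one pair of exponents contributes to degree `d`, the coefficient of a product at `d`
is a single term. -/
theorem mul_apply_of_unique (f g : QTorus q) (a d : Fin 3 → ℤ)
    (h : ∀ a', f a' ≠ 0 → g (d - a') ≠ 0 → a' = a) :
    (f * g) d = q ^ ordExp a (d - a) * (f a * g (d - a)) := by
  rw [mul_apply]
  refine Finset.sum_eq_single a (fun b hb hba => ?_) fun ha => ?_
  · by_contra hne
    refine hba (h b (mem_supp.1 hb) fun h0 => hne (by rw [h0]; simp))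
  · have : f a = 0 := by
      by_contra h0; exact ha (mem_supp.2 h0)
    simp [this]

theorem mul_apply_add_of_unique (f g : QTorus q) (a b : Fin 3 → ℤ)
    (h : ∀ a' b', f a' ≠ 0 → g b' ≠ 0 → a' + b' = a + b → a' = a ∧ b' = b) :
    (f * g) (a + b) = q ^ ordExp a b * (f a * g b) := by
  rw [mul_apply_of_unique f g a (a + b), add_sub_cancel_left]
  exact fun a' h1 h2 => (h a' _ h1 h2 (by abel)).1

/-- If `f * g = g * x^b` with `g ≠ 0`, then `f` is a multiple of `x^b`. -/
theorem eq_mono_of_mul_eq (f g : QTorus q) (b : Fin 3 → ℤ) (hg : g ≠ 0)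
    (h : f * g = g * mono b 1) : f = mono b (f b) := by
  have hq : q ≠ 0 := NeZero.ne q
  by_cases hf : f = 0
  · subst hf; simp
  have key : ∀ a c, f a ≠ 0 → g c ≠ 0 →
      (∀ a' b', f a' ≠ 0 → g b' ≠ 0 → a' + b' = a + c → a' = a ∧ b' = c) →
      g (a + c - b) ≠ 0 := by
    intro a c ha hc hu h0
    have h1 := mul_apply_add_of_unique f g a c hu
    rw [h, mul_mono_apply, h0] at h1
    exact (mul_ne_zero (zpow_ne_zero _ hq) (mul_ne_zero ha hc)) (by rw [← h1]; simp)
  obtain ⟨a, c, ha, hc, hamax, hcmax, hu⟩ := exists_top f g hf hg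
  obtain ⟨a', c', ha', hc', hamin, hcmin, hu'⟩ := exists_bot f g hf hg
  have h1 : toLex a + toLex c ≤ toLex b + toLex c := by
    have := add_le_add_right (hcmax _ (key a c ha hc hu)) (toLex b)
    convert this using 1
    change a + c = b + (a + c - b)
    abel
  have h2 : toLex b + toLex c' ≤ toLex a' + toLex c' := by
    have := add_le_add_right (hcmin _ (key a' c' ha' hc' hu')) (toLex b)
    convert this using 1
    change a' + c' = b + (a' + c' - b)
    abel
  refine eq_mono_of_supp fun d hd => toLex.injective (le_antisymm ?_ ?_)
  · exact (hamax d hd).trans (le_of_add_le_add_right h1)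
  · exact (le_of_add_le_add_right h2).trans (hamin d hd)

end QTorus

/-- The character `d ↦ θ^d` of `ℤ³`. -/
def wt (θ : Fin 3 → ℂˣ) (d : Fin 3 → ℤ) : ℂˣ := ∏ s, θ s ^ d s

theorem wt_add (θ : Fin 3 → ℂˣ) (a b : Fin 3 → ℤ) : wt θ (a + b) = wt θ a * wt θ b := by
  simp [wt, zpow_add, Finset.prod_mul_distrib]

theorem wt_zero (θ : Fin 3 → ℂˣ) : wt θ 0 = 1 := by simp [wt]

namespace QTorus

variable {q : ℂ} [NeZero q]

/-- The linear map underlying the diagonal automorphism `x_s ↦ θ_s x_s`. -/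
def twLin (θ : Fin 3 → ℂˣ) : QTorus q →ₗ[ℂ] QTorus q :=
  (Finsupp.lsum ℂ fun d => (wt θ d : ℂ) • Finsupp.lsingle d :
    ((Fin 3 → ℤ) →₀ ℂ) →ₗ[ℂ] ((Fin 3 → ℤ) →₀ ℂ))

theorem twLin_mono (θ : Fin 3 → ℂˣ) (d : Fin 3 → ℤ) (c : ℂ) :
    twLin θ (mono d c : QTorus q) = mono d (wt θ d * c) := by
  refine (Finsupp.lsum_single (S := ℂ) (N := (Fin 3 → ℤ) →₀ ℂ) _ d c).trans ?_
  exact smul_mono ..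

theorem twLin_mul (θ : Fin 3 → ℂˣ) (f g : QTorus q) :
    twLin θ (f * g) = twLin θ f * twLin θ g := by
  induction f using QTorus.induction with
  | h0 => simp
  | hadd f f' hf hf' => simp only [add_mul, map_add, hf, hf']
  | hm a s =>
    induction g using QTorus.induction with
    | h0 => simp
    | hadd f f' hf hf' => simp only [mul_add, map_add, hf, hf']
    | hm b t =>
      simp only [mono_mul_mono, twLin_mono, wt_add, Units.val_mul]; congr 1; ring

/-- The diagonal automorphism `x_s ↦ θ_s x_s` of the quantum torus. -/
def tw (θ : Fin 3 → ℂˣ) : QTorus q →ₐ[ℂ] QTorus q :=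
  AlgHom.ofLinearMap (twLin θ) (by rw [one_def, twLin_mono, wt_zero]; simp) (twLin_mul θ)

theorem tw_mono (θ : Fin 3 → ℂˣ) (d : Fin 3 → ℤ) (c : ℂ) :
    tw θ (mono d c : QTorus q) = mono d (wt θ d * c) := twLin_mono ..

theorem tw_apply (θ : Fin 3 → ℂˣ) (f : QTorus q) (d : Fin 3 → ℤ) :
    tw θ f d = wt θ d * f d := by
  induction f using QTorus.induction with
  | h0 => simp
  | hadd f g hf hg => simp only [mul_add, map_add, add_apply, hf, hg]
  | hm b t =>
    rw [tw_mono, mono_apply, mono_apply]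
    split_ifs with h
    · rw [h]
    · simp

end QTorus

namespace QSpace

variable {q : ℂ} {B : Type*} [Ring B] [Algebra ℂ B]

theorem Xg_mul_Xg {n : ℕ} {i j : Fin n} (h : j < i) :
    Xg q n i * Xg q n j = q • (Xg q n j * Xg q n i) := by
  have := RingQuot.mkAlgHom_rel ℂ (QRel.rel (q := q) i j h)
  rw [map_mul, map_smul, map_mul] at this
  exact this

/-- An algebra map out of the quantum space from a `q`-commuting family. -/
def lift {n : ℕ} (y : Fin n → B) (h : ∀ i j, j < i → y i * y j = q • (y j * y i)) :
    QSpace q n →ₐ[ℂ] B :=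
  RingQuot.liftAlgHom ℂ ⟨FreeAlgebra.lift ℂ y, fun _ _ hr => by
    cases hr with
    | rel i j hij => simpa using h i j hij⟩

theorem lift_Xg {n : ℕ} (y : Fin n → B) (h : ∀ i j, j < i → y i * y j = q • (y j * y i))
    (i : Fin n) : lift y h (Xg q n i) = y i := by
  simp [lift, Xg]

theorem algHom_ext {n : ℕ} {φ ψ : QSpace q n →ₐ[ℂ] B}
    (h : ∀ i, φ (Xg q n i) = ψ (Xg q n i)) : φ = ψ := by
  apply RingQuot.ringQuot_ext'
  apply FreeAlgebra.hom_ext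
  funext i
  exact h i

theorem induction {n : ℕ} {P : QSpace q n → Prop} (a : QSpace q n)
    (alg : ∀ r : ℂ, P (algebraMap ℂ _ r)) (gen : ∀ i, P (Xg q n i))
    (mul : ∀ a b, P a → P b → P (a * b)) (add : ∀ a b, P a → P b → P (a + b)) : P a := by
  obtain ⟨b, rfl⟩ := RingQuot.mkAlgHom_surjective ℂ (QRel q n) a
  induction b using FreeAlgebra.induction with
  | grade0 r => rw [AlgHom.commutes]; exact alg r
  | grade1 i => exact gen i
  | mul a b ha hb => rw [map_mul]; exact mul _ _ ha hb
  | add a b ha hb => rw [map_add]; exact add _ _ ha hb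

theorem Xg_mul_pow {n : ℕ} {i j : Fin n} (h : j < i) (m : ℕ) :
    Xg q n i * Xg q n j ^ m = q ^ m • (Xg q n j ^ m * Xg q n i) := by
  induction m with
  | zero => simp
  | succ m ih =>
    rw [pow_succ, ← mul_assoc, ih, smul_mul_assoc, mul_assoc, Xg_mul_Xg h, mul_smul_comm,
      smul_smul, pow_succ, mul_assoc]

end QSpace

open QTorus

/-- The exponent of the generator `x_s`. -/
abbrev ε (s : Fin 3) : Fin 3 → ℤ := Pi.single s 1

section
variable {q : ℂ}

local notation "A" => QSpace q 3
local notation "x" => Xg q 3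

/-- The normally ordered monomials. -/
def nmon (q : ℂ) (d : Fin 3 → ℕ) : QSpace q 3 :=
  Xg q 3 0 ^ d 0 * (Xg q 3 1 ^ d 1 * Xg q 3 2 ^ d 2)

theorem span_nmon (a : A) : a ∈ Submodule.span ℂ (Set.range (nmon q)) := by
  have hgen : ∀ s d, ∃ c : ℂ, ∃ d', x s * nmon q d = c • nmon q d' := by
    intro s d
    fin_cases s
    · refine ⟨1, ![d 0 + 1, d 1, d 2], ?_⟩
      simp [nmon, pow_succ', mul_assoc]
    · refine ⟨q ^ d 0, ![d 0, d 1 + 1, d 2], ?_⟩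
      have := QSpace.Xg_mul_pow (q := q) (show (0 : Fin 3) < 1 by decide) (d 0)
      simp only [nmon, Fin.mk_one, Matrix.cons_val]
      rw [← mul_assoc, this, smul_mul_assoc, mul_assoc, ← mul_assoc (x 1), ← pow_succ']
    · refine ⟨q ^ d 0 * q ^ d 1, ![d 0, d 1, d 2 + 1], ?_⟩
      have h0 := QSpace.Xg_mul_pow (q := q) (show (0 : Fin 3) < 2 by decide) (d 0)
      have h1 := QSpace.Xg_mul_pow (q := q) (show (1 : Fin 3) < 2 by decide) (d 1)
      simp only [nmon, Fin.reduceFinMk, Matrix.cons_val]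
      rw [← mul_assoc, h0, smul_mul_assoc, mul_assoc, ← mul_assoc (x 2), h1, smul_mul_assoc,
        mul_smul_comm, smul_smul, mul_assoc, ← pow_succ']
  suffices h : ∀ b ∈ Submodule.span ℂ (Set.range (nmon q)),
      a * b ∈ Submodule.span ℂ (Set.range (nmon q)) by
    have := h 1 (Submodule.subset_span ⟨0, by simp [nmon]⟩)
    rwa [mul_one] at this
  induction a using QSpace.induction with
  | alg r =>
    intro b hb
    rw [← Algebra.smul_def]
    exact Submodule.smul_mem _ _ hb
  | gen s =>
    intro b hb
    induction hb using Submodule.span_induction with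
    | mem b hb =>
      obtain ⟨d, rfl⟩ := hb
      obtain ⟨c, d', h⟩ := hgen s d
      rw [h]
      exact Submodule.smul_mem _ _ (Submodule.subset_span ⟨d', rfl⟩)
    | zero => rw [mul_zero]; exact Submodule.zero_mem _
    | add a b _ _ ha hb => rw [mul_add]; exact Submodule.add_mem _ ha hb
    | smul c b _ hb => rw [mul_smul_comm]; exact Submodule.smul_mem _ _ hb
  | mul a a' h h' => intro b hb; rw [mul_assoc]; exact h _ (h' _ hb)
  | add a a' h h' => intro b hb; rw [add_mul]; exact Submodule.add_mem _ (h _ hb) (h' _ hb)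

variable [NeZero q]

theorem QTorus.gen_comm (i j : Fin 3) (h : j < i) :
    (mono (ε i) 1 * mono (ε j) 1 : QTorus q) = q • (mono (ε j) 1 * mono (ε i) 1) := by
  rw [mono_mul_mono, mono_mul_mono, smul_mono, add_comm]
  congr 1
  revert h
  fin_cases i <;> fin_cases j <;> simp [ordExp]

/-- The embedding of quantum space in the quantum torus. -/
def toT : A →ₐ[ℂ] QTorus q := QSpace.lift (fun s => mono (ε s) 1) QTorus.gen_comm

theorem toT_Xg (s : Fin 3) : toT (x s) = mono (ε s) 1 := QSpace.lift_Xg ..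

theorem QTorus.mono_pow (s : Fin 3) (n : ℕ) :
    (mono (ε s) 1 : QTorus q) ^ n = mono (Pi.single s (n : ℤ)) 1 := by
  induction n with
  | zero => simp [one_def]
  | succ n ih =>
    rw [pow_succ, ih, mono_mul_mono, ← Pi.single_add]
    congr 1
    fin_cases s <;> simp [ordExp]

theorem toT_nmon (d : Fin 3 → ℕ) : toT (nmon q d) = mono (fun s => (d s : ℤ)) 1 := by
  simp only [nmon, map_mul, map_pow, toT_Xg, QTorus.mono_pow, mono_mul_mono]
  have : (Pi.single 0 (d 0 : ℤ) + (Pi.single 1 (d 1 : ℤ) + Pi.single 2 (d 2 : ℤ))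
      : Fin 3 → ℤ) = fun s => (d s : ℤ) := by
    funext s; fin_cases s <;> simp
  rw [this]
  congr 1
  simp [ordExp]

theorem toT_nonneg (a : A) (d : Fin 3 → ℤ) (h : toT a d ≠ 0) (s : Fin 3) : 0 ≤ d s := by
  have := span_nmon a
  induction this using Submodule.span_induction with
  | mem b hb =>
    obtain ⟨d', rfl⟩ := hb
    rw [toT_nmon, mono_apply] at h
    split_ifs at h with h'
    · rw [← h']; positivity
    · exact absurd rfl h
  | zero => simp at h
  | add a b _ _ ha hb =>
    by_cases h' : toT a d = 0
    · exact hb (by simpa [h'] using h)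
    · exact ha h'
  | smul c b _ hb =>
    exact hb fun h' => h (by simp [h'])

/-- A linear retraction of the embedding. -/
def ofT : QTorus q →ₗ[ℂ] A :=
  (Finsupp.lsum ℂ fun d => LinearMap.toSpanSingleton ℂ A (nmon q fun s => (d s).toNat) :
    ((Fin 3 → ℤ) →₀ ℂ) →ₗ[ℂ] A)

theorem ofT_mono (d : Fin 3 → ℤ) (c : ℂ) :
    ofT (mono d c) = c • nmon q fun s => (d s).toNat :=
  Finsupp.lsum_single (S := ℂ) (N := A) _ d c

theorem ofT_toT (a : A) : ofT (toT a) = a := by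
  have := span_nmon a
  induction this using Submodule.span_induction with
  | mem b hb =>
    obtain ⟨d', rfl⟩ := hb
    rw [toT_nmon, ofT_mono]; simp
  | zero => simp
  | add a b _ _ ha hb => rw [map_add, map_add, ha, hb]
  | smul c b _ hb => rw [map_smul, map_smul, hb]

theorem toT_injective : Function.Injective (toT (q := q)) :=
  Function.LeftInverse.injective ofT_toT

end

/-- A nonzero scalar which is not a root of unity. -/
class GenericParam (q : ℂ) : Prop extends NeZero q where
  pow_ne_one : ∀ n : ℕ, 0 < n → q ^ n ≠ 1

section
variable {q : ℂ}

theorem zpow_eq_one_iff_of_generic [GenericParam q] (n : ℤ) : q ^ n = 1 ↔ n = 0 := by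
  refine ⟨fun h => ?_, fun h => by rw [h, zpow_zero]⟩
  by_contra hn
  refine GenericParam.pow_ne_one (q := q) n.natAbs (Int.natAbs_pos.2 hn) ?_
  rcases Int.natAbs_eq n with h' | h' <;> rw [h'] at h <;> clear h'
  · rw [zpow_natCast] at h; exact h
  · rw [zpow_neg, zpow_natCast, inv_eq_one] at h; exact h

theorem zpow_inj_of_generic [GenericParam q] {a b : ℤ} (h : q ^ a = q ^ b) : a = b := by
  have hq : q ≠ 0 := NeZero.ne q
  have : q ^ (a - b) = 1 := by
    rw [zpow_sub₀ hq, h, div_self (zpow_ne_zero _ hq)]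
  have := (zpow_eq_one_iff_of_generic _).1 this
  omega

/-- The pairing of an integral weight with an exponent. -/
def pr (l d : Fin 3 → ℤ) : ℤ := l 0 * d 0 + l 1 * d 1 + l 2 * d 2

/-- The weight vector of conjugation by `x_s`. -/
def om : Fin 3 → Fin 3 → ℤ := ![![0, -1, -1], ![1, 0, -1], ![1, 1, 0]]

theorem pr_om_zero (d : Fin 3 → ℤ) : pr (om 0) d = -(d 1 + d 2) := by simp [pr, om]; ring
theorem pr_om_one (d : Fin 3 → ℤ) : pr (om 1) d = d 0 - d 2 := by simp [pr, om, sub_eq_add_neg]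
theorem pr_om_two (d : Fin 3 → ℤ) : pr (om 2) d = d 0 + d 1 := by simp [pr, om]

theorem pr_add (l d d' : Fin 3 → ℤ) : pr l (d + d') = pr l d + pr l d' := by
  simp only [pr, Pi.add_apply]; ring

theorem pr_om (s : Fin 3) (d : Fin 3 → ℤ) :
    pr (om s) d = ordExp (ε s) d - ordExp d (ε s) := by
  fin_cases s <;> simp [pr, om, ordExp] <;> ring

/-- The weight with values the powers of `q` with exponents `l`. -/
def qw (q : ℂ) [NeZero q] (l : Fin 3 → ℤ) : Fin 3 → ℂˣ := fun s =>
  Units.mk0 q (NeZero.ne q) ^ l s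

variable [NeZero q]

theorem wt_qw (l d : Fin 3 → ℤ) : (wt (qw q l) d : ℂ) = q ^ pr l d := by
  have hq : q ≠ 0 := NeZero.ne q
  simp [wt, qw, pr, Fin.prod_univ_three, ← zpow_mul, zpow_add₀ hq]

theorem wt_single (θ : Fin 3 → ℂˣ) (s : Fin 3) : wt θ (ε s) = θ s := by
  rw [wt, Finset.prod_eq_single s] <;> simp +contextual [ε]

theorem ordExp_ratio (s : Fin 3) (d : Fin 3 → ℤ) :
    q ^ ordExp (ε s) d = q ^ pr (om s) d * q ^ ordExp d (ε s) := by
  rw [← zpow_add₀ (NeZero.ne q), pr_om]; congr 1; ring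

/-- The generator `x_s` as an element of the quantum torus. -/
abbrev gT (q : ℂ) (s : Fin 3) : QTorus q := mono (ε s) 1

theorem gT_mul (s : Fin 3) (f : QTorus q) : gT q s * f = tw (qw q (om s)) f * gT q s := by
  ext d
  rw [mono_mul_apply, mul_mono_apply, tw_apply, wt_qw, ordExp_ratio]
  ring

theorem gT_mul_apply (s : Fin 3) (f : QTorus q) (d : Fin 3 → ℤ) :
    (gT q s * f : QTorus q) (d + ε s) = q ^ pr (om s) d * (q ^ ordExp d (ε s) * f d) := by
  rw [mono_mul_apply, add_sub_cancel_right, ordExp_ratio]; ring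

theorem mul_gT_apply (s : Fin 3) (f : QTorus q) (d : Fin 3 → ℤ) :
    (f * gT q s : QTorus q) (d + ε s) = q ^ ordExp d (ε s) * f d := by
  rw [mul_mono_apply, add_sub_cancel_right]; ring

end

section
variable {q : ℂ}

local notation "A" => QSpace q 3
local notation "x" => Xg q 3

/-- The diagonal endomorphism `x_s ↦ θ_s x_s`. -/
def diagHom (θ : Fin 3 → ℂˣ) : A →ₐ[ℂ] A :=
  QSpace.lift (fun s => (θ s : ℂ) • x s) fun i j h => by
    simp only [smul_mul_assoc, mul_smul_comm, QSpace.Xg_mul_Xg h, smul_smul]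
    congr 1; ring

/-- The diagonal automorphism `x_s ↦ θ_s x_s`. -/
def diagAut (θ : Fin 3 → ℂˣ) : A ≃ₐ[ℂ] A :=
  AlgEquiv.ofAlgHom (diagHom θ) (diagHom θ⁻¹)
    (QSpace.algHom_ext fun s => by simp [diagHom, QSpace.lift_Xg, smul_smul])
    (QSpace.algHom_ext fun s => by simp [diagHom, QSpace.lift_Xg, smul_smul])

theorem diagAut_Xg (θ : Fin 3 → ℂˣ) (s : Fin 3) : diagAut θ (x s) = (θ s : ℂ) • x s :=
  QSpace.lift_Xg ..

theorem diagAut_symm_Xg (θ : Fin 3 → ℂˣ) (s : Fin 3) :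
    (diagAut θ).symm (x s) = ((θ s)⁻¹ : ℂ) • x s :=
  (QSpace.lift_Xg _ _ s).trans (by simp)

/-- The triangular endomorphism `x_2 ↦ x_2 + c x_1 x_3`. -/
def shearHom (c : ℂ) : A →ₐ[ℂ] A :=
  QSpace.lift ![x 0, x 1 + c • (x 0 * x 2), x 2] fun i j h => by
    have h10 := QSpace.Xg_mul_Xg (q := q) (show (0 : Fin 3) < 1 by decide)
    have h20 := QSpace.Xg_mul_Xg (q := q) (show (0 : Fin 3) < 2 by decide)
    have h21 := QSpace.Xg_mul_Xg (q := q) (show (1 : Fin 3) < 2 by decide)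
    fin_cases i <;> fin_cases j <;> first | exact absurd h (by decide) | skip
    · simp only [Fin.mk_one, Fin.zero_eta, Matrix.cons_val, add_mul, mul_add, smul_mul_assoc,
        mul_smul_comm, h10, mul_assoc, h20, smul_add, smul_smul]
      congr 2; ring
    · simpa using h20
    · simp only [Fin.mk_one, Fin.reduceFinMk, Matrix.cons_val, add_mul, mul_add, smul_mul_assoc,
        mul_smul_comm, h21, ← mul_assoc, h20, smul_add, smul_smul]
      congr 2; ring

theorem shearHom_zero (c : ℂ) : shearHom c (x 0) = x 0 := QSpace.lift_Xg ..
theorem shearHom_one (c : ℂ) : shearHom c (x 1) = x 1 + c • (x 0 * x 2) := QSpace.lift_Xg ..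
theorem shearHom_two (c : ℂ) : shearHom c (x 2) = x 2 := QSpace.lift_Xg ..

theorem shearHom_comp (c c' : ℂ) (h : c + c' = 0) :
    (shearHom c).comp (shearHom c') = AlgHom.id ℂ A := by
  refine QSpace.algHom_ext fun s => ?_
  fin_cases s
  · simp [shearHom_zero]
  · simp only [Fin.mk_one, AlgHom.comp_apply, shearHom_one, map_add, map_smul, map_mul,
      shearHom_zero, shearHom_two, add_assoc, ← add_smul, h]
    simp
  · simp [shearHom_two]

/-- The triangular automorphism `x_2 ↦ x_2 + c x_1 x_3`. -/
def shearAut (c : ℂ) : A ≃ₐ[ℂ] A :=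
  AlgEquiv.ofAlgHom (shearHom c) (shearHom (-c)) (shearHom_comp _ _ (by simp))
    (shearHom_comp _ _ (by simp))

variable [NeZero q]

theorem toT_eq_tw_of_diag {φ : A →ₐ[ℂ] A} {θ : Fin 3 → ℂˣ}
    (h : ∀ s, φ (x s) = (θ s : ℂ) • x s) (a : A) : toT (φ a) = tw θ (toT a) := by
  have : toT.comp φ = (tw θ).comp (toT (q := q)) := QSpace.algHom_ext fun s => by
    simp only [AlgHom.comp_apply, h, map_smul, toT_Xg, tw_mono, smul_mono, wt_single]
  exact DFunLike.congr_fun this a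

theorem toT_diagAut (θ : Fin 3 → ℂˣ) (a : A) : toT (diagAut θ a) = tw θ (toT a) :=
  toT_eq_tw_of_diag (φ := (diagAut θ).toAlgHom) (diagAut_Xg θ) a

/-- Every generator `x_s` is normal. -/
theorem Xg_mul_eq (s : Fin 3) (b : A) : x s * b = diagAut (qw q (om s)) b * x s := by
  apply toT_injective
  rw [map_mul, map_mul, toT_diagAut, toT_Xg, gT_mul]

end

section
variable {q : ℂ} [GenericParam q]

local notation "A" => QSpace q 3
local notation "x" => Xg q 3

omit [GenericParam q] in
theorem toT_Xg_ne_zero [NeZero q] (φ : A ≃ₐ[ℂ] A) (s : Fin 3) : toT (φ (x s)) ≠ 0 := by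
  intro h
  have h1 : φ (x s) = 0 := toT_injective (by rw [h, map_zero])
  have h2 : x s = 0 := by simpa using h1
  have h3 := toT_Xg (q := q) s
  rw [h2, map_zero] at h3
  have := DFunLike.congr_fun h3 (ε s)
  rw [mono_apply, if_pos rfl] at this
  exact zero_ne_one this

theorem exists_coeff_ne_zero {f : QTorus q} (h : f ≠ 0) : ∃ d, f d ≠ 0 := by
  by_contra! h'
  exact h (QTorus.ext h')

/-- The exponents occurring in the image of a generator under an automorphism commute with
all generators in a controlled way. -/
theorem exists_om_eq_neg (φ : A ≃ₐ[ℂ] A) (s t : Fin 3) :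
    ∃ M : Fin 3 → ℤ, (∀ r, 0 ≤ M r) ∧
      ∀ D, toT (φ (x s)) D ≠ 0 → pr (om t) D = - pr (om s) M := by
  have hq : q ≠ 0 := NeZero.ne q
  set b := φ.symm (x t) with hb
  have hbt : φ b = x t := by simp [hb]
  have h1 : φ (x s) * x t = φ (diagAut (qw q (om s)) b) * φ (x s) := by
    rw [← map_mul, ← Xg_mul_eq, map_mul, hbt]
  have h2 := congrArg toT h1
  rw [map_mul, map_mul, toT_Xg] at h2
  have h3 := eq_mono_of_mul_eq _ _ _ (toT_Xg_ne_zero φ s) h2.symm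
  set c := toT (φ (diagAut (qw q (om s)) b)) (ε t) with hc
  have h4 : φ (diagAut (qw q (om s)) b) = c • x t := by
    apply toT_injective
    rw [map_smul, toT_Xg, h3, smul_mono, mul_one]
  have h5 : diagAut (qw q (om s)) b = c • b := by
    apply φ.injective; rw [h4, map_smul, hbt]
  have hbne : toT b ≠ 0 := toT_Xg_ne_zero φ.symm t
  obtain ⟨M, hM⟩ := exists_coeff_ne_zero hbne
  have h6 := congrArg (fun a => toT a M) h5
  simp only [toT_diagAut, tw_apply, map_smul, smul_apply, wt_qw] at h6
  have h7 : q ^ pr (om s) M = c := mul_right_cancel₀ hM h6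
  refine ⟨M, toT_nonneg b M hM, fun D hD => ?_⟩
  rw [h4, map_smul, toT_Xg, smul_mul_assoc] at h2
  have h8 := DFunLike.congr_fun h2 (D + ε t)
  rw [smul_apply, gT_mul_apply, mul_gT_apply, ← h7] at h8
  have h9 : q ^ (pr (om s) M + pr (om t) D) = 1 := by
    rw [zpow_add₀ hq]
    have : q ^ ordExp D (ε t) * toT (φ (x s)) D ≠ 0 := mul_ne_zero (zpow_ne_zero _ hq) hD
    apply mul_right_cancel₀ this
    rw [one_mul, mul_assoc]; exact h8.symm
  have := (zpow_eq_one_iff_of_generic _).1 h9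
  omega

theorem aut_form (φ : A ≃ₐ[ℂ] A) : ∃ α β γ τ : ℂ, α ≠ 0 ∧ β ≠ 0 ∧ γ ≠ 0 ∧
    φ (x 0) = α • x 0 ∧ φ (x 1) = β • x 1 + τ • (x 0 * x 2) ∧ φ (x 2) = γ • x 2 := by
  have hq : q ≠ 0 := NeZero.ne q
  have half : ∀ φ : A ≃ₐ[ℂ] A, ∃ α γ : ℂ, α ≠ 0 ∧ γ ≠ 0 ∧ φ (x 0) = α • x 0 ∧
      φ (x 2) = γ • x 2 := by
    intro φ
    have h0 : ∀ D, toT (φ (x 0)) D ≠ 0 → D 1 = 0 ∧ D 2 = 0 := by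
      intro D hD
      obtain ⟨M, hM, h⟩ := exists_om_eq_neg φ 0 0
      have h1 := h D hD
      have h2 := toT_nonneg _ D hD
      rw [pr_om_zero, pr_om_zero] at h1
      have := h2 1; have := h2 2; have := hM 1; have := hM 2
      omega
    have h2 : ∀ D, toT (φ (x 2)) D ≠ 0 → D 0 = 0 ∧ D 1 = 0 := by
      intro D hD
      obtain ⟨M, hM, h⟩ := exists_om_eq_neg φ 2 2
      have h1 := h D hD
      have h2 := toT_nonneg _ D hD
      rw [pr_om_two, pr_om_two] at h1
      have := h2 0; have := h2 1; have := hM 0; have := hM 1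
      omega
    obtain ⟨P, hP⟩ := exists_coeff_ne_zero (toT_Xg_ne_zero φ 0)
    obtain ⟨R, hR⟩ := exists_coeff_ne_zero (toT_Xg_ne_zero φ 2)
    have key : ∀ P R, toT (φ (x 0)) P ≠ 0 → toT (φ (x 2)) R ≠ 0 → P = ε 0 ∧ R = ε 2 := by
      intro P R hP hR
      have hP0 := h0 P hP
      have hR0 := h2 R hR
      have hP' := toT_nonneg _ P hP 0
      have hrel := congrArg (fun a => toT (φ a)) (QSpace.Xg_mul_Xg (q := q)
        (show (0 : Fin 3) < 2 by decide))
      simp only [map_mul, map_smul] at hrel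
      have h3 := DFunLike.congr_fun hrel (R + P)
      rw [mul_apply_add_of_unique, smul_apply, add_comm R P, mul_apply_add_of_unique] at h3
      · have h4 : q ^ ordExp R P = q ^ (1 + ordExp P R) := by
          rw [zpow_add₀ hq, zpow_one]
          refine mul_right_cancel₀ (mul_ne_zero hP hR) ?_
          linear_combination h3
        have h5 := zpow_inj_of_generic h4
        simp only [ordExp, hP0.1, hP0.2, hR0.1, hR0.2] at h5
        have h6 : R 2 * P 0 = 1 := by linarith
        have h7 : P 0 = 1 := by
          rcases Int.eq_one_or_neg_one_of_mul_eq_one' h6 with h | h <;> omega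
        rw [h7, mul_one] at h6
        constructor <;> funext s <;> fin_cases s <;> simp [*]
      · intro a b ha hb hab
        have ha' := h0 a ha
        have hb' := h2 b hb
        have e0 := congrFun hab 0
        have e2 := congrFun hab 2
        simp only [Pi.add_apply] at e0 e2
        constructor <;> funext s <;> fin_cases s <;> simp <;> omega
      · intro b a hb ha hab
        have ha' := h0 a ha
        have hb' := h2 b hb
        have e0 := congrFun hab 0
        have e2 := congrFun hab 2
        simp only [Pi.add_apply] at e0 e2
        constructor <;> funext s <;> fin_cases s <;> simp <;> omega
    obtain ⟨rfl, rfl⟩ := key P R hP hR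
    refine ⟨_, _, hP, hR, ?_, ?_⟩
    · apply toT_injective
      rw [map_smul, toT_Xg, smul_mono, mul_one]
      exact eq_mono_of_supp fun a ha => (key a _ ha hR).1
    · apply toT_injective
      rw [map_smul, toT_Xg, smul_mono, mul_one]
      exact eq_mono_of_supp fun a ha => (key _ a hP ha).2
  obtain ⟨α, γ, hα, hγ, h0, h2⟩ := half φ
  obtain ⟨α', γ', hα', hγ', h0', h2'⟩ := half φ.symm
  have h1 : ∀ D, toT (φ (x 1)) D ≠ 0 → D = ε 1 ∨ D = ε 0 + ε 2 := by
    intro D hD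
    have hD' := toT_nonneg _ D hD
    have e1 := congrArg (fun a => toT (φ a) (D + ε 0)) (QSpace.Xg_mul_Xg (q := q)
        (show (0 : Fin 3) < 1 by decide))
    have e2 := congrArg (fun a => toT (φ a) (D + ε 2)) (QSpace.Xg_mul_Xg (q := q)
        (show (1 : Fin 3) < 2 by decide))
    simp only [map_mul, map_smul, h0, h2, smul_mul_assoc, mul_smul_comm, smul_apply, toT_Xg,
      gT_mul_apply, mul_gT_apply] at e1 e2
    have n0 : α * (q ^ ordExp D (ε 0) * toT (φ (x 1)) D) ≠ 0 :=
      mul_ne_zero hα (mul_ne_zero (zpow_ne_zero _ hq) hD)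
    have n2 : γ * (q ^ ordExp D (ε 2) * toT (φ (x 1)) D) ≠ 0 :=
      mul_ne_zero hγ (mul_ne_zero (zpow_ne_zero _ hq) hD)
    have f1 : q ^ (1 + pr (om 0) D) = 1 := by
      rw [zpow_add₀ hq, zpow_one]
      refine mul_right_cancel₀ n0 ?_
      linear_combination -e1
    have f2 : q ^ pr (om 2) D = q ^ (1 : ℤ) := by
      rw [zpow_one]
      refine mul_right_cancel₀ n2 ?_
      linear_combination e2
    have g1 := (zpow_eq_one_iff_of_generic _).1 f1
    have g2 := zpow_inj_of_generic f2
    rw [pr_om_zero] at g1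
    rw [pr_om_two] at g2
    have := hD' 0; have := hD' 1; have := hD' 2
    have : D 1 = 0 ∨ D 1 = 1 := by omega
    rcases this with h | h
    · right; funext s; fin_cases s <;> simp <;> omega
    · left; funext s; fin_cases s <;> simp <;> omega
  have h1' : φ (x 1) = toT (φ (x 1)) (ε 1) • x 1 + toT (φ (x 1)) (ε 0 + ε 2) • (x 0 * x 2) := by
    apply toT_injective
    ext D
    simp only [map_add, map_smul, map_mul, toT_Xg, add_apply, smul_apply, mono_mul_mono, mono_apply]
    by_cases hD : toT (φ (x 1)) D = 0
    · rw [hD]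
      split_ifs with g1 g2 g2
      · rw [← g2] at g1; simpa using congrFun g1 0
      · rw [g1, hD]; simp
      · rw [g2, hD]; simp
      · simp
    · rcases h1 D hD with rfl | rfl
      · rw [if_pos rfl, if_neg (fun h => by simpa using congrFun h 0)]; simp
      · rw [if_pos rfl, if_neg (fun h => by simpa using congrFun h 0)]; simp [ordExp]
  refine ⟨α, _, γ, _, hα, fun hβ => ?_, hγ, h0, h1', h2⟩
  rw [hβ, zero_smul, zero_add] at h1'
  have h3 := congrArg φ.symm h1'
  rw [AlgEquiv.symm_apply_apply, map_smul, map_mul, h0', h2'] at h3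
  have h4 := congrArg (fun a => toT a (ε 1)) h3
  simp only [map_smul, map_mul, toT_Xg, smul_mono, mono_mul_mono, mono_apply, if_true] at h4
  rw [if_neg (fun h => by simpa using congrFun h 0)] at h4
  simp at h4

end

namespace UqslMA

variable {q : ℂ} {m : ℕ} {B : Type} [Ring B] [Algebra ℂ B]

/-- Conjugating a module-algebra structure by an automorphism. -/
def transport (π : UqslMA q m B) (ψ : B ≃ₐ[ℂ] B) : UqslMA q m B where
  k i := ψ.symm.trans ((π.k i).trans ψ)
  e i := ψ.toLinearMap ∘ₗ π.e i ∘ₗ ψ.symm.toLinearMap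
  f i := ψ.toLinearMap ∘ₗ π.f i ∘ₗ ψ.symm.toLinearMap
  e_mul i a b := by simp [π.e_mul]
  f_mul i a b := by
    have h : ∀ c, (ψ.symm.trans ((π.k i).trans ψ)).symm c = ψ ((π.k i).symm (ψ.symm c)) :=
      fun _ => rfl
    simp [π.f_mul, h]
  e_one i := by simp [π.e_one]
  f_one i := by simp [π.f_one]
  k_comm i j a := by simp [π.k_comm i j]
  ke i j a := by
    have h : ∀ c, (ψ.symm.trans ((π.k i).trans ψ)).symm c = ψ ((π.k i).symm (ψ.symm c)) :=
      fun _ => rfl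
    simp [π.ke i j, h]
  kf i j a := by
    have h : ∀ c, (ψ.symm.trans ((π.k i).trans ψ)).symm c = ψ ((π.k i).symm (ψ.symm c)) :=
      fun _ => rfl
    simp only [LinearMap.comp_apply, AlgEquiv.toLinearMap_apply, h, AlgEquiv.trans_apply,
      AlgEquiv.symm_apply_apply, π.kf i j, map_smul]
  ef i j a := by
    have h : ∀ c, (ψ.symm.trans ((π.k i).trans ψ)).symm c = ψ ((π.k i).symm (ψ.symm c)) :=
      fun _ => rfl
    simp only [LinearMap.comp_apply, AlgEquiv.toLinearMap_apply, h, AlgEquiv.trans_apply,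
      AlgEquiv.symm_apply_apply, ← map_sub, π.ef i j]
    split_ifs <;> simp
  ee_comm i j h a := by simp [π.ee_comm i j h]
  ff_comm i j h a := by simp [π.ff_comm i j h]
  serre_e i j h a := by
    have := congrArg ψ (π.serre_e i j h (ψ.symm a))
    rw [map_add, map_sub, map_smul, map_zero] at this
    simpa only [LinearMap.comp_apply, AlgEquiv.toLinearMap_apply, AlgEquiv.symm_apply_apply]
      using this
  serre_f i j h a := by
    have := congrArg ψ (π.serre_f i j h (ψ.symm a))
    rw [map_add, map_sub, map_smul, map_zero] at this
    simpa only [LinearMap.comp_apply, AlgEquiv.toLinearMap_apply, AlgEquiv.symm_apply_apply]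
      using this

theorem iso_transport (π : UqslMA q m B) (ψ : B ≃ₐ[ℂ] B) : π.Iso (π.transport ψ) :=
  ⟨ψ, fun _ _ => rfl, fun _ _ => rfl, fun _ _ => rfl, fun _ _ => rfl⟩

theorem Iso.refl (π : UqslMA q m B) : π.Iso π :=
  ⟨AlgEquiv.refl, fun _ _ => rfl, fun _ _ => rfl, fun _ _ => rfl, fun _ _ => rfl⟩

theorem Iso.trans {π₁ π₂ π₃ : UqslMA q m B} (h : π₁.Iso π₂) (h' : π₂.Iso π₃) : π₁.Iso π₃ := by
  obtain ⟨ψ, h1, h2, h3, h4⟩ := h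
  obtain ⟨φ, g1, g2, g3, g4⟩ := h'
  refine ⟨ψ.trans φ, fun i a => ?_, fun i a => ?_, fun i a => ?_, fun i a => ?_⟩
  · rw [← g1, ← h1]; rfl
  · rw [← g2, ← h2]; rfl
  · rw [← g3, ← h3]; rfl
  · rw [← g4, ← h4]; rfl

end UqslMA

/-- A `K`-twisted derivation of weight `ζ`. -/
structure TwDer {B : Type*} [Ring B] [Algebra ℂ B] (K : B ≃ₐ[ℂ] B) (ζ : ℂ) (δ : B →ₗ[ℂ] B) :
    Prop where
  leib : ∀ a b, δ (a * b) = a * δ b + δ a * K b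
  one : δ 1 = 0
  weight : ∀ a, K (δ a) = ζ • δ (K a)

namespace UqslMA

variable {q : ℂ} {m : ℕ} {B : Type} [Ring B] [Algebra ℂ B] (π : UqslMA q m B)

/-- The operator `k_i f_i`, which satisfies the same Leibniz rule as `e_i`. -/
def g (i : Fin m) : B →ₗ[ℂ] B := (π.k i).toLinearMap ∘ₗ π.f i

theorem g_apply (i : Fin m) (a : B) : π.g i a = π.k i (π.f i a) := rfl

theorem k_e (i j : Fin m) (a : B) : π.k i (π.e j a) = q ^ cartan m i j • π.e j (π.k i a) := by
  rw [← π.ke, AlgEquiv.symm_apply_apply]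

theorem k_f (i j : Fin m) (a : B) : π.k i (π.f j a) = q ^ (-cartan m i j) • π.f j (π.k i a) := by
  rw [← π.kf, AlgEquiv.symm_apply_apply]

theorem k_g (i j : Fin m) (a : B) : π.k i (π.g j a) = q ^ (-cartan m i j) • π.g j (π.k i a) := by
  rw [g_apply, π.k_comm, k_f, map_smul, g_apply]

theorem e_g (i j : Fin m) (a : B) :
    q ^ cartan m j i • π.e i (π.g j a) - π.g j (π.e i a) =
      if i = j then (q - q⁻¹)⁻¹ • (π.k i (π.k i a) - a) else 0 := by
  have h := congrArg (π.k j) (π.ef i j a)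
  rw [map_sub, π.k_e j i] at h
  rw [g_apply, g_apply, h]
  split_ifs with hij
  · subst hij; simp
  · simp

theorem cartan_self (i : Fin m) : cartan m i i = 2 := by simp [cartan]

theorem twDer_e (i : Fin m) : TwDer (π.k i) (q ^ (2 : ℤ)) (π.e i) where
  leib := π.e_mul i
  one := π.e_one i
  weight a := by rw [π.k_e, cartan_self]

theorem twDer_g (i : Fin m) : TwDer (π.k i) (q ^ (-2 : ℤ)) (π.g i) where
  leib a b := by simp [g_apply, π.f_mul]
  one := by simp [g_apply, π.f_one]
  weight a := by rw [π.k_g, cartan_self]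

end UqslMA

section
variable {q : ℂ} [NeZero q]

local notation "A" => QSpace q 3
local notation "x" => Xg q 3

/-- Total degree of an exponent. -/
def dg (d : Fin 3 → ℤ) : ℤ := d 0 + d 1 + d 2

/-- The filtration of quantum space by order of vanishing at the origin. -/
def Fil (q : ℂ) [NeZero q] (n : ℤ) : Submodule ℂ (QSpace q 3) where
  carrier := {a | ∀ d, dg d < n → toT a d = 0}
  add_mem' ha hb d hd := by rw [map_add, add_apply, ha d hd, hb d hd, add_zero]
  zero_mem' d _ := by rw [map_zero, QTorus.zero_apply]
  smul_mem' c a ha d hd := by rw [map_smul, smul_apply, ha d hd, mul_zero]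

theorem mul_mem_Fil {m n : ℤ} {a b : A} (ha : a ∈ Fil q m) (hb : b ∈ Fil q n) :
    a * b ∈ Fil q (m + n) := by
  intro d hd
  rw [map_mul, mul_apply]
  refine Finset.sum_eq_zero fun c hc => ?_
  have h1 : m ≤ dg c := by
    by_contra h
    exact mem_supp.1 hc (ha c (not_le.1 h))
  rw [hb (d - c) (by simp only [dg, Pi.sub_apply] at *; omega)]
  simp

theorem Fil_anti {m n : ℤ} (h : m ≤ n) {a : A} (ha : a ∈ Fil q n) : a ∈ Fil q m :=
  fun d hd => ha d (hd.trans_le h)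

theorem mem_Fil_zero (a : A) : a ∈ Fil q 0 := by
  intro d hd
  by_contra h
  have := toT_nonneg a d h
  have h0 := this 0; have h1' := this 1; have h2 := this 2
  simp only [dg] at hd
  omega

theorem Xg_mem_Fil (s : Fin 3) : x s ∈ Fil q 1 := by
  intro d hd
  rw [toT_Xg, mono_apply, if_neg]
  rintro rfl
  revert hd
  fin_cases s <;> simp [dg]

theorem eq_sum_nmon (a : A) :
    a = ∑ d ∈ (toT a).supp, toT a d • nmon q fun s => (d s).toNat := by
  conv_lhs => rw [← ofT_toT a, eq_sum (toT a), map_sum]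
  exact Finset.sum_congr rfl fun d _ => ofT_mono ..

/-- A property of elements respecting products and holding for generators holds for all
monomials; hence a linear map raising the filtration on generators does so everywhere. -/
theorem map_mem_Fil {P : ℤ → A → Prop} (hone : P 0 1)
    (hmul : ∀ m n a b, P m a → P n b → P (m + n) (a * b)) (hgen : ∀ s, P 1 (x s))
    {Δ : A →ₗ[ℂ] A} {r : ℤ} (hP : ∀ n a, P n a → Δ a ∈ Fil q (n + r)) {n : ℤ} {a : A}
    (ha : a ∈ Fil q n) : Δ a ∈ Fil q (n + r) := by
  have hpow : ∀ s (j : ℕ), P j (x s ^ j) := by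
    intro s j
    induction j with
    | zero => simpa using hone
    | succ j ih => rw [pow_succ]; push_cast; exact hmul _ _ _ _ ih (hgen s)
  rw [eq_sum_nmon a, map_sum]
  refine Submodule.sum_mem _ fun d hd => ?_
  rw [map_smul]
  refine Submodule.smul_mem _ _ (Fil_anti ?_
    (hP _ _ (hmul _ _ _ _ (hpow 0 _) (hmul _ _ _ _ (hpow 1 _) (hpow 2 _)))))
  have h1 : n ≤ dg d := by
    by_contra h
    exact mem_supp.1 hd (ha d (not_le.1 h))
  have := toT_nonneg a d (mem_supp.1 hd)
  simp only [dg] at h1 ⊢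
  have h0 := this 0; have h1' := this 1; have h2 := this 2
  omega

theorem TwDer.mem_Fil {K : A ≃ₐ[ℂ] A} {ζ : ℂ} {δ : A →ₗ[ℂ] A} (hδ : TwDer K ζ δ)
    (hK : ∀ s, K (x s) ∈ Fil q 1) {r : ℤ} (h : ∀ s, δ (x s) ∈ Fil q (1 + r)) {n : ℤ} {a : A}
    (ha : a ∈ Fil q n) : δ a ∈ Fil q (n + r) := by
  refine map_mem_Fil (P := fun n a => a ∈ Fil q n ∧ K a ∈ Fil q n ∧ δ a ∈ Fil q (n + r))
    ⟨mem_Fil_zero _, mem_Fil_zero _, ?_⟩ ?_ (fun s => ⟨Xg_mem_Fil s, hK s, h s⟩)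
    (fun n a h => h.2.2) ha
  · rw [hδ.one]; exact Submodule.zero_mem _
  · rintro m n a b ⟨h1, h2, h3⟩ ⟨g1, g2, g3⟩
    refine ⟨mul_mem_Fil h1 g1, by rw [map_mul]; exact mul_mem_Fil h2 g2, ?_⟩
    rw [hδ.leib]
    refine Submodule.add_mem _ ?_ ?_
    · rw [add_assoc]; exact mul_mem_Fil h1 g3
    · rw [add_right_comm]; exact mul_mem_Fil h3 g2

theorem map_aut_mem_Fil {K : A ≃ₐ[ℂ] A} (hK : ∀ s, K (x s) ∈ Fil q 1) {n : ℤ} {a : A}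
    (ha : a ∈ Fil q n) : K a ∈ Fil q n := by
  have := map_mem_Fil (P := fun n a => K a ∈ Fil q n) (Δ := K.toLinearMap) (r := 0)
    (mem_Fil_zero _) (fun m n a b h h' => by rw [map_mul]; exact mul_mem_Fil h h') hK
    (fun n a h => by rwa [add_zero]) ha
  rwa [add_zero] at this

theorem sub_const_mem_Fil (a : A) : a - toT a 0 • 1 ∈ Fil q 1 := by
  intro d hd
  rw [map_sub, map_smul, map_one, one_def, smul_mono, sub_apply, mono_apply]
  by_cases h : toT a d = 0
  · split_ifs with h0
    · rw [h0, h]; simp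
    · simp [h]
  · have := toT_nonneg a d h
    have h0 := this 0; have h1' := this 1; have h2 := this 2
    have : d = 0 := by
      simp only [dg] at hd
      funext s; fin_cases s <;> simp <;> omega
    simp [this]

theorem sub_linear_mem_Fil {a : A} (ha : toT a 0 = 0) :
    a - ∑ s, toT a (ε s) • x s ∈ Fil q 2 := by
  intro d hd
  rw [map_sub, map_sum, sub_apply, sum_apply]
  simp only [map_smul, toT_Xg, smul_mono, mono_apply, mul_one]
  by_cases h : toT a d = 0
  · rw [h, zero_sub, neg_eq_zero]
    refine Finset.sum_eq_zero fun s _ => ?_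
    split_ifs with h'
    · rw [h', h]
    · rfl
  · have := toT_nonneg a d h
    have h0 := this 0; have h1 := this 1; have h2 := this 2
    have hne : d ≠ 0 := fun h' => h (by rw [h', ha])
    simp only [dg] at hd
    have : ∃ t, d = ε t := by
      by_cases e0 : d 0 = 1
      · exact ⟨0, by funext s; fin_cases s <;> simp <;> omega⟩
      by_cases e1 : d 1 = 1
      · exact ⟨1, by funext s; fin_cases s <;> simp <;> omega⟩
      by_cases e2 : d 2 = 1
      · exact ⟨2, by funext s; fin_cases s <;> simp <;> omega⟩
      exact absurd (by funext s; fin_cases s <;> simp <;> omega) hne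
    obtain ⟨t, rfl⟩ := this
    rw [Finset.sum_eq_single t]
    · simp
    · intro b _ hb
      rw [if_neg]
      intro h'
      have := congrFun h' b
      simp [ε, hb] at this
    · simp

end

section
variable {q : ℂ} [NeZero q]

theorem Xg_comm (s t : Fin 3) : Xg q 3 s * Xg q 3 t = q ^ pr (om s) (ε t) •
    (Xg q 3 t * Xg q 3 s) := by
  rw [Xg_mul_eq, diagAut_Xg, ← wt_single (qw q (om s)), wt_qw, smul_mul_assoc]

theorem toT_x0x2 : toT (Xg q 3 0 * Xg q 3 2) = mono (ε 0 + ε 2) 1 := by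
  rw [map_mul, toT_Xg, toT_Xg, mono_mul_mono]; congr 1; simp [ordExp]

theorem toT_eq_zero_of_neg (a : QSpace q 3) {d : Fin 3 → ℤ} (s : Fin 3) (h : d s < 0)
    : toT a d = 0 := by
  by_contra h'
  exact absurd (toT_nonneg a d h' s) (not_le.2 h)

/-- An automorphism in triangular form. -/
structure TriAut {q : ℂ} (K : QSpace q 3 ≃ₐ[ℂ] QSpace q 3) (lam tau : Fin 3 → ℂ) : Prop where
  apply : ∀ s, K (Xg q 3 s) = lam s • Xg q 3 s + tau s • (Xg q 3 0 * Xg q 3 2)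
  tau0 : tau 0 = 0
  tau2 : tau 2 = 0
  ne : ∀ s, lam s ≠ 0

namespace TriAut

variable {K : QSpace q 3 ≃ₐ[ℂ] QSpace q 3} {lam tau : Fin 3 → ℂ} (hK : TriAut K lam tau)
include hK

theorem gen_mem_Fil (s : Fin 3) : K (Xg q 3 s) ∈ Fil q 1 := by
  rw [hK.apply]
  refine Submodule.add_mem _ (Submodule.smul_mem _ _ (Xg_mem_Fil s)) (Submodule.smul_mem _ _ ?_)
  exact Fil_anti (by norm_num) (mul_mem_Fil (Xg_mem_Fil 0) (Xg_mem_Fil 2))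

theorem const (a : QSpace q 3) : toT (K a) 0 = toT a 0 := by
  have h := map_aut_mem_Fil hK.gen_mem_Fil (sub_const_mem_Fil a)
  have := h 0 (by simp [dg])
  rw [map_sub, map_smul, map_one, map_sub, map_smul, map_one, one_def, smul_mono, sub_apply,
    mono_apply] at this
  simpa [sub_eq_zero] using this

theorem linear {a : QSpace q 3} (ha : toT a 0 = 0) (r : Fin 3) :
    toT (K a) (ε r) = lam r * toT a (ε r) := by
  have h := map_aut_mem_Fil hK.gen_mem_Fil (sub_linear_mem_Fil ha)
  have := h (ε r) (by fin_cases r <;> simp [dg])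
  rw [map_sub, map_sub, sub_apply, sub_eq_zero] at this
  rw [this, map_sum, map_sum, sum_apply, Finset.sum_eq_single r]
  · rw [map_smul, map_smul, hK.apply, map_add, map_smul, map_smul, toT_x0x2, toT_Xg, smul_apply,
      add_apply, smul_apply, smul_apply, mono_apply, mono_apply, if_pos rfl, if_neg]
    · ring
    · intro h
      have h0 := congrFun h 0
      have h2 := congrFun h 2
      revert h0 h2; fin_cases r <;> simp
  · intro b _ hb
    rw [map_smul, map_smul, hK.apply, map_add, map_smul, map_smul, toT_x0x2, toT_Xg, smul_apply,
      add_apply, smul_apply, smul_apply, mono_apply, mono_apply, if_neg, if_neg]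
    · ring
    · intro h
      have h0 := congrFun h 0
      have h2 := congrFun h 2
      revert h0 h2; fin_cases r <;> simp
    · intro h'
      have := congrFun h' b
      simp [ε, hb] at this
  · simp

variable {ζ : ℂ} {δ : QSpace q 3 →ₗ[ℂ] QSpace q 3} (hδ : TwDer K ζ δ)
include hδ

theorem lam_eq_of_coeff {s t : Fin 3} (hst : s ≠ t) (b : Fin 3 → ℤ) (hb : b s = 0)
    (h0 : ∀ u, toT (δ (Xg q 3 u)) (b + ε t - (ε 0 + ε 2)) = 0) (h : toT (δ (Xg q 3 s)) b ≠ 0) :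
    lam t = q ^ pr (om t) (b - ε s) := by
  have hq : q ≠ 0 := NeZero.ne q
  have h1 := congrArg (fun a => toT (δ a) (b + ε t)) (Xg_comm (q := q) s t)
  have hneg : ∀ a : QSpace q 3, toT a (b + ε t - ε s) = 0 := fun a =>
    toT_eq_zero_of_neg a s (by simp [hb, ε, hst])
  simp only [map_smul, hδ.leib, hK.apply, mul_add, mul_smul_comm, map_add, add_apply, smul_apply,
    _root_.map_mul toT, toT_Xg] at h1
  have hm : (mono (ε 0) 1 * mono (ε 2) 1 : QTorus q) = mono (ε 0 + ε 2) 1 := by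
    rw [← toT_x0x2, _root_.map_mul, toT_Xg, toT_Xg]
  rw [hm, mul_mono_apply (ε 0 + ε 2), mul_mono_apply (ε 0 + ε 2), h0, h0,
    mono_mul_apply (ε s), hneg, mul_mono_apply (ε s), hneg] at h1
  rw [show (mono (ε t) 1 : QTorus q) = gT q t from rfl, mul_gT_apply, gT_mul_apply] at h1
  have h2 : lam t * q ^ ordExp b (ε t) * toT (δ (Xg q 3 s)) b =
    (q ^ pr (om s) (ε t) * q ^ pr (om t) b) * q ^ ordExp b (ε t) * toT (δ (Xg q 3 s)) b := by
    linear_combination h1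
  have h3 := mul_right_cancel₀ (zpow_ne_zero _ hq) (mul_right_cancel₀ h h2)
  rw [h3, ← zpow_add₀ hq]
  congr 1
  fin_cases s <;> fin_cases t <;> first | exact absurd rfl hst | skip
  all_goals simp [pr, om]; try ring

end TriAut
end

section
variable {q : ℂ} [GenericParam q]

namespace TriAut

variable {K : QSpace q 3 ≃ₐ[ℂ] QSpace q 3} {lam tau : Fin 3 → ℂ} (hK : TriAut K lam tau)
include hK

variable {ζ : ℂ} {δ : QSpace q 3 →ₗ[ℂ] QSpace q 3} (hδ : TwDer K ζ δ)
include hδ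

theorem const_eq_zero (hlam : lam 1 = lam 0 * lam 2) {n : ℤ} (hζ : ζ = q ^ n)
    (hn : n = 2 ∨ n = -2) (s : Fin 3) :
    toT (δ (Xg q 3 s)) 0 = 0 := by
  have hq : q ≠ 0 := NeZero.ne q
  by_contra h
  have hneg : ∀ a : QSpace q 3, ∀ t, toT a (0 + ε t - (ε 0 + ε 2)) = 0 := fun a t => by
    by_cases ht : t = 0
    · exact toT_eq_zero_of_neg a 2 (by simp [ε, ht])
    · exact toT_eq_zero_of_neg a 0 (by simp [ε, Ne.symm ht])
  have h1 : ∀ t, t ≠ s → lam t = q ^ pr (om t) (0 - ε s) := fun t ht =>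
    hK.lam_eq_of_coeff hδ ht.symm 0 rfl (fun _ => hneg _ _) h
  have h2 : lam s = q ^ (-n) := by
    have h3 := congrArg (fun a => toT a 0) (hδ.weight (Xg q 3 s))
    have h4 : toT (δ (Xg q 3 0 * Xg q 3 2)) 0 = 0 := by
      rw [hδ.leib, hK.apply 2, hK.tau2, zero_smul, add_zero, map_add, _root_.map_mul,
        mul_smul_comm, map_smul, _root_.map_mul, add_apply, smul_apply, toT_Xg, toT_Xg,
        mono_mul_apply, mul_mono_apply, toT_eq_zero_of_neg _ 0 (by simp),
        toT_eq_zero_of_neg _ 2 (by simp)]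
      simp
    simp only [hK.const, hK.apply s, map_add, map_smul, add_apply, smul_apply, h4] at h3
    have h5 : (ζ * lam s) * toT (δ (Xg q 3 s)) 0 = 1 * toT (δ (Xg q 3 s)) 0 := by
      linear_combination -h3
    have h6 := mul_right_cancel₀ h h5
    rw [zpow_neg, ← hζ]
    exact eq_inv_of_mul_eq_one_right h6
  have key : ∀ a b c : ℤ, lam 1 = q ^ a → lam 0 = q ^ b → lam 2 = q ^ c → a = b + c := by
    intro a b c ha hb hc
    rw [ha, hb, hc, ← zpow_add₀ hq] at hlam
    exact zpow_inj_of_generic hlam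
  fin_cases s
  · have := key _ _ _ (h1 1 (by decide)) h2 (h1 2 (by decide))
    simp [pr, om] at this; omega
  · have := key _ _ _ h2 (h1 0 (by decide)) (h1 2 (by decide))
    simp [pr, om] at this; omega
  · have := key _ _ _ (h1 1 (by decide)) (h1 0 (by decide)) h2
    simp [pr, om] at this; omega

end TriAut

variable {K : QSpace q 3 ≃ₐ[ℂ] QSpace q 3} {lam tau : Fin 3 → ℂ}

omit [GenericParam q] in
theorem mem_Fil_one_of_const [NeZero q] {a : QSpace q 3} (h : toT a 0 = 0) : a ∈ Fil q 1 := by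
  simpa [h] using sub_const_mem_Fil a

omit [GenericParam q] in
theorem mem_Fil_two_of_linear [NeZero q] {a : QSpace q 3} (h : toT a 0 = 0)
    (h' : ∀ r, toT a (ε r) = 0) :
    a ∈ Fil q 2 := by
  simpa [h'] using sub_linear_mem_Fil h

namespace TriAut

variable (hK : TriAut K lam tau) {ζ : ℂ} {δ : QSpace q 3 →ₗ[ℂ] QSpace q 3} (hδ : TwDer K ζ δ)

include hK hδ in
omit [GenericParam q] in
theorem linear_der [NeZero q] (h0 : ∀ s, toT (δ (Xg q 3 s)) 0 = 0) {a : QSpace q 3}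
    (ha : toT a 0 = 0)
    (r : Fin 3) : toT (δ a) (ε r) = ∑ s, toT a (ε s) * toT (δ (Xg q 3 s)) (ε r) := by
  have h := hδ.mem_Fil (r := 0) hK.gen_mem_Fil
    (fun s => by rw [add_zero]; exact mem_Fil_one_of_const (h0 s)) (sub_linear_mem_Fil ha)
  have := h (ε r) (by fin_cases r <;> simp [dg])
  rw [map_sub, map_sub, sub_apply, sub_eq_zero] at this
  rw [this, map_sum, map_sum, sum_apply]
  simp only [map_smul, smul_apply]

include hK hδ in
omit [GenericParam q] in
theorem lam_eq_of_linear [NeZero q] (h0 : ∀ s, toT (δ (Xg q 3 s)) 0 = 0) {r s : Fin 3}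
    (h : toT (δ (Xg q 3 s)) (ε r) ≠ 0) : lam r = ζ * lam s := by
  have h3 := congrArg (fun a => toT a (ε r)) (hδ.weight (Xg q 3 s))
  have h4 : δ (Xg q 3 0 * Xg q 3 2) ∈ Fil q (2 + 0) := hδ.mem_Fil hK.gen_mem_Fil
    (fun s => by rw [add_zero]; exact mem_Fil_one_of_const (h0 s))
    (mul_mem_Fil (Xg_mem_Fil 0) (Xg_mem_Fil 2))
  have h5 := h4 (ε r) (by fin_cases r <;> simp [dg])
  simp only [hK.linear (h0 s), hK.apply s, map_add, map_smul, add_apply, smul_apply, h5] at h3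
  refine mul_right_cancel₀ h ?_
  linear_combination h3

/-- Resonant triangular automorphisms in a module-algebra structure are diagonal. -/
theorem tau_eq_zero (hK : TriAut K lam tau) (hlam : lam 1 = lam 0 * lam 2)
    {e g : QSpace q 3 →ₗ[ℂ] QSpace q 3} (he : TwDer K (q ^ (2 : ℤ)) e)
    (hg : TwDer K (q ^ (-2 : ℤ)) g)
    (heg : ∀ a, q ^ (2 : ℤ) • e (g a) - g (e a) = (q - q⁻¹)⁻¹ • (K (K a) - a)) : tau 1 = 0 := by
  have hq : q ≠ 0 := NeZero.ne q
  have hc : (q - q⁻¹)⁻¹ ≠ 0 := by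
    refine inv_ne_zero fun h => ?_
    have : q ^ (2 : ℤ) = 1 := by
      rw [sub_eq_zero] at h
      rw [zpow_two]; nth_rewrite 1 [h]; exact inv_mul_cancel₀ hq
    simpa using (zpow_eq_one_iff_of_generic _).1 this
  have he0 := hK.const_eq_zero he hlam rfl (Or.inl rfl)
  have hg0 := hK.const_eq_zero hg hlam rfl (Or.inr rfl)
  have off : ∀ {ζ : ℂ} {δ : QSpace q 3 →ₗ[ℂ] QSpace q 3} (hδ : TwDer K ζ δ)
      (h0 : ∀ s, toT (δ (Xg q 3 s)) 0 = 0)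
      {a b : Fin 3} (hab : a ≠ b), toT (δ (Xg q 3 a)) (ε b) ≠ 0 → ∀ t, t ≠ a →
      lam t = q ^ pr (om t) (ε b - ε a) := by
    intro ζ δ hδ h0 a b hab h t ht
    refine hK.lam_eq_of_coeff hδ ht.symm (ε b) (by simp [ε, hab]) (fun u => ?_) h
    by_cases hD : ε b + ε t - (ε 0 + ε 2) = 0
    · rw [hD, h0]
    · by_contra hne
      have h1 := toT_nonneg _ _ hne
      have := h1 0; have := h1 1; have := h1 2
      apply hD
      funext r
      revert h1
      fin_cases b <;> fin_cases t <;> fin_cases r <;> simp_all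
  have key : ∀ s, lam s ^ 2 = 1 := by
    intro s
    by_contra hs
    have hne : ∀ {ζ : ℂ} {δ : QSpace q 3 →ₗ[ℂ] QSpace q 3} (hδ : TwDer K ζ δ)
        (h0 : ∀ s, toT (δ (Xg q 3 s)) 0 = 0)
      (hζ : ζ ≠ 1) {a b : Fin 3}, toT (δ (Xg q 3 a)) (ε b) ≠ 0 → a ≠ b := by
      rintro ζ δ hδ h0 hζ a b h rfl
      have := hK.lam_eq_of_linear hδ h0 h
      exact hζ (mul_right_cancel₀ (hK.ne a) (by rw [one_mul]; exact this.symm))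
    have h2 : q ^ (2 : ℤ) ≠ 1 := fun h => by simpa using (zpow_eq_one_iff_of_generic _).1 h
    have h2' : q ^ (-2 : ℤ) ≠ 1 := fun h => by simpa using (zpow_eq_one_iff_of_generic _).1 h
    have hex : ∃ a b, toT (e (Xg q 3 a)) (ε b) ≠ 0 ∧ toT (g (Xg q 3 b)) (ε a) ≠ 0 := by
      by_contra! hno
      have h := congrArg (fun a => toT a (ε s)) (heg (Xg q 3 s))
      have hx0 : toT (Xg q 3 s) 0 = 0 := by
        rw [toT_Xg, mono_apply, if_neg]; intro h'; simpa using congrFun h' s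
      simp only [map_sub, map_smul, sub_apply, smul_apply, hK.linear_der he he0 (hg0 s),
        hK.linear_der hg hg0 (he0 s), hK.linear ((hK.const _).trans hx0), hK.linear hx0] at h
      rw [Finset.sum_eq_zero, Finset.sum_eq_zero, toT_Xg, mono_apply, if_pos rfl] at h
      · apply hs
        have := mul_left_cancel₀ hc ((h.symm.trans (by simp)).trans (mul_zero _).symm)
        linear_combination this
      · intro t _
        by_cases h' : toT (e (Xg q 3 s)) (ε t) = 0
        · rw [h', zero_mul]
        · rw [hno s t h', mul_zero]
      · intro t _
        by_cases h' : toT (e (Xg q 3 t)) (ε s) = 0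
        · rw [h', mul_zero]
        · rw [hno t s h', zero_mul]
    obtain ⟨a, b, hE, hG⟩ := hex
    have hab := hne he he0 h2 hE
    have l1 := off he he0 hab hE
    have l2 := off hg hg0 hab.symm hG
    have l3 := hK.lam_eq_of_linear he he0 hE
    have key3 : ∀ i j k : ℤ, lam 1 = q ^ i → lam 0 = q ^ j → lam 2 = q ^ k → i = j + k := by
      intro a b c ha hb hc
      rw [ha, hb, hc, ← zpow_add₀ hq] at hlam
      exact zpow_inj_of_generic hlam
    have key2 : ∀ (t : Fin 3) (i j : ℤ), lam t = q ^ i → lam t = q ^ j → i = j := by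
      intro t i j hi hj
      exact zpow_inj_of_generic (hi.symm.trans hj)
    have l4 := l1 b hab.symm
    have l5 := l2 a hab
    rw [l4, l5, ← zpow_add₀ hq] at l3
    have l6 := zpow_inj_of_generic l3
    fin_cases a <;> fin_cases b <;> simp [pr, om] at l6 hab
    · have := key3 _ _ _ l5 l4 (l1 2 (by decide)); simp [pr, om] at this
    · have := key2 1 _ _ (l1 1 (by decide)) (l2 1 (by decide)); simp [pr, om] at this
    · have := key3 _ _ _ l4 (l1 0 (by decide)) l5; simp [pr, om] at this
  have lin0 : ∀ {n : ℤ} {δ : QSpace q 3 →ₗ[ℂ] QSpace q 3} (hδ : TwDer K (q ^ n) δ)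
      (h0 : ∀ s, toT (δ (Xg q 3 s)) 0 = 0) (hn : n ≠ 0) (s : Fin 3),
      δ (Xg q 3 s) ∈ Fil q (1 + 1) := by
    intro n δ hδ h0 hn s
    refine mem_Fil_two_of_linear (h0 s) fun r => ?_
    by_contra h
    have h1 := hK.lam_eq_of_linear hδ h0 h
    have h2 : q ^ (n * 2) = 1 := by
      have h3 := key r
      rw [h1, mul_pow, key s, mul_one] at h3
      rw [zpow_mul]; exact_mod_cast h3
    have := (zpow_eq_one_iff_of_generic _).1 h2
    omega
  have he1 := lin0 he he0 (by decide)
  have hg1 := lin0 hg hg0 (by decide)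
  have h3 : q ^ (2 : ℤ) • e (g (Xg q 3 1)) - g (e (Xg q 3 1)) ∈ Fil q 3 :=
    Submodule.sub_mem _ (Submodule.smul_mem _ _ (he.mem_Fil hK.gen_mem_Fil he1 (hg1 1)))
      (hg.mem_Fil hK.gen_mem_Fil hg1 (he1 1))
  rw [heg] at h3
  have h4 := h3 (ε 0 + ε 2) (by simp [dg])
  simp only [hK.apply, map_add, map_smul, _root_.map_mul, hK.tau0, hK.tau2, zero_smul, add_zero,
    mul_smul_comm, smul_mul_assoc] at h4
  simp only [map_sub, map_smul, map_add, toT_x0x2, toT_Xg, smul_apply, sub_apply, add_apply,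
    mono_apply, if_true] at h4
  rw [if_neg (fun h => by simpa using congrFun h 1)] at h4
  have h5 := (mul_eq_zero.1 h4).resolve_left hc
  have h6 : 2 * lam 1 * tau 1 = 0 := by linear_combination h5 + tau 1 * hlam
  simpa [hK.ne 1] using h6

end TriAut
end

section
variable {q : ℂ} [GenericParam q]

theorem exists_triAut (K : QSpace q 3 ≃ₐ[ℂ] QSpace q 3) : ∃ lam tau, TriAut K lam tau := by
  obtain ⟨α, β, γ, τ, hα, hβ, hγ, h0, h1, h2⟩ := aut_form K
  refine ⟨![α, β, γ], ![0, τ, 0], fun s => ?_, rfl, rfl, fun s => ?_⟩ <;> fin_cases s <;> simp [*]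

theorem Xg_ne_zero (s : Fin 3) : Xg q 3 s ≠ 0 := by
  intro h
  have h1 := congrArg (fun a => toT a (ε s)) h
  simp [toT_Xg, mono_apply] at h1

namespace UqslMA

variable (π : UqslMA q 2 (QSpace q 3))

/-- Up to isomorphism, the automorphisms `k_i` act diagonally on the generators. -/
theorem exists_iso_diag : ∃ π', π.Iso π' ∧ ∃ lam : Fin 2 → Fin 3 → ℂˣ,
    ∀ i s, π'.k i (Xg q 3 s) = (lam i s : ℂ) • Xg q 3 s := by
  choose lam tau hK using fun i => exists_triAut (π.k i)
  have hcomm : ∀ i j, lam j 1 * tau i 1 + tau j 1 * (lam i 0 * lam i 2) =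
      lam i 1 * tau j 1 + tau i 1 * (lam j 0 * lam j 2) := by
    intro i j
    have h := congrArg (fun a => toT a (ε 0 + ε 2)) (π.k_comm i j (Xg q 3 1))
    simp only [(hK _).apply, map_add, map_smul, _root_.map_mul, (hK _).tau0, (hK _).tau2,
      zero_smul, add_zero, mul_smul_comm, smul_mul_assoc] at h
    rw [← _root_.map_mul, toT_x0x2] at h
    simp only [toT_Xg, smul_apply, add_apply, mono_apply, if_true] at h
    rw [if_neg (fun h => by simpa using congrFun h 1)] at h
    linear_combination h
  have hc : ∃ c, ∀ i, tau i 1 = c * (lam i 0 * lam i 2 - lam i 1) := by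
    by_cases hres : ∀ i, lam i 1 = lam i 0 * lam i 2
    · refine ⟨0, fun i => ?_⟩
      rw [zero_mul]
      exact (hK i).tau_eq_zero (hres i) (π.twDer_e i) (π.twDer_g i) fun a => by
        have := π.e_g i i a
        rwa [cartan_self, if_pos rfl] at this
    · push Not at hres
      obtain ⟨i, hi⟩ := hres
      have hi' : lam i 0 * lam i 2 - lam i 1 ≠ 0 := sub_ne_zero.2 hi.symm
      refine ⟨tau i 1 / (lam i 0 * lam i 2 - lam i 1), fun j => ?_⟩
      field_simp
      linear_combination hcomm i j
  obtain ⟨c, hc⟩ := hc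
  refine ⟨_, π.iso_transport (shearAut c), fun i s => Units.mk0 (lam i s) ((hK i).ne s),
    fun i s => ?_⟩
  have hs : ∀ a, shearAut c a = shearHom (q := q) c a := fun _ => rfl
  have hs' : ∀ a, (shearAut c).symm a = shearHom (q := q) (-c) a := fun _ => rfl
  change shearAut c (π.k i ((shearAut c).symm _)) = _
  rw [Units.val_mk0, hs, hs']
  fin_cases s
  · simp [shearHom_zero, (hK i).apply, (hK i).tau0]
  · simp only [Fin.mk_one, shearHom_zero, shearHom_one, shearHom_two, (hK i).apply, (hK i).tau0,
      (hK i).tau2, zero_smul, add_zero, mul_smul_comm, smul_mul_assoc, map_add, map_smul,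
      _root_.map_mul, hc]
    module
  · simp [shearHom_two, (hK i).apply, (hK i).tau2]

end UqslMA
end

section
variable {q : ℂ} [NeZero q]

theorem wt_eq_one_of_om {θ : Fin 3 → ℂˣ} {d : Fin 3 → ℤ}
    (h : ∀ s, (θ s : ℂ) = q ^ pr (om s) d) : (wt θ d : ℂ) = 1 := by
  have : θ = qw q fun s => pr (om s) d := by
    funext s
    apply Units.ext
    rw [h, ← wt_single (qw q _), wt_qw]
    congr 1
    fin_cases s <;> simp [pr]
  rw [this, wt_qw, show pr (fun s => pr (om s) d) d = 0 from ?_, zpow_zero]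
  simp [pr, om]; ring

/-- A linear map intertwining diagonal automorphisms is homogeneous. -/
theorem wt_eq_of_intertwine {K : QSpace q 3 ≃ₐ[ℂ] QSpace q 3} {θ : Fin 3 → ℂˣ} {ζ : ℂ}
    {δ : QSpace q 3 →ₗ[ℂ] QSpace q 3} (hK : ∀ s, K (Xg q 3 s) = (θ s : ℂ) • Xg q 3 s)
    (hδ : ∀ a, K (δ a) = ζ • δ (K a)) {s : Fin 3} {d : Fin 3 → ℤ}
    (h : toT (δ (Xg q 3 s)) (d + ε s) ≠ 0) : (wt θ d : ℂ) = ζ := by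
  have h1 := congrArg (fun a => toT a (d + ε s)) (hδ (Xg q 3 s))
  have h2 : ∀ a, toT (K a) = tw θ (toT a) := toT_eq_tw_of_diag (φ := K.toAlgHom) hK
  simp only [h2, hK, map_smul, smul_apply, tw_apply, wt_add, wt_single, Units.val_mul] at h1
  have h3 : ((wt θ d : ℂ) - ζ) * (θ s * toT (δ (Xg q 3 s)) (d + ε s)) = 0 := by
    linear_combination h1
  rcases mul_eq_zero.1 h3 with h4 | h4
  · exact sub_eq_zero.1 h4
  · exact absurd h4 (mul_ne_zero (θ s).ne_zero h)

namespace TwDer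

variable {K : QSpace q 3 ≃ₐ[ℂ] QSpace q 3} {θ : Fin 3 → ℂˣ} {ζ : ℂ}
  {δ : QSpace q 3 →ₗ[ℂ] QSpace q 3}

theorem coeff_relation (hδ : TwDer K ζ δ) (hK : ∀ s, K (Xg q 3 s) = (θ s : ℂ) • Xg q 3 s)
    (d : Fin 3 → ℤ) (s t : Fin 3) :
    (θ s - q ^ pr (om s) d) * (q ^ (-ordExp d (ε t)) * toT (δ (Xg q 3 t)) (d + ε t)) =
      (θ t - q ^ pr (om t) d) * (q ^ (-ordExp d (ε s)) * toT (δ (Xg q 3 s)) (d + ε s)) := by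
  have hq : q ≠ 0 := NeZero.ne q
  have h1 := congrArg (fun a => toT (δ a) (d + ε t + ε s)) (Xg_comm (q := q) s t)
  simp only [map_smul, hδ.leib, hK, mul_smul_comm, map_add, add_apply, smul_apply,
    _root_.map_mul toT, toT_Xg] at h1
  change (gT q s * _ : QTorus q) _ + _ * (_ * gT q t : QTorus q) _ =
    _ * ((gT q t * _ : QTorus q) _ + _ * (_ * gT q s : QTorus q) _) at h1
  rw [gT_mul_apply, mul_gT_apply, add_right_comm, gT_mul_apply, mul_gT_apply] at h1
  have e1 : pr (om t) (ε s) = - pr (om s) (ε t) := by rw [pr_om, pr_om]; ring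
  have e2 : pr (om s) (ε t) = ordExp (ε s) (ε t) - ordExp (ε t) (ε s) := pr_om s _
  simp only [pr_add, ordExp_add_left, e1, e2] at h1
  simp only [zpow_add₀ hq, zpow_sub₀ hq, zpow_neg] at h1 ⊢
  have n1 := zpow_ne_zero (ordExp (ε s) (ε t)) hq
  have n2 := zpow_ne_zero (ordExp (ε t) (ε s)) hq
  have n3 := zpow_ne_zero (ordExp d (ε s)) hq
  have n4 := zpow_ne_zero (ordExp d (ε t)) hq
  field_simp at h1 ⊢
  linear_combination -h1

/-- Every twisted derivation of nontrivial weight is inner in the quantum torus. -/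
theorem exists_inner (hδ : TwDer K ζ δ) (hK : ∀ s, K (Xg q 3 s) = (θ s : ℂ) • Xg q 3 s)
    (hζ : ζ ≠ 1) : ∃ u : QTorus q,
      (∀ a, toT (δ a) = u * tw θ (toT a) - toT a * u) ∧
      ∀ d, u d ≠ 0 → ∃ s, toT (δ (Xg q 3 s)) (d + ε s) ≠ 0 := by
  classical
  have hq : q ≠ 0 := NeZero.ne q
  set c : Fin 3 → (Fin 3 → ℤ) → ℂ :=
    fun s d => q ^ (-ordExp d (ε s)) * toT (δ (Xg q 3 s)) (d + ε s) with hc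
  have hc0 : ∀ s d, c s d ≠ 0 → toT (δ (Xg q 3 s)) (d + ε s) ≠ 0 := fun s d h =>
    right_ne_zero_of_mul h
  have hv : ∀ d, ∃ v : ℂ, (∀ t, c t d = v * (θ t - q ^ pr (om t) d)) ∧
      (v ≠ 0 → ∃ s, c s d ≠ 0) := by
    intro d
    by_cases h : ∃ s, (θ s : ℂ) ≠ q ^ pr (om s) d
    · obtain ⟨s, hs⟩ := h
      have hs' := sub_ne_zero.2 hs
      refine ⟨c s d / (θ s - q ^ pr (om s) d), fun t => ?_,
        fun h => ⟨s, fun h' => h (by simp [h'])⟩⟩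
      field_simp
      linear_combination hδ.coeff_relation hK d s t
    · push Not at h
      refine ⟨0, fun t => ?_, fun h => absurd rfl h⟩
      rw [zero_mul]
      by_contra h'
      exact hζ ((wt_eq_of_intertwine hK hδ.weight (hc0 _ _ h')).symm.trans (wt_eq_one_of_om h))
  choose v hv1 hv2 using hv
  set S : Finset (Fin 3 → ℤ) := Finset.univ.biUnion fun s =>
    (toT (δ (Xg q 3 s))).supp.image fun d => d - ε s with hS
  have hu : ∀ d, (∑ b ∈ S, mono b (v b) : QTorus q) d = v d := by
    intro d
    simp only [QTorus.sum_apply, mono_apply, Finset.sum_ite_eq']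
    split_ifs with h
    · rfl
    · by_contra h'
      obtain ⟨s, hs⟩ := hv2 d (Ne.symm h')
      exact h (Finset.mem_biUnion.2 ⟨s, Finset.mem_univ _, Finset.mem_image.2
        ⟨d + ε s, mem_supp.2 (hc0 _ _ hs), add_sub_cancel_right _ _⟩⟩)
  refine ⟨∑ b ∈ S, mono b (v b), fun a => ?_, fun d hd => ?_⟩
  · have h2 : ∀ a, toT (K a) = tw θ (toT a) := toT_eq_tw_of_diag (φ := K.toAlgHom) hK
    induction a using QSpace.induction with
    | alg r =>
      rw [Algebra.algebraMap_eq_smul_one, map_smul, hδ.one]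
      simp only [map_smul, map_one, map_zero, smul_zero, mul_smul_comm, smul_mul_assoc, mul_one,
        one_mul, sub_self]
    | gen s =>
      ext d
      obtain ⟨b, rfl⟩ : ∃ b, d = b + ε s := ⟨d - ε s, (sub_add_cancel _ _).symm⟩
      rw [← h2, hK, map_smul, toT_Xg, mul_smul_comm, sub_apply, smul_apply]
      change _ = _ * (_ * gT q s : QTorus q) _ - (gT q s * _ : QTorus q) _
      rw [mul_gT_apply, gT_mul_apply, hu]
      have h3 := hv1 b s
      simp only [hc, zpow_neg] at h3
      have n1 := zpow_ne_zero (ordExp b (ε s)) hq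
      field_simp at h3
      linear_combination h3
    | mul a b ha hb =>
      rw [hδ.leib, map_add, map_mul, map_mul, ha, hb, h2, map_mul, map_mul]
      noncomm_ring
    | add a b ha hb =>
      simp only [map_add, ha, hb, mul_add, add_mul]
      abel
  · rw [hu] at hd
    obtain ⟨s, hs⟩ := hv2 d hd
    exact ⟨s, hc0 _ _ hs⟩

end TwDer
end

section
variable {q : ℂ} [NeZero q]

/-- A module-algebra structure with diagonal `k_i` (of weights `lam i`), such that `e_i` and
`k_i f_i` are implemented by the elements `u i` and `w i` of the quantum torus. -/
structure DiagData (π : UqslMA q 2 (QSpace q 3)) (lam : Fin 2 → Fin 3 → ℂˣ)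
    (u w : Fin 2 → QTorus q) : Prop where
  k : ∀ i s, π.k i (Xg q 3 s) = (lam i s : ℂ) • Xg q 3 s
  e : ∀ i a, toT (π.e i a) = u i * tw (lam i) (toT a) - toT a * u i
  g : ∀ i a, toT (π.g i a) = w i * tw (lam i) (toT a) - toT a * w i
  u_wt : ∀ i j d, u i d ≠ 0 → (wt (lam j) d : ℂ) = q ^ cartan 2 j i
  w_wt : ∀ i j d, w i d ≠ 0 → (wt (lam j) d : ℂ) = q ^ (-cartan 2 j i)

theorem cartan_symm (i j : Fin 2) : cartan 2 i j = cartan 2 j i := by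
  fin_cases i <;> fin_cases j <;> rfl

theorem inner_coeff (u : QTorus q) (θ : Fin 3 → ℂˣ) (s : Fin 3) (d : Fin 3 → ℤ) :
    (u * tw θ (mono (ε s) 1) - mono (ε s) 1 * u : QTorus q) (d + ε s) =
      q ^ ordExp d (ε s) * ((θ s - q ^ pr (om s) d) * u d) := by
  rw [tw_mono, wt_single, mul_one, sub_apply, mul_mono_apply, add_sub_cancel_right]
  change _ - (gT q s * _ : QTorus q) _ = _
  rw [gT_mul_apply]
  ring

theorem tw_eq_smul {θ : Fin 3 → ℂˣ} {f : QTorus q} {c : ℂ}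
    (h : ∀ d, f d ≠ 0 → (wt θ d : ℂ) = c) : tw θ f = c • f := by
  ext d
  rw [tw_apply, smul_apply]
  by_cases hd : f d = 0
  · simp [hd]
  · rw [h d hd]

theorem tw_comm (θ θ' : Fin 3 → ℂˣ) (f : QTorus q) : tw θ (tw θ' f) = tw θ' (tw θ f) := by
  ext d
  simp only [tw_apply]
  ring

namespace DiagData

variable {π : UqslMA q 2 (QSpace q 3)} {lam : Fin 2 → Fin 3 → ℂˣ} {u w : Fin 2 → QTorus q}

theorem toT_k (D : DiagData π lam u w) (i : Fin 2) (a : QSpace q 3) :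
    toT (π.k i a) = tw (lam i) (toT a) :=
  toT_eq_tw_of_diag (φ := (π.k i).toAlgHom) (D.k i) a

theorem e_eq_of (D : DiagData π lam u w) {i : Fin 2} {s : Fin 3} {m : QSpace q 3}
    (h : u i * tw (lam i) (mono (ε s) 1) - mono (ε s) 1 * u i = toT m) :
    π.e i (Xg q 3 s) = m :=
  toT_injective (by rw [D.e, toT_Xg, h])

theorem f_eq_of (D : DiagData π lam u w) {i : Fin 2} {s : Fin 3} {m : QSpace q 3}
    (h : w i * tw (lam i) (mono (ε s) 1) - mono (ε s) 1 * w i = tw (lam i) (toT m)) :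
    π.f i (Xg q 3 s) = m :=
  (π.k i).injective (toT_injective (by rw [← π.g_apply, D.g, toT_Xg, h, D.toT_k]))

theorem u_supp (D : DiagData π lam u w) {i : Fin 2} {d : Fin 3 → ℤ} (h : u i d ≠ 0) (s : Fin 3) :
    (lam i s : ℂ) = q ^ pr (om s) d ∨ ∀ r, 0 ≤ d r + ε s r := by
  by_contra! h'
  obtain ⟨h1, r, h2⟩ := h'
  have h3 := D.e i (Xg q 3 s)
  rw [toT_Xg] at h3
  have h4 := inner_coeff (u i) (lam i) s d
  rw [← h3, toT_eq_zero_of_neg _ r h2] at h4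
  exact (mul_ne_zero (zpow_ne_zero _ (NeZero.ne q)) (mul_ne_zero (sub_ne_zero.2 h1) h)) h4.symm

theorem w_supp (D : DiagData π lam u w) {i : Fin 2} {d : Fin 3 → ℤ} (h : w i d ≠ 0) (s : Fin 3) :
    (lam i s : ℂ) = q ^ pr (om s) d ∨ ∀ r, 0 ≤ d r + ε s r := by
  by_contra! h'
  obtain ⟨h1, r, h2⟩ := h'
  have h3 := D.g i (Xg q 3 s)
  rw [toT_Xg] at h3
  have h4 := inner_coeff (w i) (lam i) s d
  rw [← h3, toT_eq_zero_of_neg _ r h2] at h4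
  exact (mul_ne_zero (zpow_ne_zero _ (NeZero.ne q)) (mul_ne_zero (sub_ne_zero.2 h1) h)) h4.symm

theorem commutator (D : DiagData π lam u w) (i j : Fin 2) {d : Fin 3 → ℤ}
    (h : (u i * w j - q ^ cartan 2 j i • (w j * u i) -
      (if i = j then mono 0 (q - q⁻¹)⁻¹ else 0) : QTorus q) d ≠ 0) (s : Fin 3) :
    (lam i s * lam j s : ℂ) = q ^ pr (om s) d := by
  have hq : q ≠ 0 := NeZero.ne q
  set c : QTorus q := if i = j then mono 0 (q - q⁻¹)⁻¹ else 0 with hc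
  have hu : tw (lam j) (u i) = q ^ cartan 2 j i • u i := tw_eq_smul fun d => D.u_wt i j d
  have hw : tw (lam i) (w j) = q ^ (-cartan 2 j i) • w j :=
    tw_eq_smul fun d hd => by rw [D.w_wt j i d hd, cartan_symm]
  have h1 := congrArg toT (π.e_g i j (Xg q 3 s))
  have h2 : toT (if i = j then (q - q⁻¹)⁻¹ • (π.k i (π.k i (Xg q 3 s)) - Xg q 3 s) else 0) =
      c * tw (lam i) (tw (lam j) (toT (Xg q 3 s))) - toT (Xg q 3 s) * c := by
    rw [hc]
    split_ifs with hij
    · subst hij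
      have : (mono 0 (q - q⁻¹)⁻¹ : QTorus q) = (q - q⁻¹)⁻¹ • 1 := by
        rw [one_def, smul_mono, mul_one]
      rw [this, map_smul, map_sub, D.toT_k, D.toT_k, smul_mul_assoc, mul_smul_comm, one_mul,
        mul_one, smul_sub]
    · simp
  have h3 : (u i * w j - q ^ cartan 2 j i • (w j * u i) - c) *
      tw (lam i * lam j) (mono (ε s) 1) - mono (ε s) 1 *
        (u i * w j - q ^ cartan 2 j i • (w j * u i) - c) = 0 := by
    have h4 : tw (lam i * lam j) (mono (ε s) 1 : QTorus q) =
        tw (lam i) (tw (lam j) (mono (ε s) 1)) := by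
      ext b
      simp only [tw_apply, wt, Pi.mul_apply, mul_zpow, Finset.prod_mul_distrib, Units.val_mul]
      ring
    rw [h2, map_sub, map_smul, D.e, D.g, D.g, D.e] at h1
    simp only [map_sub, map_mul, hu, hw, toT_Xg] at h1
    rw [h4]
    rw [tw_comm (lam j)] at h1
    have h5 : ∀ f : QTorus q, q ^ cartan 2 j i • q ^ (-cartan 2 j i) • f = f := fun f => by
      rw [smul_smul, ← zpow_add₀ hq, add_neg_cancel, zpow_zero, one_smul]
    simp only [sub_mul, mul_sub, smul_sub, smul_mul_assoc, mul_smul_comm, h5, mul_assoc] at h1 ⊢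
    rw [← sub_eq_zero] at h1
    refine Eq.trans ?_ h1
    abel
  have h4 := inner_coeff (u i * w j - q ^ cartan 2 j i • (w j * u i) - c) (lam i * lam j) s d
  rw [h3, QTorus.zero_apply] at h4
  have h5 := (mul_eq_zero.1 h4.symm).resolve_left (zpow_ne_zero _ hq)
  have h6 := (mul_eq_zero.1 h5).resolve_right h
  rw [sub_eq_zero] at h6
  simpa using h6

/-- Diagonal change of coordinates. -/
theorem transport (D : DiagData π lam u w) (θ : Fin 3 → ℂˣ) :
    DiagData (π.transport (diagAut θ)) lam (fun i => tw θ (u i)) (fun i => tw θ (w i)) where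
  k i s := by
    change diagAut θ (π.k i ((diagAut θ).symm _)) = _
    rw [diagAut_symm_Xg, map_smul, D.k, map_smul, map_smul, diagAut_Xg, smul_smul, smul_smul]
    congr 1
    have := (θ s).ne_zero
    field_simp
  e i a := by
    have h : tw θ (toT ((diagAut θ).symm a)) = toT a := by
      rw [← toT_diagAut, AlgEquiv.apply_symm_apply]
    change toT (diagAut θ (π.e i ((diagAut θ).symm a))) = _
    rw [toT_diagAut, D.e, map_sub, map_mul, map_mul, tw_comm, h]
  g i a := by
    have h : tw θ (toT ((diagAut θ).symm a)) = toT a := by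
      rw [← toT_diagAut, AlgEquiv.apply_symm_apply]
    have h' : (π.transport (diagAut θ)).g i a = diagAut θ (π.g i ((diagAut θ).symm a)) := by
      change diagAut θ (π.k i ((diagAut θ).symm (diagAut θ _))) = _
      rw [AlgEquiv.symm_apply_apply]; rfl
    rw [h', toT_diagAut, D.g, map_sub, map_mul, map_mul, tw_comm, h]
  u_wt i j d h := D.u_wt i j d (right_ne_zero_of_mul (by rwa [tw_apply] at h))
  w_wt i j d h := D.w_wt i j d (right_ne_zero_of_mul (by rwa [tw_apply] at h))

end DiagData
end

section
variable {q : ℂ} [GenericParam q]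

theorem UqslMA.exists_iso_diagData (π : UqslMA q 2 (QSpace q 3)) :
    ∃ π', π.Iso π' ∧ ∃ lam u w, DiagData π' lam u w := by
  obtain ⟨π', hπ, lam, hk⟩ := π.exists_iso_diag
  have h2 : q ^ (2 : ℤ) ≠ 1 := fun h => by simpa using (zpow_eq_one_iff_of_generic _).1 h
  have h2' : q ^ (-2 : ℤ) ≠ 1 := fun h => by simpa using (zpow_eq_one_iff_of_generic _).1 h
  choose u hu hu' using fun i => (π'.twDer_e i).exists_inner (hk i) h2
  choose w hw hw' using fun i => (π'.twDer_g i).exists_inner (hk i) h2'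
  refine ⟨π', hπ, lam, u, w, hk, hu, hw, fun i j d h => ?_, fun i j d h => ?_⟩
  · obtain ⟨s, hs⟩ := hu' i d h
    exact wt_eq_of_intertwine (hk j) (π'.k_e j i) hs
  · obtain ⟨s, hs⟩ := hw' i d h
    exact wt_eq_of_intertwine (hk j) (π'.k_g j i) hs

end

/-- Weights of the possible diagonal actions of `k` in a quantum `sl(2)`-triple. -/
def tyL : Fin 8 → Fin 3 → ℤ :=
  ![![-2, -1, -1], ![1, -2, -1], ![1, 1, -2], ![2, -1, -1], ![1, 2, -1], ![1, 1, 2],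
    ![1, -1, 0], ![0, 1, -1]]

/-- Leading exponents of the possible raising operators in a quantum `sl(2)`-triple. -/
def tyD : Fin 8 → Fin 3 → ℤ :=
  ![![-1, 0, 0], ![0, -1, 0], ![0, 0, -1], ![1, 0, 0], ![0, 1, 0], ![0, 0, 1],
    ![1, -1, 0], ![0, 1, -1]]

theorem eq_qw {q : ℂ} [NeZero q] {lam : Fin 3 → ℂˣ} {l : Fin 3 → ℤ}
    (h : ∀ s, (lam s : ℂ) = q ^ l s) : lam = qw q l := by
  funext s
  apply Units.ext
  rw [h, ← wt_single (qw q _), wt_qw]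
  congr 1
  fin_cases s <;> simp [pr]

section
variable {q : ℂ} [GenericParam q]

theorem exists_type {lam : Fin 3 → ℂˣ} {d : Fin 3 → ℤ} (hwt : (wt lam d : ℂ) = q ^ (2 : ℤ))
    (h1 : ∀ s, (lam s : ℂ) = q ^ pr (om s) d ∨ ∀ r, 0 ≤ d r + ε s r)
    (h2 : ∀ s, (lam s : ℂ) = q ^ pr (om s) (-d) ∨ ∀ r, 0 ≤ -d r + ε s r) :
    ∃ a, lam = qw q (tyL a) ∧ d = tyD a := by
  have hq : q ≠ 0 := NeZero.ne q
  have hne : q ^ (2 : ℤ) ≠ 1 := fun h => by simpa using (zpow_eq_one_iff_of_generic _).1 h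
  have hs : ∃ s, ∀ r, 0 ≤ d r + ε s r := by
    by_contra! h
    refine hne (hwt.symm.trans (wt_eq_one_of_om fun s => (h1 s).resolve_right ?_))
    push Not
    exact h s
  have ht : ∃ t, ∀ r, 0 ≤ -d r + ε t r := by
    by_contra! h
    have h3 : (wt lam (-d) : ℂ) = 1 := wt_eq_one_of_om fun s => (h2 s).resolve_right (by
      push Not
      exact h s)
    have h4 : (wt lam d * wt lam (-d) : ℂ) = 1 := by
      rw [← Units.val_mul, ← wt_add, add_neg_cancel, wt_zero, Units.val_one]
    rw [h3, mul_one, hwt] at h4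
    exact hne h4
  obtain ⟨s, hs⟩ := hs
  obtain ⟨t, ht⟩ := ht
  have hd : d = 0 ∨ (∃ t, d = ε t) ∨ (∃ s, d = -ε s) ∨ ∃ s t, s ≠ t ∧ d = ε t - ε s := by
    by_cases hst : s = t
    · subst hst
      have h3 : ∀ r, r ≠ s → d r = 0 := by
        intro r hr
        have := hs r; have := ht r
        simp [ε, hr] at *
        omega
      have h4 := hs s; have h5 := ht s
      simp [ε] at h4 h5
      have h6 : d s = 0 ∨ d s = 1 ∨ d s = -1 := by omega
      rcases h6 with h6 | h6 | h6
      · left; funext r; by_cases hr : r = s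
        · simp [hr, h6]
        · simp [h3 r hr]
      · right; left; use s; funext r; by_cases hr : r = s
        · simp [hr, h6, ε]
        · simp [h3 r hr, ε, hr]
      · right; right; left; use s; funext r; by_cases hr : r = s
        · simp [hr, h6, ε]
        · simp [h3 r hr, ε, hr]
    · have h3 : ∀ r, r ≠ s → r ≠ t → d r = 0 := by
        intro r hr hr'
        have := hs r; have := ht r
        simp [ε, hr, hr'] at *
        omega
      have a1 := hs s; have a2 := ht s; have a3 := hs t; have a4 := ht t
      simp [ε, hst, Ne.symm hst] at a1 a2 a3 a4
      have h6 : d s = 0 ∨ d s = -1 := by omega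
      have h7 : d t = 0 ∨ d t = 1 := by omega
      have key : ∀ d' : Fin 3 → ℤ, d' s = d s → d' t = d t →
          (∀ r, r ≠ s → r ≠ t → d' r = 0) → d = d' := by
        intro d' e1 e2 e3
        funext r
        by_cases hr : r = s
        · rw [hr, e1]
        by_cases hr' : r = t
        · rw [hr', e2]
        rw [h3 r hr hr', e3 r hr hr']
      have hst' := Ne.symm hst
      rcases h6 with h6 | h6 <;> rcases h7 with h7 | h7
      · left; refine key _ ?_ ?_ ?_ <;> simp_all
      · right; left; use t
        refine key _ ?_ ?_ ?_ <;> simp_all [ε]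
      · right; right; left; use s
        refine key _ ?_ ?_ ?_ <;> simp_all [ε]
      · right; right; right; refine ⟨s, t, hst, ?_⟩
        refine key _ ?_ ?_ ?_ <;> simp_all [ε]
  rcases hd with rfl | ⟨t, rfl⟩ | ⟨s, rfl⟩ | ⟨s, t, hst, rfl⟩
  · rw [wt_zero, Units.val_one] at hwt
    exact absurd hwt.symm hne
  · rw [wt_single] at hwt
    have h3 : ∀ r, r ≠ t → (lam r : ℂ) = q ^ pr (om r) (-ε t) := fun r hr =>
      (h2 r).resolve_right fun h => by have := h t; simp [ε, Ne.symm hr] at this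
    refine ⟨![3, 4, 5] t, eq_qw fun r => ?_, by fin_cases t <;> simp [tyD] <;> decide⟩
    by_cases hr : r = t
    · rw [hr, hwt]; congr 1; fin_cases t <;> rfl
    · rw [h3 r hr]; congr 1
      fin_cases t <;> fin_cases r <;> first | exact absurd rfl hr | decide
  · have hwt' : (lam s : ℂ) = q ^ (-2 : ℤ) := by
      have h4 : (wt lam (ε s) * wt lam (-ε s) : ℂ) = 1 := by
        rw [← Units.val_mul, ← wt_add, add_neg_cancel, wt_zero, Units.val_one]
      rw [hwt, wt_single] at h4
      rw [zpow_neg]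
      exact eq_inv_of_mul_eq_one_left h4
    have h3 : ∀ r, r ≠ s → (lam r : ℂ) = q ^ pr (om r) (-ε s) := fun r hr =>
      (h1 r).resolve_right fun h => by have := h s; simp [ε, Ne.symm hr] at this
    refine ⟨![0, 1, 2] s, eq_qw fun r => ?_, by fin_cases s <;> simp [tyD] <;> decide⟩
    by_cases hr : r = s
    · rw [hr, hwt']; congr 1; fin_cases s <;> rfl
    · rw [h3 r hr]; congr 1
      fin_cases s <;> fin_cases r <;> first | exact absurd rfl hr | decide
  · have h3 : ∀ r, r ≠ s → (lam r : ℂ) = q ^ pr (om r) (ε t - ε s) := fun r hr =>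
      (h1 r).resolve_right fun h => by have := h s; simp [ε, Ne.symm hr, hst] at this
    have h4 : ∀ r, r ≠ t → (lam r : ℂ) = q ^ pr (om r) (-(ε t - ε s)) := fun r hr =>
      (h2 r).resolve_right fun h => by have := h t; simp [ε, Ne.symm hr, Ne.symm hst] at this
    have h5 : ∀ r, r ≠ s → r ≠ t → pr (om r) (ε t - ε s) = pr (om r) (-(ε t - ε s)) :=
      fun r hr hr' => zpow_inj_of_generic ((h3 r hr).symm.trans (h4 r hr'))
    have h6 : (lam s : ℂ) = q ^ pr (om s) (-(ε t - ε s)) := h4 s hst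
    have h7 : pr (om t) (ε t - ε s) - pr (om s) (-(ε t - ε s)) = 2 := by
      have h8 : (wt lam (ε t - ε s) * wt lam (ε s) : ℂ) = wt lam (ε t) := by
        rw [← Units.val_mul, ← wt_add, sub_add_cancel]
      rw [hwt, wt_single, wt_single, h6, h3 t hst.symm, ← zpow_add₀ hq] at h8
      have := zpow_inj_of_generic h8
      omega
    have h9 : (s = 1 ∧ t = 0) ∨ (s = 2 ∧ t = 1) := by
      revert h5 h7 hst
      clear * -
      revert s t
      decide
    rcases h9 with ⟨rfl, rfl⟩ | ⟨rfl, rfl⟩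
    · refine ⟨6, eq_qw fun r => ?_, by decide⟩
      by_cases hr : r = 1
      · rw [hr, h6]; congr 1
      · rw [h3 r hr]; congr 1; revert hr; revert r; decide
    · refine ⟨7, eq_qw fun r => ?_, by decide⟩
      by_cases hr : r = 2
      · rw [hr, h6]; congr 1
      · rw [h3 r hr]; congr 1; revert hr; revert r; decide

end

section
variable {q : ℂ} [GenericParam q]

theorem sub_inv_ne_zero_of_generic : q - q⁻¹ ≠ 0 := by
  intro h
  have hq : q ≠ 0 := NeZero.ne q
  have : q ^ (2 : ℤ) = 1 := by
    rw [sub_eq_zero] at h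
    rw [zpow_two]; nth_rewrite 1 [h]; exact inv_mul_cancel₀ hq
  simpa using (zpow_eq_one_iff_of_generic _).1 this

theorem UqslMA.sq_eq_one_of_ef_zero {π : UqslMA q 2 (QSpace q 3)} {i : Fin 2}
    (he : ∀ a, π.e i a = 0) (hg : ∀ a, π.g i a = 0) (a : QSpace q 3) :
    π.k i (π.k i a) = a := by
  have h := π.e_g i i a
  rw [hg a, he 0, hg (π.e i a), smul_zero, sub_zero, if_pos rfl] at h
  exact sub_eq_zero.1 ((smul_eq_zero.1 h.symm).resolve_left
    (inv_ne_zero sub_inv_ne_zero_of_generic))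

theorem eq_zero_of_wt_sq {θ : Fin 3 → ℂˣ} (h : ∀ s, (θ s : ℂ) ^ 2 = 1) {f : QTorus q} {n : ℤ}
    (hn : n ≠ 0) (hf : ∀ d, f d ≠ 0 → (wt θ d : ℂ) = q ^ n) : f = 0 := by
  ext d
  by_contra hd
  have h1 := hf d hd
  have h2 : (wt θ d) ^ 2 = 1 := by
    rw [wt, ← Finset.prod_pow]
    refine Finset.prod_eq_one fun s _ => ?_
    have : θ s ^ 2 = 1 := Units.ext (by simpa using h s)
    rw [← zpow_natCast, ← zpow_mul, mul_comm, zpow_mul, zpow_natCast, this, one_zpow]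
  have h3 : q ^ (n * 2) = 1 := by
    rw [zpow_mul, ← h1, zpow_ofNat, ← Units.val_pow_eq_pow_val, h2, Units.val_one]
  have := (zpow_eq_one_iff_of_generic _).1 h3
  omega

theorem exists_of_mul_apply_zero {f g : QTorus q} (h : (f * g : QTorus q) 0 ≠ 0) :
    ∃ d, f d ≠ 0 ∧ g (-d) ≠ 0 := by
  rw [QTorus.mul_apply] at h
  obtain ⟨d, _, hd⟩ := Finset.exists_ne_zero_of_sum_ne_zero h
  refine ⟨d, left_ne_zero_of_mul (right_ne_zero_of_mul hd), ?_⟩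
  have := right_ne_zero_of_mul (right_ne_zero_of_mul hd)
  rwa [zero_sub] at this

namespace DiagData

variable {π : UqslMA q 2 (QSpace q 3)} {lam : Fin 2 → Fin 3 → ℂˣ} {u w : Fin 2 → QTorus q}

theorem exists_type_of_ne (D : DiagData π lam u w) {i : Fin 2} {s : Fin 3}
    (h : (lam i s : ℂ) ^ 2 ≠ 1) :
    ∃ a, lam i = qw q (tyL a) ∧ u i (tyD a) ≠ 0 ∧ w i (-tyD a) ≠ 0 := by
  have h1 : ∃ d, u i d ≠ 0 ∧ w i (-d) ≠ 0 := by
    by_contra! hno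
    have h2 : (u i * w i : QTorus q) 0 = 0 := by
      by_contra h'
      obtain ⟨d, hd, hd'⟩ := exists_of_mul_apply_zero h'
      exact hd' (hno d hd)
    have h3 : (w i * u i : QTorus q) 0 = 0 := by
      by_contra h'
      obtain ⟨d, hd, hd'⟩ := exists_of_mul_apply_zero h'
      exact hd (by simpa using hno _ hd')
    refine h ?_
    rw [sq, D.commutator i i (d := 0) _ s]
    · simp [pr]
    · rw [sub_apply, sub_apply, smul_apply, h2, h3, if_pos rfl, mono_apply, if_pos rfl]
      simpa [sub_eq_zero] using sub_ne_zero.1 sub_inv_ne_zero_of_generic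
  obtain ⟨d, hu, hw⟩ := h1
  have hwt := D.u_wt i i d hu
  rw [UqslMA.cartan_self] at hwt
  obtain ⟨a, ha, rfl⟩ := exists_type hwt (D.u_supp hu) (D.w_supp hw)
  exact ⟨a, ha, hu, hw⟩

theorem tKind_zero (D : DiagData π lam u w) {i : Fin 2} (h : ∀ s, (lam i s : ℂ) ^ 2 = 1) :
    TKind q 0 π := by
  have hc : ∀ j, cartan 2 i j ≠ 0 := by fin_cases i <;> decide
  have hu : ∀ j, u j = 0 := fun j => eq_zero_of_wt_sq h (hc j) (D.u_wt j i)
  have hw : ∀ j, w j = 0 := fun j => eq_zero_of_wt_sq h (neg_ne_zero.2 (hc j)) (D.w_wt j i)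
  have he : ∀ j a, π.e j a = 0 := fun j a => toT_injective (by rw [D.e, hu]; simp)
  have hg : ∀ j a, π.g j a = 0 := fun j a => toT_injective (by rw [D.g, hw]; simp)
  have hf : ∀ j a, π.f j a = 0 := fun j a =>
    (π.k j).injective ((hg j a).trans (map_zero _).symm)
  have hk : ∀ j s, (lam j s : ℂ) = 1 ∨ (lam j s : ℂ) = -1 := by
    intro j s
    have h1 := UqslMA.sq_eq_one_of_ef_zero (he j) (hg j) (Xg q 3 s)
    rw [D.k, map_smul, D.k, smul_smul] at h1
    rw [← mul_self_eq_one_iff]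
    have h2 : ((lam j s * lam j s : ℂ) - 1) • Xg q 3 s = 0 :=
      ((sub_smul (lam j s * lam j s : ℂ) 1 (Xg q 3 s)).trans
        (congrArg₂ (· - ·) h1 (one_smul ℂ _))).trans (sub_self _)
    exact sub_eq_zero.1 ((smul_eq_zero.1 h2).resolve_right (Xg_ne_zero s))
  exact ⟨0, 1, by decide, fun s => lam 0 s, fun s => lam 1 s, hk 0, hk 1, D.k 0, D.k 1,
    fun t s => he t _, fun t s => hf t _⟩

/-- The pairs of types compatible with the Serre relation weights. -/
theorem exists_types (D : DiagData π lam u w) : TKind q 0 π ∨ ∃ i j : Fin 2, i ≠ j ∧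
    ∃ a b : Fin 8, (a, b) ∈ [((0 : Fin 8), (5 : Fin 8)), (0, 6), (5, 7), (6, 7), (6, 4), (7, 1),
      (0, 4), (5, 1)] ∧
    (lam i = qw q (tyL a) ∧ u i (tyD a) ≠ 0 ∧ w i (-tyD a) ≠ 0) ∧
    (lam j = qw q (tyL b) ∧ u j (tyD b) ≠ 0 ∧ w j (-tyD b) ≠ 0) := by
  by_cases h : ∃ i, ∀ s, (lam i s : ℂ) ^ 2 = 1
  · obtain ⟨i, hi⟩ := h
    exact Or.inl (D.tKind_zero hi)
  push Not at h
  choose s hs using h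
  choose a ha using fun i => D.exists_type_of_ne (hs i)
  have hp : ∀ i j, pr (tyL (a j)) (tyD (a i)) = cartan 2 j i := by
    intro i j
    have := D.u_wt i j _ (ha i).2.1
    rw [(ha j).1, wt_qw] at this
    exact zpow_inj_of_generic this
  have key : ∀ a b : Fin 8, pr (tyL a) (tyD b) = -1 → pr (tyL b) (tyD a) = -1 →
      (a, b) ∈ [((0 : Fin 8), (5 : Fin 8)), (0, 6), (5, 7), (6, 7), (6, 4), (7, 1), (0, 4), (5, 1)]
      ∨ (b, a) ∈ [((0 : Fin 8), (5 : Fin 8)), (0, 6), (5, 7), (6, 7), (6, 4), (7, 1), (0, 4),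
        (5, 1)] := by decide
  right
  rcases key (a 0) (a 1) (hp 1 0) (hp 0 1) with h | h
  · exact ⟨0, 1, by decide, _, _, h, ha 0, ha 1⟩
  · exact ⟨1, 0, by decide, _, _, h, ha 1, ha 0⟩

end DiagData
end

section
variable {q : ℂ} [NeZero q]

/-- The operator `x ↦ v θ(x) - x v` on the quantum torus. -/
def QTorus.inner (v : QTorus q) (θ : Fin 3 → ℂˣ) : QTorus q →ₗ[ℂ] QTorus q where
  toFun x := v * tw θ x - x * v
  map_add' x y := by rw [map_add, mul_add, add_mul]; abel
  map_smul' c x := by rw [map_smul, mul_smul_comm, smul_mul_assoc, RingHom.id_apply, smul_sub]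

theorem QTorus.inner_apply (v : QTorus q) (θ : Fin 3 → ℂˣ) (x : QTorus q) :
    QTorus.inner v θ x = v * tw θ x - x * v := rfl

theorem QTorus.inner_add (v v' : QTorus q) (θ : Fin 3 → ℂˣ) (x : QTorus q) :
    QTorus.inner (v + v') θ x = QTorus.inner v θ x + QTorus.inner v' θ x := by
  simp only [QTorus.inner_apply, add_mul, mul_add]; abel

theorem QTorus.inner_mono (c d l : Fin 3 → ℤ) (s t : ℂ) :
    QTorus.inner (mono c s) (qw q l) (mono d t : QTorus q) =
      mono (c + d) (s * t * (q ^ (ordExp c d + pr l d) - q ^ ordExp d c)) := by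
  have hq : q ≠ 0 := NeZero.ne q
  rw [QTorus.inner_apply, tw_mono, wt_qw, mono_mul_mono, mono_mul_mono, add_comm d c,
    sub_eq_iff_eq_add, ← mono_add, zpow_add₀ hq]
  congr 1
  ring

/-- The difference of the two `q`-exponents occurring in `QTorus.inner_mono`. -/
def gap (l c d : Fin 3 → ℤ) : ℤ := ordExp c d + pr l d - ordExp d c

theorem QTorus.inner_mono_eq_zero {c d l : Fin 3 → ℤ} (h : gap l c d = 0) (s t : ℂ) :
    QTorus.inner (mono c s) (qw q l) (mono d t : QTorus q) = 0 := by
  rw [QTorus.inner_mono, sub_eq_zero.1 h, sub_self, mul_zero, mono_zero]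

end

section
variable {q : ℂ} [GenericParam q]

theorem QTorus.exists_inner_mono {c d l : Fin 3 → ℤ} (h : gap l c d ≠ 0) : ∃ z : ℂ, z ≠ 0 ∧
    ∀ s t, QTorus.inner (mono c s) (qw q l) (mono d t : QTorus q) = mono (c + d) (s * t * z) :=
  ⟨_, sub_ne_zero.2 fun h' => h (sub_eq_zero.2 (zpow_inj_of_generic h')), fun s t =>
    QTorus.inner_mono c d l s t⟩

/-- A quantum Serre relation prevents the exponent `c'` from occurring along with `c`. -/
theorem QTorus.coeff_eq_zero_of_serre {l m c c' p d : Fin 3 → ℤ} {b b' s : ℂ}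
    {G H : QTorus q →ₗ[ℂ] QTorus q}
    (hG : G = QTorus.inner (mono c b + mono c' b') (qw q l))
    (hH : H = QTorus.inner (mono p s) (qw q m))
    (hS : G (G (H (mono d 1))) - (q + q⁻¹) • G (H (G (mono d 1))) + H (G (G (mono d 1))) = 0)
    (hc : c ≠ c') (h1 : gap m p d = 0) (h2 : gap l c' d = 0) (h3 : gap l c' (c + d) = 0)
    (h4 : gap l c d ≠ 0) (h5 : gap m p (c + d) ≠ 0) (h6 : gap l c' (p + (c + d)) ≠ 0)
    (hb : b ≠ 0) (hs : s ≠ 0) : b' = 0 := by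
  have hq : q ≠ 0 := NeZero.ne q
  obtain ⟨z1, hz1, e1⟩ := QTorus.exists_inner_mono (q := q) h4
  obtain ⟨z2, hz2, e2⟩ := QTorus.exists_inner_mono (q := q) h5
  obtain ⟨z3, hz3, e3⟩ := QTorus.exists_inner_mono (q := q) h6
  have hG' : ∀ x, G x = QTorus.inner (mono c b) (qw q l) x + QTorus.inner (mono c' b') (qw q l) x :=
    fun x => by rw [hG, QTorus.inner_add]
  have hx : G (mono d 1) = mono (c + d) (b * 1 * z1) := by
    rw [hG', e1, QTorus.inner_mono_eq_zero h2, add_zero]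
  have hy := QTorus.inner_mono (q := q) c (c + d) l b (b * 1 * z1)
  rw [hx, hG' (mono _ (b * 1 * z1)), QTorus.inner_mono_eq_zero h3, add_zero, hy, hH,
    QTorus.inner_mono_eq_zero h1, map_zero, map_zero, e2, hG', e3, QTorus.inner_mono,
    QTorus.inner_mono] at hS
  have hS' := congrArg (fun f : QTorus q => f (c' + (p + (c + d)))) hS
  have n1 : c + (p + (c + d)) ≠ c' + (p + (c + d)) := fun h => hc (add_right_cancel h)
  have n2 : p + (c + (c + d)) ≠ c' + (p + (c + d)) := fun h => hc (by
    rw [← add_assoc p, add_comm p c, add_assoc c p] at h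
    exact add_right_cancel h)
  simp only [add_apply, neg_apply, smul_apply, mono_apply, if_neg n1, if_neg n2, if_true,
    add_zero, zero_apply, zero_sub, neg_eq_zero] at hS'
  have hq2 : q + q⁻¹ ≠ 0 := by
    intro h
    have h7 : q ^ 2 = -1 := by field_simp at h; linear_combination h
    exact GenericParam.pow_ne_one (q := q) 4 (by norm_num)
      (by rw [show (4 : ℕ) = 2 * 2 from rfl, pow_mul, h7]; norm_num)
  simpa [hq2, hb, hs, hz1, hz2, hz3] using hS'

theorem UqslMA.f_k (π : UqslMA q 2 (QSpace q 3)) (i j : Fin 2) (a : QSpace q 3) :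
    π.f i (π.k j a) = q ^ cartan 2 j i • π.k j (π.f i a) := by
  rw [π.k_f, smul_smul, ← zpow_add₀ (NeZero.ne q), add_neg_cancel, zpow_zero]
  exact (one_smul ℂ _).symm

theorem cartan_of_ne {i j : Fin 2} (hij : i ≠ j) : cartan 2 i j = -1 := by
  revert hij; fin_cases i <;> fin_cases j <;> simp [cartan]

theorem UqslMA.serre_g (π : UqslMA q 2 (QSpace q 3)) {i j : Fin 2} (hij : i ≠ j)
    (a : QSpace q 3) : π.g i (π.g i (π.g j a)) - (q + q⁻¹) • π.g i (π.g j (π.g i a))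
      + π.g j (π.g i (π.g i a)) = 0 := by
  have hq : q ≠ 0 := NeZero.ne q
  have h := congrArg (fun b => π.k j (π.k i (π.k i b))) (π.serre_f i j (cartan_of_ne hij) a)
  have e1 : ∀ a, π.f i (π.k i a) = q ^ (2 : ℤ) • π.k i (π.f i a) := fun a => by
    rw [π.f_k, cartan_self]
  have e2 : ∀ a, π.f i (π.k j a) = q ^ (-1 : ℤ) • π.k j (π.f i a) := fun a => by
    rw [π.f_k, cartan_of_ne hij.symm]
  have e3 : ∀ a, π.f j (π.k i a) = q ^ (-1 : ℤ) • π.k i (π.f j a) := fun a => by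
    rw [π.f_k, cartan_of_ne hij]
  have e4 : q ^ (-1 : ℤ) * (q ^ (2 : ℤ) * q ^ (-1 : ℤ)) = 1 := by
    rw [← zpow_add₀ hq, ← zpow_add₀ hq]; rfl
  have e5 : q ^ (2 : ℤ) * (q ^ (-1 : ℤ) * q ^ (-1 : ℤ)) = 1 := by
    rw [← zpow_add₀ hq, ← zpow_add₀ hq]; rfl
  simp only [map_add, map_sub, map_smul, map_zero, π.k_comm j i] at h
  simp only [UqslMA.g_apply, e1, e2, e3, map_smul, smul_smul, π.k_comm j i, e4, e5,
    mul_one]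
  rw [one_smul ℂ (π.k i (π.k i (π.k j (π.f i (π.f i (π.f j a)))))),
    one_smul ℂ (π.k i (π.k i (π.k j (π.f j (π.f i (π.f i a))))))]
  exact h

namespace DiagData

variable {π : UqslMA q 2 (QSpace q 3)} {lam : Fin 2 → Fin 3 → ℂˣ} {u w : Fin 2 → QTorus q}

theorem serre_u (D : DiagData π lam u w) {i j : Fin 2} (hij : i ≠ j) (s : Fin 3) :
    QTorus.inner (u i) (lam i) (QTorus.inner (u i) (lam i)
        (QTorus.inner (u j) (lam j) (mono (ε s) 1)))
      - (q + q⁻¹) • QTorus.inner (u i) (lam i)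
          (QTorus.inner (u j) (lam j) (QTorus.inner (u i) (lam i) (mono (ε s) 1)))
      + QTorus.inner (u j) (lam j) (QTorus.inner (u i) (lam i)
          (QTorus.inner (u i) (lam i) (mono (ε s) 1))) = 0 := by
  have h := congrArg toT (π.serre_e i j (cartan_of_ne hij) (Xg q 3 s))
  rw [map_zero, map_add, map_sub, map_smul] at h
  simpa only [D.e, toT_Xg, QTorus.inner_apply] using h

theorem serre_w (D : DiagData π lam u w) {i j : Fin 2} (hij : i ≠ j) (s : Fin 3) :
    QTorus.inner (w i) (lam i) (QTorus.inner (w i) (lam i)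
        (QTorus.inner (w j) (lam j) (mono (ε s) 1)))
      - (q + q⁻¹) • QTorus.inner (w i) (lam i)
          (QTorus.inner (w j) (lam j) (QTorus.inner (w i) (lam i) (mono (ε s) 1)))
      + QTorus.inner (w j) (lam j) (QTorus.inner (w i) (lam i)
          (QTorus.inner (w i) (lam i) (mono (ε s) 1))) = 0 := by
  have h := congrArg toT (π.serre_g hij (Xg q 3 s))
  rw [map_zero, map_add, map_sub, map_smul] at h
  simpa only [D.g, toT_Xg, QTorus.inner_apply] using h

end DiagData

theorem qw_apply (l : Fin 3 → ℤ) (s : Fin 3) : (qw q l s : ℂ) = q ^ l s := by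
  rw [← wt_single (qw q _), wt_qw]
  congr 1
  fin_cases s <;> simp [pr]

namespace DiagData

variable {π : UqslMA q 2 (QSpace q 3)} {lam : Fin 2 → Fin 3 → ℂˣ} {u w : Fin 2 → QTorus q}
  {i j : Fin 2} {l m : Fin 3 → ℤ}

theorem u_int (D : DiagData π lam u w) (hij : i ≠ j) (hi : lam i = qw q l) (hj : lam j = qw q m)
    {d : Fin 3 → ℤ} (h : u i d ≠ 0) :
    pr l d = 2 ∧ pr m d = -1 ∧ ∀ s, l s = pr (om s) d ∨ ∀ r, 0 ≤ d r + ε s r := by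
  refine ⟨?_, ?_, fun s => (D.u_supp h s).imp_left fun h' => ?_⟩
  · have := D.u_wt i i d h
    rw [hi, wt_qw, UqslMA.cartan_self] at this
    exact zpow_inj_of_generic this
  · have := D.u_wt i j d h
    rw [hj, wt_qw, cartan_of_ne hij.symm] at this
    exact zpow_inj_of_generic this
  · rw [hi, qw_apply] at h'
    exact zpow_inj_of_generic h'

theorem w_int (D : DiagData π lam u w) (hij : i ≠ j) (hi : lam i = qw q l) (hj : lam j = qw q m)
    {d : Fin 3 → ℤ} (h : w i d ≠ 0) :
    pr l d = -2 ∧ pr m d = 1 ∧ ∀ s, l s = pr (om s) d ∨ ∀ r, 0 ≤ d r + ε s r := by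
  refine ⟨?_, ?_, fun s => (D.w_supp h s).imp_left fun h' => ?_⟩
  · have := D.w_wt i i d h
    rw [hi, wt_qw, UqslMA.cartan_self] at this
    exact zpow_inj_of_generic this
  · have := D.w_wt i j d h
    rw [hj, wt_qw, cartan_of_ne hij.symm] at this
    exact zpow_inj_of_generic this
  · rw [hi, qw_apply] at h'
    exact zpow_inj_of_generic h'

/-- The coefficient of a quantum commutator at a degree reached by a unique pair of exponents. -/
theorem add_eq_zero_of_unique (D : DiagData π lam u w) (hi : lam i = qw q l)
    {a b : Fin 3 → ℤ} (ha : u i a ≠ 0) (hb : w i b ≠ 0)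
    (h : ∀ a' b', u i a' ≠ 0 → w i b' ≠ 0 → a' + b' = a + b → a' = a ∧ b' = b)
    (hne : a + b = 0 ∨ ordExp a b ≠ 2 + ordExp b a ∧ ∃ s, l s + l s ≠ pr (om s) (a + b)) :
    a + b = 0 := by
  have hq : q ≠ 0 := NeZero.ne q
  by_contra h0
  obtain ⟨h1, s, h2⟩ := hne.resolve_left h0
  refine h2 (zpow_inj_of_generic (q := q) ?_)
  rw [zpow_add₀ hq, ← qw_apply, ← hi]
  refine D.commutator i i (fun h3 => ?_) s
  rw [sub_apply, sub_apply, smul_apply, mul_apply_add_of_unique _ _ _ _ h, add_comm a b,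
    mul_apply_add_of_unique _ _ b a fun b' a' hb' ha' h' => (h a' b' ha' hb'
      (by rw [add_comm a', h', add_comm])).symm, if_pos rfl, mono_apply, add_comm b a,
    if_neg (Ne.symm h0), UqslMA.cartan_self, sub_zero, mul_comm (w i b),
    ← mul_assoc (q ^ _) (q ^ _),
    ← zpow_add₀ hq, ← sub_mul] at h3
  exact h1 (zpow_inj_of_generic (sub_eq_zero.1 ((mul_eq_zero.1 h3).resolve_right
    (mul_ne_zero ha hb))))

theorem eq_mono (D : DiagData π lam u w) (hi : lam i = qw q l) {d : Fin 3 → ℤ}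
    (hu : u i d ≠ 0) (hw : w i (-d) ≠ 0)
    (h : ∀ a b, u i a ≠ 0 → w i b ≠ 0 →
      a + b = 0 ∨ ordExp a b ≠ 2 + ordExp b a ∧ ∃ s, l s + l s ≠ pr (om s) (a + b)) :
    u i = mono d (u i d) ∧ w i = mono (-d) (w i (-d)) := by
  have hu0 : u i ≠ 0 := fun h => hu (by rw [h, zero_apply])
  have hw0 : w i ≠ 0 := fun h => hw (by rw [h, zero_apply])
  obtain ⟨a, b, ha, hb, hta, htb, hab⟩ := exists_top _ _ hu0 hw0
  obtain ⟨a', b', ha', hb', hta', htb', hab'⟩ := exists_bot _ _ hu0 hw0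
  have h1 : b = -a := (neg_eq_of_add_eq_zero_right
    (D.add_eq_zero_of_unique hi ha hb hab (h a b ha hb))).symm
  have h2 : b' = -a' := (neg_eq_of_add_eq_zero_right
    (D.add_eq_zero_of_unique hi ha' hb' hab' (h a' b' ha' hb'))).symm
  have h3 : toLex a ≤ toLex a' := by
    have := htb _ hb'
    rw [h1, h2, toLex_neg, toLex_neg] at this
    exact neg_le_neg_iff.1 this
  have hu' : ∀ x, u i x ≠ 0 → x = a := fun x hx =>
    toLex.injective ((hta x hx).antisymm (h3.trans (hta' x hx)))
  have hw' : ∀ x, w i x ≠ 0 → x = -a := fun x hx => by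
    rw [← h1]
    refine toLex.injective ((htb x hx).antisymm (le_trans ?_ (htb' x hx)))
    rw [h1, h2, toLex_neg, toLex_neg]
    exact neg_le_neg_iff.2 (hta' a ha)
  obtain rfl := hu' d hu
  exact ⟨eq_mono_of_supp hu', eq_mono_of_supp hw'⟩

end DiagData
end

section
variable {q : ℂ} [GenericParam q]

namespace DiagData

variable {π : UqslMA q 2 (QSpace q 3)} {lam : Fin 2 → Fin 3 → ℂˣ} {u w : Fin 2 → QTorus q}
  {i j : Fin 2} {l m : Fin 3 → ℤ}

theorem eq_mono_of_line (D : DiagData π lam u w) (hi : lam i = qw q l) {d n : Fin 3 → ℤ}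
    (hu : u i d ≠ 0) (hw : w i (-d) ≠ 0) (hn : ordExp d n - ordExp n d = -2) (hl : 0 ≤ l 0)
    (hn' : 0 < n 1 + n 2) (r : Fin 3)
    (h1 : ∀ a, u i a ≠ 0 → d r ≤ a r ∧ ∀ s, a s = d s + (a r - d r) * n s)
    (h2 : ∀ b, w i b ≠ 0 → -d r ≤ b r ∧ ∀ s, b s = -d s + (b r + d r) * n s) :
    u i = mono d (u i d) ∧ w i = mono (-d) (w i (-d)) := by
  refine D.eq_mono hi hu hw fun a b ha hb => ?_
  obtain ⟨s, hs, rfl⟩ : ∃ t, 0 ≤ t ∧ a = d + t • n :=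
    ⟨a r - d r, sub_nonneg.2 (h1 a ha).1, funext (h1 a ha).2⟩
  obtain ⟨t, ht, rfl⟩ : ∃ t, 0 ≤ t ∧ b = -d + t • n :=
    ⟨b r + d r, by linarith [(h2 b hb).1], funext (h2 b hb).2⟩
  obtain h | h : s + t = 0 ∨ 0 < s + t := by omega
  · left
    obtain ⟨rfl, rfl⟩ : s = 0 ∧ t = 0 := by omega
    simp
  · right
    constructor
    · intro h'
      have h3 : ordExp (d + s • n) (-d + t • n) - ordExp (-d + t • n) (d + s • n) =
          (s + t) * (ordExp d n - ordExp n d) := by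
        simp only [ordExp, Pi.add_apply, Pi.neg_apply, Pi.smul_apply, smul_eq_mul]; ring
      rw [hn] at h3
      omega
    · refine ⟨0, fun h' => ?_⟩
      have h3 : pr (om 0) (d + s • n + (-d + t • n)) = -((s + t) * (n 1 + n 2)) := by
        rw [pr_om_zero]
        simp only [Pi.add_apply, Pi.neg_apply, Pi.smul_apply, smul_eq_mul]; ring
      rw [h3] at h'
      have := mul_pos h hn'
      omega

theorem eq_mono_of_unique (D : DiagData π lam u w) (hi : lam i = qw q l) {d : Fin 3 → ℤ}
    (hu : u i d ≠ 0) (hw : w i (-d) ≠ 0) (h1 : ∀ a, u i a ≠ 0 → a = d)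
    (h2 : ∀ b, w i b ≠ 0 → b = -d) :
    u i = mono d (u i d) ∧ w i = mono (-d) (w i (-d)) :=
  D.eq_mono hi hu hw fun a b ha hb => Or.inl (by rw [h1 a ha, h2 b hb, add_neg_cancel])

/-- The pairs of types for which the exponents are determined by the weights alone. -/
theorem eq_mono_of_type (D : DiagData π lam u w) (hij : i ≠ j) {a b : Fin 8}
    (hi : lam i = qw q (tyL a)) (hj : lam j = qw q (tyL b)) (hu : u i (tyD a) ≠ 0)
    (hw : w i (-tyD a) ≠ 0) (h : (a, b) ∈ [((0 : Fin 8), (5 : Fin 8)), (5, 0), (6, 0), (7, 5),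
      (6, 7), (7, 6), (6, 4), (4, 6), (7, 1), (1, 7)]) :
    u i = mono (tyD a) (u i (tyD a)) ∧ w i = mono (-tyD a) (w i (-tyD a)) := by
  have hU := fun d (hd : u i d ≠ 0) => D.u_int hij hi hj hd
  have hW := fun d (hd : w i d ≠ 0) => D.w_int hij hi hj hd
  simp only [Fin.forall_fin_succ, Fin.forall_fin_zero, Fin.succ_zero_eq_one, Fin.succ_one_eq_two,
    pr_om_zero, pr_om_one, pr_om_two, ε] at hU hW
  simp only [List.mem_cons, Prod.mk.injEq, List.not_mem_nil, or_false] at h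
  have hext : ∀ x y : Fin 3 → ℤ, x 0 = y 0 → x 1 = y 1 → x 2 = y 2 → x = y := fun x y h0 h1 h2 => by
    funext r; fin_cases r <;> assumption
  rcases h with ⟨rfl, rfl⟩ | ⟨rfl, rfl⟩ | ⟨rfl, rfl⟩ | ⟨rfl, rfl⟩ | ⟨rfl, rfl⟩ | ⟨rfl, rfl⟩ |
    ⟨rfl, rfl⟩ | ⟨rfl, rfl⟩ | ⟨rfl, rfl⟩ | ⟨rfl, rfl⟩ <;> simp [pr, tyL] at hU hW
  iterate 4
    · refine D.eq_mono_of_unique hi hu hw (fun d hd => ?_) fun d hd => ?_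
      · have := hU d hd
        refine hext _ _ ?_ ?_ ?_ <;> simp [tyD] <;> omega
      · have := hW d hd
        refine hext _ _ ?_ ?_ ?_ <;> simp [tyD] <;> omega
  iterate 2
    refine D.eq_mono_of_line hi hu hw (n := ![1, 1, 1]) (by decide) (by decide) (by decide) 0
      (fun d hd => ?_) fun d hd => ?_
    · have := hU d hd
      simp [Fin.forall_fin_succ, tyD]
      omega
    · have := hW d hd
      simp [Fin.forall_fin_succ, tyD]
      omega
  iterate 2
    refine D.eq_mono_of_line hi hu hw (n := ![1, 1, 3]) (by decide) (by decide) (by decide) 0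
      (fun d hd => ?_) fun d hd => ?_
    · have := hU d hd
      simp [Fin.forall_fin_succ, tyD]
      omega
    · have := hW d hd
      simp [Fin.forall_fin_succ, tyD]
      omega
  iterate 2
    refine D.eq_mono_of_line hi hu hw (n := ![3, 1, 1]) (by decide) (by decide) (by decide) 1
      (fun d hd => ?_) fun d hd => ?_
    · have := hU d hd
      simp [Fin.forall_fin_succ, tyD]
      omega
    · have := hW d hd
      simp [Fin.forall_fin_succ, tyD]
      omega

end DiagData
end

section
variable {q : ℂ} [GenericParam q]

/-- The normalized leading coefficients of the raising operators. -/
def nu (q : ℂ) (a : Fin 8) : ℂ :=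
  (![-q, -q, -q, -1, -1, -1, -1, -1] : Fin 8 → ℂ) a * (q - q⁻¹)⁻¹

/-- The normalized leading coefficients of the lowering operators. -/
def nw (q : ℂ) (a : Fin 8) : ℂ :=
  (![(q ^ 2)⁻¹, (q ^ 2)⁻¹, (q ^ 2)⁻¹, q⁻¹, q⁻¹, q⁻¹, (q ^ 2)⁻¹, (q ^ 2)⁻¹] : Fin 8 → ℂ) a *
    (q - q⁻¹)⁻¹

theorem sq_sub_one_ne_zero_of_generic : q ^ 2 - 1 ≠ 0 :=
  sub_ne_zero.2 (GenericParam.pow_ne_one 2 two_pos)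

namespace DiagData

variable {π : UqslMA q 2 (QSpace q 3)} {lam : Fin 2 → Fin 3 → ℂˣ} {u w : Fin 2 → QTorus q}
  {i j : Fin 2} {l m : Fin 3 → ℤ}

theorem e_eq_of_mono (D : DiagData π lam u w) (hi : lam i = qw q l) {d d' : Fin 3 → ℤ} {c c' : ℂ}
    (hu : u i = mono d c) {s : Fin 3} {a : QSpace q 3} (ha : toT a = mono d' c')
    (hd : d + ε s = d') (hc : c * (q ^ (ordExp d (ε s) + pr l (ε s)) - q ^ ordExp (ε s) d) = c') :
    π.e i (Xg q 3 s) = a := by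
  refine D.e_eq_of ?_
  rw [← QTorus.inner_apply, hi, hu, QTorus.inner_mono, ha, ← hd, ← hc, mul_one]

theorem e_eq_zero (D : DiagData π lam u w) (hi : lam i = qw q l) {d : Fin 3 → ℤ} {c : ℂ}
    (hu : u i = mono d c) {s : Fin 3} (h : gap l d (ε s) = 0) : π.e i (Xg q 3 s) = 0 := by
  refine D.e_eq_of ?_
  rw [← QTorus.inner_apply, hi, hu, QTorus.inner_mono_eq_zero h, map_zero]

theorem f_eq_of_mono (D : DiagData π lam u w) (hi : lam i = qw q l) {d d' : Fin 3 → ℤ} {c c' : ℂ}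
    (hw : w i = mono d c) {s : Fin 3} {a : QSpace q 3} (ha : toT a = mono d' c')
    (hd : d + ε s = d') (hc : c * (q ^ (ordExp d (ε s) + pr l (ε s)) - q ^ ordExp (ε s) d) =
      q ^ pr l d' * c') : π.f i (Xg q 3 s) = a := by
  refine D.f_eq_of ?_
  rw [← QTorus.inner_apply, hi, hw, QTorus.inner_mono, ha, tw_mono, wt_qw, ← hc, hd, mul_one]

theorem f_eq_zero (D : DiagData π lam u w) (hi : lam i = qw q l) {d : Fin 3 → ℤ} {c : ℂ}
    (hw : w i = mono d c) {s : Fin 3} (h : gap l d (ε s) = 0) : π.f i (Xg q 3 s) = 0 := by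
  refine D.f_eq_of ?_
  rw [← QTorus.inner_apply, hi, hw, QTorus.inner_mono_eq_zero h, map_zero, map_zero]

theorem toT_smul_mul (c : ℂ) (s t : Fin 3) :
    toT (c • (Xg q 3 s * Xg q 3 t)) = mono (ε s + ε t) (c * q ^ ordExp (ε s) (ε t)) := by
  rw [map_smul, map_mul, toT_Xg, toT_Xg, mono_mul_mono, smul_mono, mul_one, mul_one]

theorem toT_smul_sq (c : ℂ) (s : Fin 3) :
    toT (c • Xg q 3 s ^ 2) = mono (ε s + ε s) (c * q ^ ordExp (ε s) (ε s)) := by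
  rw [pow_two, toT_smul_mul]

theorem toT_one : toT (1 : QSpace q 3) = mono 0 1 := map_one _

theorem toT_mul (s t : Fin 3) :
    toT (Xg q 3 s * Xg q 3 t) = mono (ε s + ε t) (q ^ ordExp (ε s) (ε t)) := by
  rw [map_mul, toT_Xg, toT_Xg, mono_mul_mono, mul_one, mul_one]

theorem e_ty0 (D : DiagData π lam u w) (hi : lam i = qw q (tyL 0))
    (h : u i = mono (tyD 0) (nu q 0)) :
    π.e i (Z1 q) = 1 ∧ π.e i (Z2 q) = 0 ∧ π.e i (Z3 q) = 0 := by
  have hq : q ≠ 0 := NeZero.ne q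
  have hr := sq_sub_one_ne_zero_of_generic (q := q)
  refine ⟨D.e_eq_of_mono hi h toT_one (by decide) ?_,
    D.e_eq_zero hi h (by decide),
    D.e_eq_zero hi h (by decide)⟩
  · simp [nu, tyL, tyD, ordExp, pr]
    try field_simp
    try ring

theorem f_ty0 (D : DiagData π lam u w) (hi : lam i = qw q (tyL 0))
    (h : w i = mono (-tyD 0) (nw q 0)) :
    π.f i (Z1 q) = (-q) • (Z1 q ^ 2) ∧ π.f i (Z2 q) = (-q) • (Z1 q * Z2 q) ∧
    π.f i (Z3 q) = (-q) • (Z1 q * Z3 q) := by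
  have hq : q ≠ 0 := NeZero.ne q
  have hr := sq_sub_one_ne_zero_of_generic (q := q)
  refine ⟨D.f_eq_of_mono hi h (toT_smul_sq ..) (by decide) ?_,
    D.f_eq_of_mono hi h (toT_smul_mul ..) (by decide) ?_,
    D.f_eq_of_mono hi h (toT_smul_mul ..) (by decide) ?_⟩ <;>
  · simp [nw, tyL, tyD, ordExp, pr]
    try field_simp
    try ring

theorem e_ty1 (D : DiagData π lam u w) (hi : lam i = qw q (tyL 1))
    (h : u i = mono (tyD 1) (nu q 1)) :
    π.e i (Z1 q) = 0 ∧ π.e i (Z2 q) = 1 ∧ π.e i (Z3 q) = 0 := by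
  have hq : q ≠ 0 := NeZero.ne q
  have hr := sq_sub_one_ne_zero_of_generic (q := q)
  refine ⟨D.e_eq_zero hi h (by decide),
    D.e_eq_of_mono hi h toT_one (by decide) ?_,
    D.e_eq_zero hi h (by decide)⟩
  · simp [nu, tyL, tyD, ordExp, pr]
    try field_simp
    try ring

theorem f_ty1 (D : DiagData π lam u w) (hi : lam i = qw q (tyL 1))
    (h : w i = mono (-tyD 1) (nw q 1)) :
    π.f i (Z1 q) = Z1 q * Z2 q ∧ π.f i (Z2 q) = (-q) • (Z2 q ^ 2) ∧
    π.f i (Z3 q) = (-q) • (Z2 q * Z3 q) := by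
  have hq : q ≠ 0 := NeZero.ne q
  have hr := sq_sub_one_ne_zero_of_generic (q := q)
  refine ⟨D.f_eq_of_mono hi h (toT_mul ..) (by decide) ?_,
    D.f_eq_of_mono hi h (toT_smul_sq ..) (by decide) ?_,
    D.f_eq_of_mono hi h (toT_smul_mul ..) (by decide) ?_⟩ <;>
  · simp [nw, tyL, tyD, ordExp, pr]
    try field_simp
    try ring

theorem e_ty4 (D : DiagData π lam u w) (hi : lam i = qw q (tyL 4))
    (h : u i = mono (tyD 4) (nu q 4)) :
    π.e i (Z1 q) = (-q) • (Z1 q * Z2 q) ∧ π.e i (Z2 q) = (-q) • (Z2 q ^ 2) ∧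
    π.e i (Z3 q) = Z2 q * Z3 q := by
  have hq : q ≠ 0 := NeZero.ne q
  have hr := sq_sub_one_ne_zero_of_generic (q := q)
  refine ⟨D.e_eq_of_mono hi h (toT_smul_mul ..) (by decide) ?_,
    D.e_eq_of_mono hi h (toT_smul_sq ..) (by decide) ?_,
    D.e_eq_of_mono hi h (toT_mul ..) (by decide) ?_⟩ <;>
  · simp [nu, tyL, tyD, ordExp, pr]
    try field_simp
    try ring

theorem f_ty4 (D : DiagData π lam u w) (hi : lam i = qw q (tyL 4))
    (h : w i = mono (-tyD 4) (nw q 4)) :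
    π.f i (Z1 q) = 0 ∧ π.f i (Z2 q) = 1 ∧ π.f i (Z3 q) = 0 := by
  have hq : q ≠ 0 := NeZero.ne q
  have hr := sq_sub_one_ne_zero_of_generic (q := q)
  refine ⟨D.f_eq_zero hi h (by decide),
    D.f_eq_of_mono hi h toT_one (by decide) ?_,
    D.f_eq_zero hi h (by decide)⟩
  · simp [nw, tyL, tyD, ordExp, pr]
    try field_simp
    try ring

theorem e_ty5 (D : DiagData π lam u w) (hi : lam i = qw q (tyL 5))
    (h : u i = mono (tyD 5) (nu q 5)) :
    π.e i (Z1 q) = (-q) • (Z1 q * Z3 q) ∧ π.e i (Z2 q) = (-q) • (Z2 q * Z3 q) ∧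
    π.e i (Z3 q) = (-q) • (Z3 q ^ 2) := by
  have hq : q ≠ 0 := NeZero.ne q
  have hr := sq_sub_one_ne_zero_of_generic (q := q)
  refine ⟨D.e_eq_of_mono hi h (toT_smul_mul ..) (by decide) ?_,
    D.e_eq_of_mono hi h (toT_smul_mul ..) (by decide) ?_,
    D.e_eq_of_mono hi h (toT_smul_sq ..) (by decide) ?_⟩ <;>
  · simp [nu, tyL, tyD, ordExp, pr]
    try field_simp
    try ring

theorem f_ty5 (D : DiagData π lam u w) (hi : lam i = qw q (tyL 5))
    (h : w i = mono (-tyD 5) (nw q 5)) :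
    π.f i (Z1 q) = 0 ∧ π.f i (Z2 q) = 0 ∧ π.f i (Z3 q) = 1 := by
  have hq : q ≠ 0 := NeZero.ne q
  have hr := sq_sub_one_ne_zero_of_generic (q := q)
  refine ⟨D.f_eq_zero hi h (by decide),
    D.f_eq_zero hi h (by decide),
    D.f_eq_of_mono hi h toT_one (by decide) ?_⟩
  · simp [nw, tyL, tyD, ordExp, pr]
    try field_simp
    try ring

theorem e_ty6 (D : DiagData π lam u w) (hi : lam i = qw q (tyL 6))
    (h : u i = mono (tyD 6) (nu q 6)) :
    π.e i (Z1 q) = 0 ∧ π.e i (Z2 q) = Z1 q ∧ π.e i (Z3 q) = 0 := by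
  have hq : q ≠ 0 := NeZero.ne q
  have hr := sq_sub_one_ne_zero_of_generic (q := q)
  refine ⟨D.e_eq_zero hi h (by decide),
    D.e_eq_of_mono hi h (toT_Xg _) (by decide) ?_,
    D.e_eq_zero hi h (by decide)⟩
  · simp [nu, tyL, tyD, ordExp, pr]
    try field_simp
    try ring

theorem f_ty6 (D : DiagData π lam u w) (hi : lam i = qw q (tyL 6))
    (h : w i = mono (-tyD 6) (nw q 6)) :
    π.f i (Z1 q) = Z2 q ∧ π.f i (Z2 q) = 0 ∧ π.f i (Z3 q) = 0 := by
  have hq : q ≠ 0 := NeZero.ne q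
  have hr := sq_sub_one_ne_zero_of_generic (q := q)
  refine ⟨D.f_eq_of_mono hi h (toT_Xg _) (by decide) ?_,
    D.f_eq_zero hi h (by decide),
    D.f_eq_zero hi h (by decide)⟩
  · simp [nw, tyL, tyD, ordExp, pr]
    try field_simp
    try ring

theorem e_ty7 (D : DiagData π lam u w) (hi : lam i = qw q (tyL 7))
    (h : u i = mono (tyD 7) (nu q 7)) :
    π.e i (Z1 q) = 0 ∧ π.e i (Z2 q) = 0 ∧ π.e i (Z3 q) = Z2 q := by
  have hq : q ≠ 0 := NeZero.ne q
  have hr := sq_sub_one_ne_zero_of_generic (q := q)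
  refine ⟨D.e_eq_zero hi h (by decide),
    D.e_eq_zero hi h (by decide),
    D.e_eq_of_mono hi h (toT_Xg _) (by decide) ?_⟩
  · simp [nu, tyL, tyD, ordExp, pr]
    try field_simp
    try ring

theorem f_ty7 (D : DiagData π lam u w) (hi : lam i = qw q (tyL 7))
    (h : w i = mono (-tyD 7) (nw q 7)) :
    π.f i (Z1 q) = 0 ∧ π.f i (Z2 q) = Z3 q ∧ π.f i (Z3 q) = 0 := by
  have hq : q ≠ 0 := NeZero.ne q
  have hr := sq_sub_one_ne_zero_of_generic (q := q)
  refine ⟨D.f_eq_zero hi h (by decide),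
    D.f_eq_of_mono hi h (toT_Xg _) (by decide) ?_,
    D.f_eq_zero hi h (by decide)⟩
  · simp [nw, tyL, tyD, ordExp, pr]
    try field_simp
    try ring

end DiagData

end

section
variable {q : ℂ} [GenericParam q]

namespace DiagData

variable {π : UqslMA q 2 (QSpace q 3)} {lam : Fin 2 → Fin 3 → ℂˣ} {u w : Fin 2 → QTorus q}
  {i j : Fin 2} {l m : Fin 3 → ℤ}

theorem k_eq (D : DiagData π lam u w) (hi : lam i = qw q l) (s : Fin 3) :
    π.k i (Xg q 3 s) = q ^ l s • Xg q 3 s := by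
  rw [D.k, hi, qw_apply]

/-- The product of the leading coefficients is determined by the commutator at degree `0`. -/
theorem coeff_mul_coeff (D : DiagData π lam u w) (hi : lam i = qw q l) {s : Fin 3} (hs : l s ≠ 0)
    {d : Fin 3 → ℤ} (h : ∀ a, u i a ≠ 0 → w i (-a) ≠ 0 → a = d) :
    u i d * w i (-d) * (1 - q ^ 2) = q ^ ordExp d d * (q - q⁻¹)⁻¹ := by
  have hq : q ≠ 0 := NeZero.ne q
  have h0 : (u i * w i - q ^ cartan 2 i i • (w i * u i) -
      (if i = i then mono 0 (q - q⁻¹)⁻¹ else 0) : QTorus q) 0 = 0 := by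
    by_contra h'
    have h1 := D.commutator i i h' s
    rw [hi, qw_apply, ← zpow_add₀ hq] at h1
    have h2 := zpow_inj_of_generic h1
    simp [pr] at h2
    omega
  have h1 : ∀ a b, u i a ≠ 0 → w i b ≠ 0 → a + b = d + -d → a = d ∧ b = -d := by
    intro a b ha hb hab
    rw [add_neg_cancel] at hab
    obtain rfl := (neg_eq_of_add_eq_zero_right hab).symm
    obtain rfl := h a ha hb
    exact ⟨rfl, rfl⟩
  have h2 := mul_apply_add_of_unique (u i) (w i) d (-d) h1
  have h3 := mul_apply_add_of_unique (w i) (u i) (-d) d fun b a hb ha hab =>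
    (h1 a b ha hb (by rw [add_comm, hab, add_comm])).symm
  rw [add_neg_cancel] at h2
  rw [neg_add_cancel] at h3
  have h4 : ordExp d (-d) = -ordExp d d ∧ ordExp (-d) d = -ordExp d d := by
    constructor <;> simp only [ordExp, Pi.neg_apply] <;> ring
  rw [sub_apply, sub_apply, smul_apply, h2, h3, if_pos rfl, mono_apply, if_pos rfl,
    UqslMA.cartan_self, h4.1, h4.2, zpow_neg] at h0
  have h5 : q ^ ordExp d d ≠ 0 := zpow_ne_zero _ hq
  rw [zpow_ofNat] at h0
  have h6 : q ^ ordExp d d * (q - q⁻¹)⁻¹ =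
      q ^ ordExp d d * ((q ^ ordExp d d)⁻¹ * (u i d * w i (-d)) -
    q ^ 2 * ((q ^ ordExp d d)⁻¹ * (w i (-d) * u i d))) := by
    rw [sub_eq_zero.1 h0]
  rw [h6]
  field_simp

theorem nu_mul_nw {a : Fin 8} (ha : a ∈ [(0 : Fin 8), 1, 4, 5, 6, 7]) :
    nu q a * nw q a * (1 - q ^ 2) = q ^ ordExp (tyD a) (tyD a) * (q - q⁻¹)⁻¹ := by
  have hq : q ≠ 0 := NeZero.ne q
  have hr := sq_sub_one_ne_zero_of_generic (q := q)
  simp only [List.mem_cons, List.not_mem_nil, or_false] at ha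
  rcases ha with rfl | rfl | rfl | rfl | rfl | rfl <;>
  · simp [nu, nw, ordExp, tyD]
    field_simp
    try ring

theorem nu_ne_zero (a : Fin 8) : nu q a ≠ 0 := by
  have hq : q ≠ 0 := NeZero.ne q
  refine mul_ne_zero ?_ (inv_ne_zero sub_inv_ne_zero_of_generic)
  fin_cases a <;> simp [hq]

theorem nw_ne_zero (a : Fin 8) : nw q a ≠ 0 := by
  have hq : q ≠ 0 := NeZero.ne q
  refine mul_ne_zero ?_ (inv_ne_zero sub_inv_ne_zero_of_generic)
  fin_cases a <;> simp [hq]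

/-- If the raising coefficient is normalized, so is the lowering coefficient. -/
theorem w_eq_nw (D : DiagData π lam u w) {a : Fin 8} (ha : a ∈ [(0 : Fin 8), 1, 4, 5, 6, 7])
    (hi : lam i = qw q (tyL a)) (h : ∀ d, u i d ≠ 0 → w i (-d) ≠ 0 → d = tyD a)
    (hu : u i (tyD a) = nu q a) : w i (-tyD a) = nw q a := by
  obtain ⟨s, hs⟩ : ∃ s, tyL a s ≠ 0 :=
    (by decide : ∀ a : Fin 8, ∃ s, tyL a s ≠ 0) a
  have h1 := D.coeff_mul_coeff hi hs h
  rw [← nu_mul_nw ha, hu] at h1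
  have h2 : (1 - q ^ 2) ≠ 0 := by
    rw [← neg_sub]; exact neg_ne_zero.2 sq_sub_one_ne_zero_of_generic
  exact mul_left_cancel₀ (nu_ne_zero a) (mul_right_cancel₀ h2 h1)

theorem exists_wt {a b : Fin 8} (h : (a, b) ∈ [((0 : Fin 8), (5 : Fin 8)), (0, 6), (5, 7), (6, 7),
    (6, 4), (7, 1)]) (x y : ℂˣ) : ∃ θ : Fin 3 → ℂˣ, wt θ (tyD a) = x ∧ wt θ (tyD b) = y := by
  simp only [List.mem_cons, Prod.mk.injEq, List.not_mem_nil, or_false] at h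
  rcases h with ⟨rfl, rfl⟩ | ⟨rfl, rfl⟩ | ⟨rfl, rfl⟩ | ⟨rfl, rfl⟩ | ⟨rfl, rfl⟩ | ⟨rfl, rfl⟩
  · exact ⟨![x⁻¹, 1, y], by simp [wt, tyD, Fin.prod_univ_three]⟩
  · exact ⟨![x⁻¹, x⁻¹ * y⁻¹, 1], by simp [wt, tyD, Fin.prod_univ_three]⟩
  · exact ⟨![1, y * x, x], by simp [wt, tyD, Fin.prod_univ_three]⟩
  · exact ⟨![x, 1, y⁻¹], by simp [wt, tyD, Fin.prod_univ_three]⟩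
  · exact ⟨![x * y, y, 1], by simp [wt, tyD, Fin.prod_univ_three]⟩
  · exact ⟨![1, y⁻¹, y⁻¹ * x⁻¹], by simp [wt, tyD, Fin.prod_univ_three]⟩

/-- Normalization of the coefficients in the case where all `u i` and `w i` are monomials. -/
theorem exists_normalized (D : DiagData π lam u w) {a b : Fin 8}
    (h : (a, b) ∈ [((0 : Fin 8), (5 : Fin 8)), (0, 6), (5, 7), (6, 7), (6, 4), (7, 1)])
    (hi : lam i = qw q (tyL a)) (hj : lam j = qw q (tyL b))
    (hu : u i (tyD a) ≠ 0) (hu' : u j (tyD b) ≠ 0)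
    (h1 : u i = mono (tyD a) (u i (tyD a)) ∧ w i = mono (-tyD a) (w i (-tyD a)))
    (h2 : u j = mono (tyD b) (u j (tyD b)) ∧ w j = mono (-tyD b) (w j (-tyD b))) :
    ∃ π' u' w', π.Iso π' ∧ DiagData π' lam u' w' ∧
      (u' i = mono (tyD a) (nu q a) ∧ w' i = mono (-tyD a) (nw q a)) ∧
      (u' j = mono (tyD b) (nu q b) ∧ w' j = mono (-tyD b) (nw q b)) := by
  obtain ⟨θ, hx, hy⟩ := exists_wt h (Units.mk0 _ (nu_ne_zero (q := q) a) / Units.mk0 _ hu)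
    (Units.mk0 _ (nu_ne_zero (q := q) b) / Units.mk0 _ hu')
  have ha : a ∈ [(0 : Fin 8), 1, 4, 5, 6, 7] ∧ b ∈ [(0 : Fin 8), 1, 4, 5, 6, 7] := by
    simp only [List.mem_cons, Prod.mk.injEq, List.not_mem_nil, or_false] at h
    rcases h with ⟨rfl, rfl⟩ | ⟨rfl, rfl⟩ | ⟨rfl, rfl⟩ | ⟨rfl, rfl⟩ | ⟨rfl, rfl⟩ | ⟨rfl, rfl⟩ <;>
      simp
  have D' := D.transport θ
  have key : ∀ {i a}, a ∈ [(0 : Fin 8), 1, 4, 5, 6, 7] → lam i = qw q (tyL a) →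
      ∀ hu : u i (tyD a) ≠ 0,
      u i = mono (tyD a) (u i (tyD a)) ∧ w i = mono (-tyD a) (w i (-tyD a)) →
      wt θ (tyD a) = Units.mk0 _ (nu_ne_zero (q := q) a) / Units.mk0 _ hu →
      tw θ (u i) = mono (tyD a) (nu q a) ∧ tw θ (w i) = mono (-tyD a) (nw q a) := by
    intro i a ha hi hu h hx
    have e1 : tw θ (u i) = mono (tyD a) (nu q a) := by
      rw [h.1, tw_mono, hx, Units.val_div_eq_div_val, Units.val_mk0, Units.val_mk0,
        div_mul_cancel₀ _ hu]
    have e2 : tw θ (w i) (-tyD a) = nw q a := D'.w_eq_nw ha hi (fun d hd _ => by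
      rw [e1, mono_apply] at hd
      by_contra hne
      exact hd (if_neg (Ne.symm hne))) (by rw [e1, mono_apply, if_pos rfl])
    refine ⟨e1, ?_⟩
    rw [← e2]
    conv_lhs => rw [h.2, tw_mono]
    rw [tw_apply]
  exact ⟨_, _, _, π.iso_transport _, D', key ha.1 hi hu h1 hx, key ha.2 hj hu' h2 hy⟩

end DiagData

end

section
variable {q : ℂ} [GenericParam q]

theorem QTorus.eq_mono_add_of_supp {f : QTorus q} {d d' : Fin 3 → ℤ} (hd : d ≠ d')
    (h : ∀ a, f a ≠ 0 → a = d ∨ a = d') : f = mono d (f d) + mono d' (f d') := by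
  refine QTorus.ext fun a => ?_
  rw [add_apply, mono_apply, mono_apply]
  by_cases h1 : d = a
  · rw [if_pos h1, if_neg (h1 ▸ hd.symm), h1, add_zero]
  by_cases h2 : d' = a
  · rw [if_neg h1, if_pos h2, h2, zero_add]
  · rw [if_neg h1, if_neg h2, add_zero]
    by_contra h'
    exact (h a h').elim (fun e => h1 e.symm) fun e => h2 e.symm

namespace DiagData

variable {π : UqslMA q 2 (QSpace q 3)} {lam : Fin 2 → Fin 3 → ℂˣ} {u w : Fin 2 → QTorus q}
  {i j : Fin 2} {l m : Fin 3 → ℤ}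

theorem k_eq_smul (D : DiagData π lam u w) (hi : lam i = qw q l) (s : Fin 3) {c : ℂ}
    (h : q ^ l s = c) : π.k i (Xg q 3 s) = c • Xg q 3 s := by
  rw [D.k_eq hi, h]

theorem k_eq_self (D : DiagData π lam u w) (hi : lam i = qw q l) (s : Fin 3) (h : l s = 0) :
    π.k i (Xg q 3 s) = Xg q 3 s := by
  rw [D.k_eq hi, h, zpow_zero]; exact one_smul ℂ (Xg q 3 s)

/-- The supports of the implementing elements, for the types where they are determined by the
weights of the pair. -/
theorem supp_of_type (D : DiagData π lam u w) (hij : i ≠ j) {a b : Fin 8}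
    (hi : lam i = qw q (tyL a)) (hj : lam j = qw q (tyL b)) :
    (a = 0 ∧ b = 6 → (∀ d, u i d ≠ 0 → d = ![-1, 0, 0]) ∧
      ∀ d, w i d ≠ 0 → d = ![1, 0, 0] ∨ d = ![0, -1, 3]) ∧
    (a = 5 ∧ b = 7 → (∀ d, u i d ≠ 0 → d = ![0, 0, 1] ∨ d = ![3, -1, 0]) ∧
      ∀ d, w i d ≠ 0 → d = ![0, 0, -1]) ∧
    (a = 0 ∧ b = 4 → (∀ d, u i d ≠ 0 → d = ![-1, 0, 0]) ∧
      ∀ d, w i d ≠ 0 → d = ![1, 0, 0] ∨ d = ![0, 1, 1]) ∧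
    (a = 4 ∧ b = 0 → (∀ d, u i d ≠ 0 → d = ![0, 1, 0] ∨ d = ![1, 0, -1]) ∧
      ∀ d, w i d ≠ 0 → d = ![0, -1, 0]) ∧
    (a = 5 ∧ b = 1 → (∀ d, u i d ≠ 0 → d = ![0, 0, 1] ∨ d = ![1, 1, 0]) ∧
      ∀ d, w i d ≠ 0 → d = ![0, 0, -1]) ∧
    (a = 1 ∧ b = 5 → (∀ d, u i d ≠ 0 → d = ![0, -1, 0]) ∧
      ∀ d, w i d ≠ 0 → d = ![0, 1, 0] ∨ d = ![-1, 0, 1]) := by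
  have hU := fun d (hd : u i d ≠ 0) => D.u_int hij hi hj hd
  have hW := fun d (hd : w i d ≠ 0) => D.w_int hij hi hj hd
  simp only [Fin.forall_fin_succ, Fin.forall_fin_zero, Fin.succ_zero_eq_one, Fin.succ_one_eq_two,
    pr_om_zero, pr_om_one, pr_om_two, ε] at hU hW
  have hext : ∀ x y : Fin 3 → ℤ, x = y ↔ x 0 = y 0 ∧ x 1 = y 1 ∧ x 2 = y 2 := fun x y => by
    rw [funext_iff]
    simp [Fin.forall_fin_succ]
  refine ⟨?_, ?_, ?_, ?_, ?_, ?_⟩ <;> rintro ⟨rfl, rfl⟩ <;> simp [pr, tyL] at hU hW <;>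
    refine ⟨fun d hd => ?_, fun d hd => ?_⟩ <;> simp [hext] <;>
    first
    | (have := hU d hd; omega)
    | (have := hW d hd; omega)

theorem eq_mono_of_serre_w (D : DiagData π lam u w) (hij : i ≠ j)
    (hi : lam i = qw q (tyL 0)) (hj : lam j = qw q (tyL 6)) (hu : u i (tyD 0) ≠ 0)
    (hw : w i (-tyD 0) ≠ 0) (hw' : w j (-tyD 6) ≠ 0) (h2 : w j = mono (-tyD 6) (w j (-tyD 6))) :
    u i = mono (tyD 0) (u i (tyD 0)) ∧ w i = mono (-tyD 0) (w i (-tyD 0)) := by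
  obtain ⟨hU, hW⟩ := (D.supp_of_type hij hi hj).1 ⟨rfl, rfl⟩
  have h3 := QTorus.eq_mono_add_of_supp (by decide) hW
  have h4 : w i ![0, -1, 3] = 0 := by
    have h5 := D.serre_w hij 2
    rw [hi, hj] at h5
    refine QTorus.coeff_eq_zero_of_serre (congrArg (fun x => QTorus.inner x (qw q (tyL 0))) h3)
      (congrArg (fun x => QTorus.inner x (qw q (tyL 6))) h2) h5
      (by decide) (by decide) (by decide) (by decide) (by decide) (by decide) (by decide) ?_ hw'
    convert hw using 1
    congr 1
    decide
  refine D.eq_mono_of_unique hi hu hw (fun a ha => (hU a ha).trans (by decide)) fun b hb => ?_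
  rcases hW b hb with rfl | rfl
  · decide
  · exact absurd h4 hb

theorem eq_mono_of_serre_u (D : DiagData π lam u w) (hij : i ≠ j)
    (hi : lam i = qw q (tyL 5)) (hj : lam j = qw q (tyL 7)) (hu : u i (tyD 5) ≠ 0)
    (hw : w i (-tyD 5) ≠ 0) (hu' : u j (tyD 7) ≠ 0) (h2 : u j = mono (tyD 7) (u j (tyD 7))) :
    u i = mono (tyD 5) (u i (tyD 5)) ∧ w i = mono (-tyD 5) (w i (-tyD 5)) := by
  obtain ⟨hU, hW⟩ := (D.supp_of_type hij hi hj).2.1 ⟨rfl, rfl⟩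
  have h3 := QTorus.eq_mono_add_of_supp (by decide) hU
  have h4 : u i ![3, -1, 0] = 0 := by
    have h5 := D.serre_u hij 0
    rw [hi, hj] at h5
    exact QTorus.coeff_eq_zero_of_serre (congrArg (fun x => QTorus.inner x (qw q (tyL 5))) h3)
      (congrArg (fun x => QTorus.inner x (qw q (tyL 7))) h2) h5
      (by decide) (by decide) (by decide) (by decide) (by decide) (by decide) (by decide) hu hu'
  refine D.eq_mono_of_unique hi hu hw (fun a ha => ?_) fun b hb => (hW b hb).trans (by decide)
  rcases hU a ha with rfl | rfl
  · decide
  · exact absurd h4 ha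

theorem eq_mono_of_pair (D : DiagData π lam u w) (hij : i ≠ j) {a b : Fin 8}
    (h : (a, b) ∈ [((0 : Fin 8), (5 : Fin 8)), (0, 6), (5, 7), (6, 7), (6, 4), (7, 1)])
    (hi : lam i = qw q (tyL a) ∧ u i (tyD a) ≠ 0 ∧ w i (-tyD a) ≠ 0)
    (hj : lam j = qw q (tyL b) ∧ u j (tyD b) ≠ 0 ∧ w j (-tyD b) ≠ 0) :
    (u i = mono (tyD a) (u i (tyD a)) ∧ w i = mono (-tyD a) (w i (-tyD a))) ∧
      u j = mono (tyD b) (u j (tyD b)) ∧ w j = mono (-tyD b) (w j (-tyD b)) := by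
  obtain ⟨hi, hui, hwi⟩ := hi
  obtain ⟨hj, huj, hwj⟩ := hj
  have h2 : u j = mono (tyD b) (u j (tyD b)) ∧ w j = mono (-tyD b) (w j (-tyD b)) := by
    exact D.eq_mono_of_type hij.symm hj hi huj hwj ((by decide : ∀ a b : Fin 8,
      (a, b) ∈ [((0 : Fin 8), (5 : Fin 8)), (0, 6), (5, 7), (6, 7), (6, 4), (7, 1)] →
      (b, a) ∈ [((0 : Fin 8), (5 : Fin 8)), (5, 0), (6, 0), (7, 5), (6, 7), (7, 6), (6, 4), (4, 6),
        (7, 1), (1, 7)]) a b h)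
  refine ⟨?_, h2⟩
  simp only [List.mem_cons, Prod.mk.injEq, List.not_mem_nil, or_false] at h
  rcases h with ⟨rfl, rfl⟩ | ⟨rfl, rfl⟩ | ⟨rfl, rfl⟩ | ⟨rfl, rfl⟩ | ⟨rfl, rfl⟩ | ⟨rfl, rfl⟩
  · exact D.eq_mono_of_type hij hi hj hui hwi (by simp)
  · exact D.eq_mono_of_serre_w hij hi hj hui hwi hwj h2.2
  · exact D.eq_mono_of_serre_u hij hi hj hui hwi huj h2.1
  · exact D.eq_mono_of_type hij hi hj hui hwi (by simp)
  · exact D.eq_mono_of_type hij hi hj hui hwi (by simp)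
  · exact D.eq_mono_of_type hij hi hj hui hwi (by simp)

/-- The monomial kinds of structures, `(2)` to `(7)`. -/
theorem exists_tKind_of_monomial (D : DiagData π lam u w) (hij : i ≠ j) {a b : Fin 8}
    (h : (a, b) ∈ [((0 : Fin 8), (5 : Fin 8)), (0, 6), (5, 7), (6, 7), (6, 4), (7, 1)])
    (hi : lam i = qw q (tyL a) ∧ u i (tyD a) ≠ 0 ∧ w i (-tyD a) ≠ 0)
    (hj : lam j = qw q (tyL b) ∧ u j (tyD b) ≠ 0 ∧ w j (-tyD b) ≠ 0) :
    ∃ π', π.Iso π' ∧ ∃ n, TKind q n π' := by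
  have key := D.eq_mono_of_pair hij h hi hj
  obtain ⟨hi, hui, -⟩ := hi
  obtain ⟨hj, huj, -⟩ := hj
  obtain ⟨π', u', w', hπ, D', ⟨hu, hw⟩, hu', hw'⟩ := D.exists_normalized h hi hj hui huj key.1 key.2
  refine ⟨π', hπ, ?_⟩
  simp only [List.mem_cons, Prod.mk.injEq, List.not_mem_nil, or_false] at h
  have hk := fun s => D'.k_eq hi s
  have hk' := fun s => D'.k_eq hj s
  rcases h with ⟨rfl, rfl⟩ | ⟨rfl, rfl⟩ | ⟨rfl, rfl⟩ | ⟨rfl, rfl⟩ | ⟨rfl, rfl⟩ | ⟨rfl, rfl⟩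
  · obtain ⟨e1, e2, e3⟩ := D'.e_ty0 hi hu
    obtain ⟨f1, f2, f3⟩ := D'.f_ty0 hi hw
    obtain ⟨e1', e2', e3'⟩ := D'.e_ty5 hj hu'
    obtain ⟨f1', f2', f3'⟩ := D'.f_ty5 hj hw'
    exact ⟨1, i, j, hij, hk 0, D'.k_eq_smul hi 1 (zpow_neg_one q),
      D'.k_eq_smul hi 2 (zpow_neg_one q),
      D'.k_eq_smul hj 0 (zpow_one q), D'.k_eq_smul hj 1 (zpow_one q),
      D'.k_eq_smul hj 2 (zpow_ofNat q 2),
      e1, e2, e3, e1', e2', e3', f1, f2, f3, f1', f2', f3'⟩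
  · obtain ⟨e1, e2, e3⟩ := D'.e_ty0 hi hu
    obtain ⟨f1, f2, f3⟩ := D'.f_ty0 hi hw
    obtain ⟨e1', e2', e3'⟩ := D'.e_ty6 hj hu'
    obtain ⟨f1', f2', f3'⟩ := D'.f_ty6 hj hw'
    exact ⟨2, i, j, hij, hk 0, D'.k_eq_smul hi 1 (zpow_neg_one q),
      D'.k_eq_smul hi 2 (zpow_neg_one q),
      D'.k_eq_smul hj 0 (zpow_one q), D'.k_eq_smul hj 1 (zpow_neg_one q), D'.k_eq_self hj 2 rfl,
      e1, e2, e3, e1', e2', e3', f1, f2, f3, f1', f2', f3'⟩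
  · obtain ⟨e1, e2, e3⟩ := D'.e_ty5 hi hu
    obtain ⟨f1, f2, f3⟩ := D'.f_ty5 hi hw
    obtain ⟨e1', e2', e3'⟩ := D'.e_ty7 hj hu'
    obtain ⟨f1', f2', f3'⟩ := D'.f_ty7 hj hw'
    exact ⟨3, i, j, hij, D'.k_eq_smul hi 0 (zpow_one q), D'.k_eq_smul hi 1 (zpow_one q),
      D'.k_eq_smul hi 2 (zpow_ofNat q 2),
      D'.k_eq_self hj 0 rfl, D'.k_eq_smul hj 1 (zpow_one q), D'.k_eq_smul hj 2 (zpow_neg_one q),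
      e1, e2, e3, e1', e2', e3', f1, f2, f3, f1', f2', f3'⟩
  · obtain ⟨e1, e2, e3⟩ := D'.e_ty6 hi hu
    obtain ⟨f1, f2, f3⟩ := D'.f_ty6 hi hw
    obtain ⟨e1', e2', e3'⟩ := D'.e_ty7 hj hu'
    obtain ⟨f1', f2', f3'⟩ := D'.f_ty7 hj hw'
    exact ⟨4, i, j, hij, D'.k_eq_smul hi 0 (zpow_one q), D'.k_eq_smul hi 1 (zpow_neg_one q),
      D'.k_eq_self hi 2 rfl,
      D'.k_eq_self hj 0 rfl, D'.k_eq_smul hj 1 (zpow_one q), D'.k_eq_smul hj 2 (zpow_neg_one q),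
      e1, e2, e3, e1', e2', e3', f1, f2, f3, f1', f2', f3'⟩
  · obtain ⟨e1, e2, e3⟩ := D'.e_ty6 hi hu
    obtain ⟨f1, f2, f3⟩ := D'.f_ty6 hi hw
    obtain ⟨e1', e2', e3'⟩ := D'.e_ty4 hj hu'
    obtain ⟨f1', f2', f3'⟩ := D'.f_ty4 hj hw'
    exact ⟨5, i, j, hij, D'.k_eq_smul hi 0 (zpow_one q), D'.k_eq_smul hi 1 (zpow_neg_one q),
      D'.k_eq_self hi 2 rfl,
      D'.k_eq_smul hj 0 (zpow_one q), D'.k_eq_smul hj 1 (zpow_ofNat q 2),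
      D'.k_eq_smul hj 2 (zpow_neg_one q),
      e1, e2, e3, e1', e2', e3', f1, f2, f3, f1', f2', f3'⟩
  · obtain ⟨e1, e2, e3⟩ := D'.e_ty7 hi hu
    obtain ⟨f1, f2, f3⟩ := D'.f_ty7 hi hw
    obtain ⟨e1', e2', e3'⟩ := D'.e_ty1 hj hu'
    obtain ⟨f1', f2', f3'⟩ := D'.f_ty1 hj hw'
    exact ⟨6, i, j, hij, D'.k_eq_self hi 0 rfl, D'.k_eq_smul hi 1 (zpow_one q),
      D'.k_eq_smul hi 2 (zpow_neg_one q),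
      D'.k_eq_smul hj 0 (zpow_one q), hk' 1, D'.k_eq_smul hj 2 (zpow_neg_one q),
      e1, e2, e3, e1', e2', e3', f1, f2, f3, f1', f2', f3'⟩

end DiagData

end

section
variable {q : ℂ} [GenericParam q]

theorem QTorus.inner_eq_toT {l d d' : Fin 3 → ℤ} {c c' : ℂ} {s : Fin 3} {a : QSpace q 3}
    (ha : toT a = mono d' c') (hd : d + ε s = d')
    (hc : c * (q ^ (ordExp d (ε s) + pr l (ε s)) - q ^ ordExp (ε s) d) = c') :
    QTorus.inner (mono d c) (qw q l) (mono (ε s) 1 : QTorus q) = toT a := by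
  rw [QTorus.inner_mono, mul_one, hd, hc, ha]

theorem QTorus.inner_eq_tw_toT {l d d' : Fin 3 → ℤ} {c c' : ℂ} {s : Fin 3} {a : QSpace q 3}
    (ha : toT a = mono d' c') (hd : d + ε s = d')
    (hc : c * (q ^ (ordExp d (ε s) + pr l (ε s)) - q ^ ordExp (ε s) d) = q ^ pr l d' * c') :
    QTorus.inner (mono d c) (qw q l) (mono (ε s) 1 : QTorus q) = tw (qw q l) (toT a) := by
  rw [QTorus.inner_mono, mul_one, hd, hc, ha, tw_mono, wt_qw]

theorem QTorus.inner_eq_toT_zero {l d : Fin 3 → ℤ} (c : ℂ) {s : Fin 3} (h : gap l d (ε s) = 0) :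
    QTorus.inner (mono d c) (qw q l) (mono (ε s) 1 : QTorus q) = toT (0 : QSpace q 3) :=
  (QTorus.inner_mono_eq_zero h c 1).trans (map_zero _).symm

theorem QTorus.inner_eq_tw_toT_zero {l d : Fin 3 → ℤ} (c : ℂ) {s : Fin 3}
    (h : gap l d (ε s) = 0) : QTorus.inner (mono d c) (qw q l) (mono (ε s) 1 : QTorus q) =
      tw (qw q l) (toT (0 : QSpace q 3)) := by
  rw [map_zero, map_zero, QTorus.inner_mono_eq_zero h]

theorem toT_neg_smul_mul_sq (c : ℂ) (s t : Fin 3) : toT (-(c • (Xg q 3 s * Xg q 3 t ^ 2))) =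
    mono (ε s + (ε t + ε t)) (-(c * (q ^ ordExp (ε s) (ε t + ε t) * q ^ ordExp (ε t) (ε t)))) := by
  rw [map_neg, map_smul, map_mul, map_pow, toT_Xg, toT_Xg, pow_two, mono_mul_mono, mono_mul_mono,
    smul_mono, ← neg_one_smul ℂ, smul_mono]
  congr 1
  ring

theorem toT_neg_smul_sq_mul (c : ℂ) (s t : Fin 3) : toT (-(c • (Xg q 3 s ^ 2 * Xg q 3 t))) =
    mono (ε s + ε s + ε t) (-(c * (q ^ ordExp (ε s + ε s) (ε t) * q ^ ordExp (ε s) (ε s)))) := by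
  rw [map_neg, map_smul, map_mul, map_pow, toT_Xg, toT_Xg, pow_two, mono_mul_mono, mono_mul_mono,
    smul_mono, ← neg_one_smul ℂ, smul_mono]
  congr 1
  ring

namespace DiagData

variable {π : UqslMA q 2 (QSpace q 3)} {lam : Fin 2 → Fin 3 → ℂˣ} {u w : Fin 2 → QTorus q}
  {i j : Fin 2} {l m : Fin 3 → ℤ}

theorem mul_apply_zero_of_commutator (D : DiagData π lam u w) (hij : i ≠ j)
    (hi : lam i = qw q l) (hj : lam j = qw q m) {d : Fin 3 → ℤ} {s : Fin 3}
    (h : l s + m s ≠ pr (om s) d) :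
    ((u i * w j : QTorus q)) d = q⁻¹ * ((w j * u i : QTorus q)) d := by
  by_contra hne
  refine h (zpow_inj_of_generic (q := q) ?_)
  rw [zpow_add₀ (NeZero.ne q), ← qw_apply, ← qw_apply, ← hi, ← hj]
  refine D.commutator i j ?_ s
  rw [if_neg hij, sub_zero, sub_apply, smul_apply, cartan_of_ne hij.symm, zpow_neg_one]
  exact sub_ne_zero.2 hne

theorem e_eq_add (D : DiagData π lam u w) (hi : lam i = qw q l) {v v' : QTorus q}
    (hu : u i = v + v') {s : Fin 3} {a a' : QSpace q 3}
    (h : QTorus.inner v (qw q l) (mono (ε s) 1) = toT a)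
    (h' : QTorus.inner v' (qw q l) (mono (ε s) 1) = toT a') : π.e i (Xg q 3 s) = a + a' := by
  refine D.e_eq_of ?_
  rw [← QTorus.inner_apply, hi, hu, QTorus.inner_add, map_add]
  exact congrArg₂ (· + ·) h h'

theorem f_eq_add (D : DiagData π lam u w) (hi : lam i = qw q l) {v v' : QTorus q}
    (hw : w i = v + v') {s : Fin 3} {a a' : QSpace q 3}
    (h : QTorus.inner v (qw q l) (mono (ε s) 1) = tw (qw q l) (toT a))
    (h' : QTorus.inner v' (qw q l) (mono (ε s) 1) = tw (qw q l) (toT a')) :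
    π.f i (Xg q 3 s) = a + a' := by
  refine D.f_eq_of ?_
  rw [← QTorus.inner_apply, hi, hw, QTorus.inner_add, map_add, map_add]
  exact congrArg₂ (· + ·) h h'

theorem coeff_relation (D : DiagData π lam u w) (hij : i ≠ j)
    (hi : lam i = qw q l) (hj : lam j = qw q m) {a a' b b' : Fin 3 → ℤ} {s : Fin 3}
    (hu : u i = mono a (u i a) + mono a' (u i a')) (hw : w j = mono b (w j b) + mono b' (w j b'))
    (h : l s + m s ≠ pr (om s) (a + b)) (h1 : a + b = a' + b') (h2 : a + b' ≠ a + b)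
    (h3 : a' + b ≠ a + b) :
    u i a * w j b * (q ^ ordExp a b - q⁻¹ * q ^ ordExp b a) +
      u i a' * w j b' * (q ^ ordExp a' b' - q⁻¹ * q ^ ordExp b' a') = 0 := by
  have h4 := D.mul_apply_zero_of_commutator hij hi hj h
  rw [hu, hw] at h4
  simp only [add_mul, mul_add, mono_mul_mono, add_apply, mono_apply, add_comm b, add_comm b',
    if_neg h2, if_neg h3, ← h1, if_true] at h4
  linear_combination h4

theorem coeff_eight (D : DiagData π lam u w) (hij : i ≠ j)
    (hi : lam i = qw q (tyL 0)) (hj : lam j = qw q (tyL 4)) :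
    u j ![0, 1, 0] * w i ![1, 0, 0] = u j ![1, 0, -1] * w i ![0, 1, 1] := by
  have hq : q ≠ 0 := NeZero.ne q
  have hr := sq_sub_one_ne_zero_of_generic (q := q)
  have h := D.coeff_relation hij.symm hj hi (s := 2)
    (QTorus.eq_mono_add_of_supp (by decide) ((D.supp_of_type hij.symm hj hi).2.2.2.1 ⟨rfl, rfl⟩).1)
    (QTorus.eq_mono_add_of_supp (by decide) ((D.supp_of_type hij hi hj).2.2.1 ⟨rfl, rfl⟩).2)
    (by decide) (by decide) (by decide) (by decide)
  simp [ordExp] at h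
  have h' : q⁻¹ * q ^ 2 = q := by field_simp
  rw [h'] at h
  exact mul_right_cancel₀ (sub_inv_ne_zero_of_generic (q := q)) (by linear_combination h)

theorem coeff_nine (D : DiagData π lam u w) (hij : i ≠ j)
    (hi : lam i = qw q (tyL 5)) (hj : lam j = qw q (tyL 1)) :
    u i ![0, 0, 1] * w j ![0, 1, 0] = u i ![1, 1, 0] * w j ![-1, 0, 1] := by
  have hq : q ≠ 0 := NeZero.ne q
  have hr := sq_sub_one_ne_zero_of_generic (q := q)
  have h := D.coeff_relation hij hi hj (s := 0)
    (QTorus.eq_mono_add_of_supp (by decide) ((D.supp_of_type hij hi hj).2.2.2.2.1 ⟨rfl, rfl⟩).1)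
    (QTorus.eq_mono_add_of_supp (by decide)
    ((D.supp_of_type hij.symm hj hi).2.2.2.2.2 ⟨rfl, rfl⟩).2)
    (by decide) (by decide) (by decide) (by decide)
  simp [ordExp] at h
  have h' : q⁻¹ * q ^ 2 = q := by field_simp
  rw [h'] at h
  exact mul_right_cancel₀ (sub_inv_ne_zero_of_generic (q := q)) (by linear_combination h)

theorem tKind_eight (D : DiagData π lam u w) (hij : i ≠ j)
    (hi : lam i = qw q (tyL 0)) (hj : lam j = qw q (tyL 4)) (hw : w j ![0, -1, 0] = nw q 4)
    (hu : u i ![-1, 0, 0] = nu q 0) (hp : u j ![0, 1, 0] = nu q 4) (hb : w i ![1, 0, 0] = nw q 0)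
    (hp' : u j ![1, 0, -1] = -(q - q⁻¹)⁻¹) : TKind q 7 π := by
  have hq : q ≠ 0 := NeZero.ne q
  have hr := sq_sub_one_ne_zero_of_generic (q := q)
  have hb' : w i ![0, 1, 1] = nw q 0 := by
    have h := D.coeff_eight hij hi hj
    rw [hp, hb, hp', nu] at h
    simp only [Matrix.cons_val] at h
    rw [neg_one_mul] at h
    exact (mul_left_cancel₀ (neg_ne_zero.2 (inv_ne_zero sub_inv_ne_zero_of_generic)) h).symm
  obtain ⟨hU, hW⟩ := (D.supp_of_type hij hi hj).2.2.1 ⟨rfl, rfl⟩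
  obtain ⟨hU', hW'⟩ := (D.supp_of_type hij.symm hj hi).2.2.2.1 ⟨rfl, rfl⟩
  have h1 : u i = mono (tyD 0) (nu q 0) := (QTorus.eq_mono_of_supp hU).trans (by rw [hu]; rfl)
  have h2 : w j = mono (-tyD 4) (nw q 4) := (QTorus.eq_mono_of_supp hW').trans (by
    rw [hw]; congr 1; decide)
  have h3 := QTorus.eq_mono_add_of_supp (by decide) hW
  have h4 := QTorus.eq_mono_add_of_supp (by decide) hU'
  rw [hb, hb'] at h3
  rw [hp, hp'] at h4
  obtain ⟨e1, e2, e3⟩ := D.e_ty0 hi h1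
  obtain ⟨f1', f2', f3'⟩ := D.f_ty4 hj h2
  have e1' := (D.e_eq_add hj h4 (s := 0) (QTorus.inner_eq_toT (toT_smul_mul (-q) 0 1) (by decide)
    (by simp [nu, tyL, ordExp, pr]; field_simp))
    (QTorus.inner_eq_toT_zero _ (by decide))).trans (add_zero _)
  have e2' := (D.e_eq_add hj h4 (s := 1) (QTorus.inner_eq_toT (toT_smul_sq (-q) 1) (by decide)
    (by simp [nu, tyL, ordExp, pr]; field_simp))
    (QTorus.inner_eq_toT_zero _ (by decide))).trans (add_zero _)
  have e3' := (D.e_eq_add hj h4 (s := 2) (QTorus.inner_eq_toT (toT_mul 1 2) (by decide)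
    (by simp [nu, tyL, ordExp, pr]; field_simp; ring))
    (QTorus.inner_eq_toT (toT_Xg 0) (by decide)
    (by simp [tyL, ordExp, pr]; field_simp; ring))).trans (add_comm _ _)
  have f1 := (D.f_eq_add hi h3 (s := 0) (QTorus.inner_eq_tw_toT (toT_smul_sq (-q) 0) (by decide)
    (by simp [nw, tyL, ordExp, pr]; field_simp; ring))
    (QTorus.inner_eq_tw_toT_zero _ (by decide))).trans (add_zero _)
  have f2 := (D.f_eq_add hi h3 (s := 1) (QTorus.inner_eq_tw_toT (toT_smul_mul (-q) 0 1) (by decide)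
    (by simp [nw, tyL, ordExp, pr]; field_simp; ring))
    (QTorus.inner_eq_tw_toT_zero _ (by decide))).trans (add_zero _)
  have f3 := (D.f_eq_add hi h3 (s := 2) (QTorus.inner_eq_tw_toT (toT_smul_mul (-q) 0 2) (by decide)
    (by simp [nw, tyL, ordExp, pr]; field_simp; ring))
    (QTorus.inner_eq_tw_toT (toT_neg_smul_mul_sq q 1 2) (by decide)
    (by simp [nw, tyL, ordExp, pr]; field_simp; ring))).trans (sub_eq_add_neg _ _).symm
  exact ⟨i, j, hij, D.k_eq hi 0, D.k_eq_smul hi 1 (zpow_neg_one q),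
    D.k_eq_smul hi 2 (zpow_neg_one q), D.k_eq_smul hj 0 (zpow_one q),
    D.k_eq_smul hj 1 (zpow_ofNat q 2), D.k_eq_smul hj 2 (zpow_neg_one q),
    e1, e2, e3, e1', e2', e3', f1, f2, f3, f1', f2', f3'⟩

theorem tKind_nine (D : DiagData π lam u w) (hij : i ≠ j)
    (hi : lam i = qw q (tyL 5)) (hj : lam j = qw q (tyL 1)) (hw : w i ![0, 0, -1] = nw q 5)
    (hu : u j ![0, -1, 0] = nu q 1) (ha : u i ![0, 0, 1] = nu q 5) (hs : w j ![0, 1, 0] = nw q 1)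
    (hs' : w j ![-1, 0, 1] = nw q 1) : TKind q 8 π := by
  have hq : q ≠ 0 := NeZero.ne q
  have hr := sq_sub_one_ne_zero_of_generic (q := q)
  have ha' : u i ![1, 1, 0] = nu q 5 := by
    have h := D.coeff_nine hij hi hj
    rw [ha, hs, hs'] at h
    exact (mul_right_cancel₀ (nw_ne_zero _) h).symm
  obtain ⟨hU, hW⟩ := (D.supp_of_type hij hi hj).2.2.2.2.1 ⟨rfl, rfl⟩
  obtain ⟨hU', hW'⟩ := (D.supp_of_type hij.symm hj hi).2.2.2.2.2 ⟨rfl, rfl⟩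
  have h1 : u j = mono (tyD 1) (nu q 1) := (QTorus.eq_mono_of_supp hU').trans (by rw [hu]; rfl)
  have h2 : w i = mono (-tyD 5) (nw q 5) := (QTorus.eq_mono_of_supp hW).trans (by
    rw [hw]; congr 1; decide)
  have h3 := QTorus.eq_mono_add_of_supp (by decide) hU
  have h4 := QTorus.eq_mono_add_of_supp (by decide) hW'
  rw [ha, ha'] at h3
  rw [hs, hs'] at h4
  obtain ⟨e1', e2', e3'⟩ := D.e_ty1 hj h1
  obtain ⟨f1, f2, f3⟩ := D.f_ty5 hi h2
  have e1 := (D.e_eq_add hi h3 (s := 0) (QTorus.inner_eq_toT (toT_smul_mul (-q) 0 2) (by decide)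
    (by simp [nu, tyL, ordExp, pr]; field_simp))
    (QTorus.inner_eq_toT (toT_neg_smul_sq_mul q 0 1) (by decide)
    (by simp [nu, tyL, ordExp, pr]; field_simp))).trans (sub_eq_add_neg _ _).symm
  have e2 := (D.e_eq_add hi h3 (s := 1) (QTorus.inner_eq_toT (toT_smul_mul (-q) 1 2) (by decide)
    (by simp [nu, tyL, ordExp, pr]; field_simp))
    (QTorus.inner_eq_toT_zero _ (by decide))).trans (add_zero _)
  have e3 := (D.e_eq_add hi h3 (s := 2) (QTorus.inner_eq_toT (toT_smul_sq (-q) 2) (by decide)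
    (by simp [nu, tyL, ordExp, pr]; field_simp))
    (QTorus.inner_eq_toT_zero _ (by decide))).trans (add_zero _)
  have f1' := (D.f_eq_add hj h4 (s := 0) (QTorus.inner_eq_tw_toT (toT_mul 0 1) (by decide)
    (by simp [nw, tyL, ordExp, pr]; field_simp))
    (QTorus.inner_eq_tw_toT (toT_Xg 2) (by decide)
    (by simp [nw, tyL, ordExp, pr]; field_simp))).trans (add_comm _ _)
  have f2' := (D.f_eq_add hj h4 (s := 1) (QTorus.inner_eq_tw_toT (toT_smul_sq (-q) 1) (by decide)
    (by simp [nw, tyL, ordExp, pr]; field_simp; ring))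
    (QTorus.inner_eq_tw_toT_zero _ (by decide))).trans (add_zero _)
  have f3' := (D.f_eq_add hj h4 (s := 2) (QTorus.inner_eq_tw_toT (toT_smul_mul (-q) 1 2) (by decide)
    (by simp [nw, tyL, ordExp, pr]; field_simp; ring))
    (QTorus.inner_eq_tw_toT_zero _ (by decide))).trans (add_zero _)
  exact ⟨i, j, hij, D.k_eq_smul hi 0 (zpow_one q), D.k_eq_smul hi 1 (zpow_one q),
    D.k_eq_smul hi 2 (zpow_ofNat q 2), D.k_eq_smul hj 0 (zpow_one q),
    D.k_eq hj 1, D.k_eq_smul hj 2 (zpow_neg_one q),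
    e1, e2, e3, e1', e2', e3', f1, f2, f3, f1', f2', f3'⟩

theorem tw_apply_of_wt {θ : Fin 3 → ℂˣ} {f : QTorus q} {d : Fin 3 → ℤ} {c : ℂ} (hc : c ≠ 0)
    (hf : f d ≠ 0) (h : wt θ d = Units.mk0 c hc / Units.mk0 _ hf) : tw θ f d = c := by
  rw [tw_apply, h, Units.val_div_eq_div_val, Units.val_mk0, Units.val_mk0, div_mul_cancel₀ _ hf]

theorem exists_tKind_eight (D : DiagData π lam u w) (hij : i ≠ j)
    (hi : lam i = qw q (tyL 0)) (hj : lam j = qw q (tyL 4)) (hu : u i (tyD 0) ≠ 0)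
    (hw : w i (-tyD 0) ≠ 0) (hu' : u j (tyD 4) ≠ 0) : ∃ π', π.Iso π' ∧ TKind q 7 π' := by
  have hp : u j ![1, 0, -1] ≠ 0 := by
    intro h
    have h' := D.coeff_eight hij hi hj
    rw [h, zero_mul] at h'
    exact mul_ne_zero hu' hw ((congrArg _ (by congr 1; decide)).trans h')
  have hr : -(q - q⁻¹)⁻¹ ≠ 0 := neg_ne_zero.2 (inv_ne_zero sub_inv_ne_zero_of_generic)
  obtain ⟨θ, h1, h2, h3⟩ : ∃ θ : Fin 3 → ℂˣ,
      wt θ ![-1, 0, 0] = Units.mk0 _ (nu_ne_zero (q := q) 0) / Units.mk0 _ hu ∧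
      wt θ ![0, 1, 0] = Units.mk0 _ (nu_ne_zero (q := q) 4) / Units.mk0 _ hu' ∧
      wt θ ![1, 0, -1] = Units.mk0 _ hr / Units.mk0 _ hp := by
    generalize Units.mk0 _ (nu_ne_zero (q := q) 0) / Units.mk0 _ hu = x
    generalize Units.mk0 _ (nu_ne_zero (q := q) 4) / Units.mk0 _ hu' = y
    generalize Units.mk0 _ hr / Units.mk0 _ hp = z
    exact ⟨![x⁻¹, y, x⁻¹ * z⁻¹], by simp [wt, Fin.prod_univ_three]⟩
  have D' := D.transport θ
  have a1 : tw θ (u i) (tyD 0) = nu q 0 := tw_apply_of_wt _ hu h1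
  have a2 : tw θ (u j) (tyD 4) = nu q 4 := tw_apply_of_wt _ hu' h2
  have b1 := D'.w_eq_nw (a := 0) (by simp) hi (fun d hd _ =>
    ((D'.supp_of_type hij hi hj).2.2.1 ⟨rfl, rfl⟩).1 d hd) a1
  have b2 := D'.w_eq_nw (a := 4) (by simp) hj (fun d _ hd => neg_injective
    ((((D'.supp_of_type hij.symm hj hi).2.2.2.1 ⟨rfl, rfl⟩).2 _ hd).trans (by decide))) a2
  refine ⟨_, π.iso_transport _, D'.tKind_eight hij hi hj ?_ a1 a2 ?_ (tw_apply_of_wt _ hp h3)⟩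
  · rw [← b2]; congr 1; decide
  · rw [← b1]; congr 1; decide

theorem exists_tKind_nine (D : DiagData π lam u w) (hij : i ≠ j)
    (hi : lam i = qw q (tyL 5)) (hj : lam j = qw q (tyL 1)) (hu : u i (tyD 5) ≠ 0)
    (hu' : u j (tyD 1) ≠ 0) (hw' : w j (-tyD 1) ≠ 0) : ∃ π', π.Iso π' ∧ TKind q 8 π' := by
  have hs : w j ![-1, 0, 1] ≠ 0 := by
    intro h
    have h' := D.coeff_nine hij hi hj
    rw [h, mul_zero] at h'
    exact mul_ne_zero hu hw' ((congrArg _ (by congr 1; decide)).trans h')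
  obtain ⟨θ, h1, h2, h3⟩ : ∃ θ : Fin 3 → ℂˣ,
      wt θ ![0, 0, 1] = Units.mk0 _ (nu_ne_zero (q := q) 5) / Units.mk0 _ hu ∧
      wt θ ![0, -1, 0] = Units.mk0 _ (nu_ne_zero (q := q) 1) / Units.mk0 _ hu' ∧
      wt θ ![-1, 0, 1] = Units.mk0 _ (nw_ne_zero (q := q) 1) / Units.mk0 _ hs := by
    generalize Units.mk0 _ (nu_ne_zero (q := q) 5) / Units.mk0 _ hu = x
    generalize Units.mk0 _ (nu_ne_zero (q := q) 1) / Units.mk0 _ hu' = y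
    generalize Units.mk0 _ (nw_ne_zero (q := q) 1) / Units.mk0 _ hs = z
    exact ⟨![z⁻¹ * x, y⁻¹, x], by simp [wt, Fin.prod_univ_three]⟩
  have D' := D.transport θ
  have a1 : tw θ (u i) (tyD 5) = nu q 5 := tw_apply_of_wt _ hu h1
  have a2 : tw θ (u j) (tyD 1) = nu q 1 := tw_apply_of_wt _ hu' h2
  have b1 := D'.w_eq_nw (a := 5) (by simp) hi (fun d _ hd => neg_injective
    ((((D'.supp_of_type hij hi hj).2.2.2.2.1 ⟨rfl, rfl⟩).2 _ hd).trans (by decide))) a1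
  have b2 := D'.w_eq_nw (a := 1) (by simp) hj (fun d hd _ =>
    ((D'.supp_of_type hij.symm hj hi).2.2.2.2.2 ⟨rfl, rfl⟩).1 d hd) a2
  refine ⟨_, π.iso_transport _, D'.tKind_nine hij hi hj ?_ a2 a1 ?_ (tw_apply_of_wt _ hs h3)⟩
  · rw [← b1]; congr 1; decide
  · rw [← b2]; congr 1; decide

theorem exists_tKind (D : DiagData π lam u w) : ∃ π', π.Iso π' ∧ ∃ n, TKind q n π' := by
  obtain h | ⟨i, j, hij, a, b, h, hi, hj⟩ := D.exists_types
  · exact ⟨π, UqslMA.Iso.refl π, 0, h⟩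
  by_cases h' : (a, b) ∈ [((0 : Fin 8), (5 : Fin 8)), (0, 6), (5, 7), (6, 7), (6, 4), (7, 1)]
  · exact D.exists_tKind_of_monomial hij h' hi hj
  have h3 : (a = 0 ∧ b = 4) ∨ a = 5 ∧ b = 1 := (by decide : ∀ a b : Fin 8,
    (a, b) ∈ [((0 : Fin 8), (5 : Fin 8)), (0, 6), (5, 7), (6, 7), (6, 4), (7, 1), (0, 4), (5, 1)] →
    (a, b) ∉ [((0 : Fin 8), (5 : Fin 8)), (0, 6), (5, 7), (6, 7), (6, 4), (7, 1)] →
    (a = 0 ∧ b = 4) ∨ a = 5 ∧ b = 1) a b h h'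
  rcases h3 with ⟨rfl, rfl⟩ | ⟨rfl, rfl⟩
  · obtain ⟨π', h1, h2⟩ := D.exists_tKind_eight hij hi.1 hj.1 hi.2.1 hi.2.2 hj.2.1
    exact ⟨π', h1, _, h2⟩
  · obtain ⟨π', h1, h2⟩ := D.exists_tKind_nine hij hi.1 hj.1 hi.2.1 hj.2.1 hj.2.2
    exact ⟨π', h1, _, h2⟩

end DiagData

end

section
variable {q : ℂ} [GenericParam q]

/-- Isomorphic structures on the quantum 3-space have the same diagonal weights. -/
theorem UqslMA.Iso.weight_eq {π₁ π₂ : UqslMA q 2 (QSpace q 3)} (h : π₁.Iso π₂) {i : Fin 2}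
    {a b : Fin 3 → ℂ} (h₁ : ∀ s, π₁.k i (Xg q 3 s) = a s • Xg q 3 s)
    (h₂ : ∀ s, π₂.k i (Xg q 3 s) = b s • Xg q 3 s) : a = b := by
  obtain ⟨ψ, hk, -, -, -⟩ := h
  obtain ⟨α, β, γ, τ, hα, hβ, hγ, e0, e1, e2⟩ := aut_form ψ
  have key : ∀ s, a s • ψ (Xg q 3 s) = π₂.k i (ψ (Xg q 3 s)) := fun s => by
    rw [← hk, AlgEquiv.symm_apply_apply, h₁, map_smul]
  have h3 : ∀ s, toT (a s • ψ (Xg q 3 s)) (ε s) = toT (π₂.k i (ψ (Xg q 3 s))) (ε s) := fun s => by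
    rw [key]
  have d1 : ε 0 + ε 2 ≠ ε 1 := by decide
  have k0 := h3 0
  have k1 := h3 1
  have k2 := h3 2
  rw [e0, map_smul (π₂.k i), h₂] at k0
  rw [e1, map_add (π₂.k i), map_smul (π₂.k i), map_smul (π₂.k i), map_mul (π₂.k i), h₂, h₂, h₂,
    smul_mul_smul_comm] at k1
  rw [e2, map_smul (π₂.k i), h₂] at k2
  simp only [map_smul, map_add, map_mul, toT_Xg, mono_mul_mono, smul_mono, add_apply, mono_apply,
    smul_apply, if_true, if_neg d1, mul_one, add_zero] at k0 k1 k2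
  have c0 := mul_right_cancel₀ hα (k0.trans (mul_comm _ _))
  have c1 := mul_right_cancel₀ hβ (k1.trans (mul_comm _ _))
  have c2 := mul_right_cancel₀ hγ (k2.trans (mul_comm _ _))
  funext s
  fin_cases s
  exacts [c0, c1, c2]

/-- The types of the two diagonal actions for each kind other than the first. -/
def kindTypes : Fin 9 → Fin 8 × Fin 8 :=
  ![(0, 0), (0, 5), (0, 6), (5, 7), (6, 7), (6, 4), (7, 1), (0, 4), (5, 1)]

omit [GenericParam q] in
theorem UqslMA.exists_weights {π : UqslMA q 2 (QSpace q 3)} {i j : Fin 2} (hij : i ≠ j)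
    {a b : Fin 3 → ℂ} (ha : ∀ s, π.k i (Xg q 3 s) = a s • Xg q 3 s)
    (hb : ∀ s, π.k j (Xg q 3 s) = b s • Xg q 3 s) :
    ∃ κ : Fin 2 → Fin 3 → ℂ, (∀ i s, π.k i (Xg q 3 s) = κ i s • Xg q 3 s) ∧
      κ i = a ∧ κ j = b := by
  refine ⟨fun t => if t = i then a else b, fun t s => ?_, if_pos rfl, if_neg hij.symm⟩
  by_cases ht : t = i
  · simp only [if_pos ht]; rw [ht, ha]
  · obtain rfl : t = j := by omega
    simp only [if_neg ht]; rw [hb]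

omit [GenericParam q] in
theorem UqslMA.exists_zpow_weights {π : UqslMA q 2 (QSpace q 3)} {c d : Fin 3 → ℤ}
    (h : ∃ i j : Fin 2, i ≠ j ∧
      (π.k i (Z1 q) = q ^ c 0 • Z1 q ∧ π.k i (Z2 q) = q ^ c 1 • Z2 q ∧
        π.k i (Z3 q) = q ^ c 2 • Z3 q) ∧
      (π.k j (Z1 q) = q ^ d 0 • Z1 q ∧ π.k j (Z2 q) = q ^ d 1 • Z2 q ∧
        π.k j (Z3 q) = q ^ d 2 • Z3 q)) :
    ∃ κ : Fin 2 → Fin 3 → ℂ, (∀ i s, π.k i (Xg q 3 s) = κ i s • Xg q 3 s) ∧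
      ∃ i j, i ≠ j ∧ (∀ s, κ i s = q ^ c s) ∧ ∀ s, κ j s = q ^ d s := by
  obtain ⟨i, j, hij, ⟨a0, a1, a2⟩, b0, b1, b2⟩ := h
  obtain ⟨κ, hκ, hi, hj⟩ := exists_weights (π := π) hij (a := fun s => q ^ c s)
    (b := fun s => q ^ d s)
    (fun s => by fin_cases s; exacts [a0, a1, a2]) (fun s => by fin_cases s; exacts [b0, b1, b2])
  exact ⟨κ, hκ, i, j, hij, congrFun hi, congrFun hj⟩

omit [GenericParam q] in
theorem exists_zpow_weights_of_tKind {π : UqslMA q 2 (QSpace q 3)} {n : Fin 9} (hn : n ≠ 0)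
    (h : TKind q n π) : ∃ κ : Fin 2 → Fin 3 → ℂ, (∀ i s, π.k i (Xg q 3 s) = κ i s • Xg q 3 s) ∧
      ∃ i j, i ≠ j ∧ (∀ s, κ i s = q ^ tyL (kindTypes n).1 s) ∧
        ∀ s, κ j s = q ^ tyL (kindTypes n).2 s := by
  refine UqslMA.exists_zpow_weights ?_
  have one : ∀ {y z : QSpace q 3}, y = z → y = (q ^ (0 : ℤ)) • z := fun {y z} h => by
    rw [zpow_zero, h]; exact (one_smul ℂ z).symm
  have pos1 : ∀ {y z : QSpace q 3}, y = q • z → y = (q ^ (1 : ℤ)) • z := fun h => by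
    rwa [zpow_one]
  have pos2 : ∀ {y z : QSpace q 3}, y = (q ^ (2 : ℕ)) • z → y = (q ^ (2 : ℤ)) • z := fun h => by
    rwa [zpow_ofNat]
  have neg1 : ∀ {y z : QSpace q 3}, y = q⁻¹ • z → y = (q ^ (-1 : ℤ)) • z := fun h => by
    rwa [zpow_neg_one]
  match n, h with
  | 0, _ => exact absurd rfl hn
  | 1, ⟨i, j, hij, a0, a1, a2, b0, b1, b2, _⟩ =>
    exact ⟨i, j, hij, ⟨a0, neg1 a1, neg1 a2⟩, pos1 b0, pos1 b1, pos2 b2⟩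
  | 2, ⟨i, j, hij, a0, a1, a2, b0, b1, b2, _⟩ =>
    exact ⟨i, j, hij, ⟨a0, neg1 a1, neg1 a2⟩, pos1 b0, neg1 b1, one b2⟩
  | 3, ⟨i, j, hij, a0, a1, a2, b0, b1, b2, _⟩ =>
    exact ⟨i, j, hij, ⟨pos1 a0, pos1 a1, pos2 a2⟩, one b0, pos1 b1, neg1 b2⟩
  | 4, ⟨i, j, hij, a0, a1, a2, b0, b1, b2, _⟩ =>
    exact ⟨i, j, hij, ⟨pos1 a0, neg1 a1, one a2⟩, one b0, pos1 b1, neg1 b2⟩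
  | 5, ⟨i, j, hij, a0, a1, a2, b0, b1, b2, _⟩ =>
    exact ⟨i, j, hij, ⟨pos1 a0, neg1 a1, one a2⟩, pos1 b0, pos2 b1, neg1 b2⟩
  | 6, ⟨i, j, hij, a0, a1, a2, b0, b1, b2, _⟩ =>
    exact ⟨i, j, hij, ⟨one a0, pos1 a1, neg1 a2⟩, pos1 b0, b1, neg1 b2⟩
  | 7, ⟨i, j, hij, a0, a1, a2, b0, b1, b2, _⟩ =>
    exact ⟨i, j, hij, ⟨a0, neg1 a1, neg1 a2⟩, pos1 b0, pos2 b1, neg1 b2⟩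
  | 8, ⟨i, j, hij, a0, a1, a2, b0, b1, b2, _⟩ =>
    exact ⟨i, j, hij, ⟨pos1 a0, pos1 a1, pos2 a2⟩, pos1 b0, b1, neg1 b2⟩

omit [GenericParam q] in
theorem exists_weights_of_tKind {π : UqslMA q 2 (QSpace q 3)} {n : Fin 9} (h : TKind q n π) :
    ∃ κ : Fin 2 → Fin 3 → ℂ, (∀ i s, π.k i (Xg q 3 s) = κ i s • Xg q 3 s) ∧
      ((n = 0 ∧ ∀ i s, κ i s ^ 2 = 1) ∨ (n ≠ 0 ∧ ∃ i j, i ≠ j ∧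
        (∀ s, κ i s = q ^ tyL (kindTypes n).1 s) ∧ ∀ s, κ j s = q ^ tyL (kindTypes n).2 s)) := by
  by_cases hn : n = 0
  · subst hn
    obtain ⟨i, j, hij, a, b, ha, hb, hi, hj, -⟩ := h
    obtain ⟨κ, hκ, hi, hj⟩ := UqslMA.exists_weights hij hi hj
    refine ⟨κ, hκ, Or.inl ⟨rfl, fun t s => ?_⟩⟩
    have sq : ∀ {c : ℂ}, c = 1 ∨ c = -1 → c ^ 2 = 1 := by rintro c (rfl | rfl) <;> norm_num
    by_cases ht : t = i
    · rw [ht, hi]; exact sq (ha s)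
    · obtain rfl : t = j := by omega
      rw [hj]; exact sq (hb s)
  · obtain ⟨κ, hκ, h⟩ := exists_zpow_weights_of_tKind hn h
    exact ⟨κ, hκ, Or.inr ⟨hn, h⟩⟩

theorem UqslMA.Iso.kind_eq {π₁ π₂ : UqslMA q 2 (QSpace q 3)} (h : π₁.Iso π₂) {a b : Fin 9}
    (ha : TKind q a π₁) (hb : TKind q b π₂) : a = b := by
  obtain ⟨κ, h₁, h₂⟩ := exists_weights_of_tKind ha
  obtain ⟨κ', h₃, h₄⟩ := exists_weights_of_tKind hb
  obtain rfl : κ = κ' := funext fun i => h.weight_eq (h₁ i) (h₃ i)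
  have hne : ∀ {i : Fin 2} {c : Fin 8}, (∀ i s, κ i s ^ 2 = 1) → ¬ ∀ s, κ i s = q ^ tyL c s := by
    intro i c h1 h2
    obtain ⟨s, hs⟩ := (by decide : ∀ a : Fin 8, ∃ s, tyL a s ≠ 0) c
    have h3 := h1 i s
    rw [h2, ← zpow_natCast, ← zpow_mul, zpow_eq_one_iff_of_generic] at h3
    simp at h3
    exact hs h3
  have inj : ∀ {c c' : Fin 8} {x : Fin 3 → ℂ}, (∀ s, x s = q ^ tyL c s) →
      (∀ s, x s = q ^ tyL c' s) → c = c' := by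
    intro c c' x h1 h2
    have h3 : ∀ s, tyL c s = tyL c' s := fun s => zpow_inj_of_generic ((h1 s).symm.trans (h2 s))
    exact (by decide : ∀ c c', (∀ s, tyL c s = tyL c' s) → c = c') c c' h3
  rcases h₂ with ⟨rfl, h₂⟩ | ⟨ha0, i, j, hij, hi, hj⟩ <;>
    rcases h₄ with ⟨rfl, h₄⟩ | ⟨hb0, i', j', hij', hi', hj'⟩
  · rfl
  · exact absurd hi' (hne h₂)
  · exact absurd hi (hne h₄)
  · have h5 : (i = i' ∧ j = j') ∨ (i = j' ∧ j = i') := by omega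
    have h6 : ((kindTypes a).1 = (kindTypes b).1 ∧ (kindTypes a).2 = (kindTypes b).2) ∨
        (kindTypes a).1 = (kindTypes b).2 ∧ (kindTypes a).2 = (kindTypes b).1 := by
      rcases h5 with ⟨rfl, rfl⟩ | ⟨rfl, rfl⟩
      · exact Or.inl ⟨inj hi hi', inj hj hj'⟩
      · exact Or.inr ⟨inj hi hj', inj hj hi'⟩
    revert ha0 hb0 h6
    clear * -
    revert a b
    decide

end

/-- Classification of `U_q(sl(3))`-module-algebra structures on the quantum 3-space:
every structure is isomorphic to one of the nine kinds, and no two structures of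
different kinds are isomorphic. -/
theorem classification_Uqsl3_on_Aq3 (q : ℂ) (hq : q ≠ 0)
    (hq' : ∀ N : ℕ, 0 < N → q ^ N ≠ 1) :
    (∀ π : UqslMA q 2 (QSpace q 3), ∃ π' : UqslMA q 2 (QSpace q 3),
      π.Iso π' ∧ ∃ a : Fin 9, TKind q a π') ∧
    (∀ (π₁ π₂ : UqslMA q 2 (QSpace q 3)) (a b : Fin 9),
      TKind q a π₁ → TKind q b π₂ → π₁.Iso π₂ → a = b) := by
  have : GenericParam q := { out := hq, pow_ne_one := hq' }
  refine ⟨fun π => ?_, fun π₁ π₂ a b ha hb h => h.kind_eq ha hb⟩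
  obtain ⟨π₁, h₁, lam, u, w, D⟩ := π.exists_iso_diagData
  obtain ⟨π₂, h₂, n, hn⟩ := D.exists_tKind
  exact ⟨π₂, h₁.trans h₂, n, hn⟩
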